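/- Let p ∈ (3/2, 4) and r ∈ (2, ∞). Then there exists a constant C_{p,r} > 0 independent of the dimension d ∈ ℕ such that for every f ∈ ℓ^p(ℤ^d) one has ‖ V_r(𝓜_t f : t > 0) ‖_{ℓ^p(ℤ^d)} ≤ C_{p,r} ‖f‖_{ℓ^p(ℤ^d)}. -/

import Mathlib

open MeasureTheory ENNReal

/-- The ℓ^p(ℤ^d) "norm" of a nonnegative (ℝ≥0∞-valued) function, `p ∈ (0,∞]`. -/
noncomputable def lpZ (d : ℕ) (p : ℝ≥0∞) (g : (Fin d → ℤ) → ℝ≥0∞) : ℝ≥0∞ :=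
  if p = ∞ then ⨆ x, g x else (∑' x, g x ^ p.toReal) ^ (1 / p.toReal)

/-- `x ↦ ‖f x‖₊` as an ℝ≥0∞-valued function. -/
noncomputable def nnC {d : ℕ} (f : (Fin d → ℤ) → ℂ) : (Fin d → ℤ) → ℝ≥0∞ :=
  fun x => (‖f x‖₊ : ℝ≥0∞)

/-- The discrete Hardy–Littlewood averaging operator over the cube `Q_t = [-t,t]^d`. -/
noncomputable def cubeAvg (d : ℕ) (t : ℝ) (f : (Fin d → ℤ) → ℂ) (x : Fin d → ℤ) : ℂ :=
  (((2 * ⌊t⌋ + 1) ^ d : ℤ) : ℂ)⁻¹ *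
    ∑ y ∈ Finset.Icc (fun _ => -⌊t⌋ : Fin d → ℤ) (fun _ => ⌊t⌋), f (x - y)

/-- The `r`-variation seminorm of `t ↦ a t` over the index set `Z ⊆ ℝ`:
the supremum over all finite increasing sequences `t_0 < … < t_J` in `Z` of
`(Σ_j |a(t_{j+1}) - a(t_j)|^r)^{1/r}`. -/
noncomputable def varSem (r : ℝ) (Z : Set ℝ) (a : ℝ → ℂ) : ℝ≥0∞ :=
  ⨆ (J : ℕ) (u : Fin (J + 1) → ℝ) (_ : StrictMono u) (_ : ∀ j, u j ∈ Z),
    (∑ j : Fin J, (‖a (u j.succ) - a (u j.castSucc)‖₊ : ℝ≥0∞) ^ r) ^ (1 / r)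


open MeasureTheory ENNReal
namespace DF
open Finset

section basics
variable {X : Type*} [Fintype X]

noncomputable def nP (p : ℝ) (f : X → ℝ) : ℝ := (∑ x, |f x| ^ p) ^ (1 / p)

lemma nP_nonneg (p : ℝ) (f : X → ℝ) : 0 ≤ nP p f := by unfold nP; positivity

lemma nP_rpow {p : ℝ} (hp : 0 < p) (f : X → ℝ) : nP p f ^ p = ∑ x, |f x| ^ p := by
  unfold nP
  rw [← Real.rpow_mul (by positivity), one_div_mul_cancel hp.ne', Real.rpow_one]

lemma nP_mono {p : ℝ} (hp : 0 < p) {f g : X → ℝ} (h : ∀ x, |f x| ≤ g x) : nP p f ≤ nP p g := by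
  unfold nP
  apply Real.rpow_le_rpow (by positivity) _ (by positivity)
  apply sum_le_sum
  intro x _
  exact Real.rpow_le_rpow (abs_nonneg _) ((h x).trans (le_abs_self _)) hp.le

lemma nP_abs (p : ℝ) (f : X → ℝ) : nP p (fun x => |f x|) = nP p f := by simp [nP]

lemma nP_add_le {p : ℝ} (hp : 1 ≤ p) (f g : X → ℝ) :
    nP p (fun x => f x + g x) ≤ nP p f + nP p g := Real.Lp_add_le _ _ _ hp

lemma nP_smul {p : ℝ} (hp : 0 < p) (c : ℝ) (f : X → ℝ) :
    nP p (fun x => c * f x) = |c| * nP p f := by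
  unfold nP
  simp_rw [abs_mul, Real.mul_rpow (abs_nonneg _) (abs_nonneg _)]
  rw [← mul_sum, Real.mul_rpow (by positivity) (by positivity), ← Real.rpow_mul (by positivity),
    mul_one_div_cancel hp.ne', Real.rpow_one]

lemma nP_zero {p : ℝ} (hp : 0 < p) : nP p (fun _ : X => (0:ℝ)) = 0 := by
  simp [nP, hp.ne']

lemma nP_sum_le {ι : Type*} {p : ℝ} (hp : 1 ≤ p) (s : Finset ι) (f : ι → X → ℝ) :
    nP p (fun x => ∑ i ∈ s, f i x) ≤ ∑ i ∈ s, nP p (f i) := by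
  classical
  induction s using Finset.induction_on with
  | empty => simp [nP_zero (X := X) (zero_lt_one.trans_le hp)]
  | insert a s ha ih =>
    simp_rw [sum_insert ha]
    exact (nP_add_le hp _ _).trans (by linarith)

lemma nP_holder {p q : ℝ} (h : p.HolderConjugate q) (f g : X → ℝ) :
    ∑ x, f x * g x ≤ nP p f * nP q g := Real.inner_le_Lp_mul_Lq _ _ _ h

lemma nP_le_of {p C : ℝ} (hp : 0 < p) (hC : 0 ≤ C) {f : X → ℝ}
    (h : ∑ x, |f x| ^ p ≤ C ^ p) : nP p f ≤ C := by
  rw [← nP_rpow hp] at h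
  exact (Real.rpow_le_rpow_iff (nP_nonneg _ _) hC hp).1 h

/-- `nP q (|f|^a) = nP (a q) f ^ a`. -/
lemma nP_pow {q a : ℝ} (ha : 0 < a) (hq : 0 < q) (f : X → ℝ) :
    nP q (fun x => |f x| ^ a) = nP (a * q) f ^ a := by
  unfold nP
  rw [← Real.rpow_mul (by positivity)]
  congr 1
  · apply sum_congr rfl
    intro x _
    rw [abs_of_nonneg (by positivity), ← Real.rpow_mul (abs_nonneg _)]
  · field_simp

variable {ι : Type*}

noncomputable def sq (s : Finset ι) (F : ι → X → ℝ) (x : X) : ℝ := √(∑ i ∈ s, (F i x) ^ 2)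

lemma sq_nonneg' (s : Finset ι) (F : ι → X → ℝ) (x : X) : 0 ≤ sq s F x := Real.sqrt_nonneg _

lemma sq_sq (s : Finset ι) (F : ι → X → ℝ) (x : X) : sq s F x ^ 2 = ∑ i ∈ s, (F i x) ^ 2 :=
  Real.sq_sqrt (sum_nonneg fun _ _ => sq_nonneg _)

lemma sq_add_le (s : Finset ι) (F G : ι → X → ℝ) (x : X) :
    sq s (fun i x => F i x + G i x) x ≤ sq s F x + sq s G x := by
  have := Real.Lp_add_le s (fun i => F i x) (fun i => G i x) (p := 2) (by norm_num)
  simpa [sq, Real.sqrt_eq_rpow] using this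

lemma sq_sum_le {κ : Type*} (s : Finset ι) (t : Finset κ) (F : κ → ι → X → ℝ) (x : X) :
    sq s (fun i x => ∑ j ∈ t, F j i x) x ≤ ∑ j ∈ t, sq s (F j) x := by
  classical
  induction t using Finset.induction_on with
  | empty => simp [sq]
  | insert a t ha ih =>
    simp_rw [sum_insert ha]
    exact (sq_add_le s _ _ x).trans (by linarith)

lemma abs_le_sq {s : Finset ι} (F : ι → X → ℝ) (x : X) {i : ι} (hi : i ∈ s) :
    |F i x| ≤ sq s F x := by
  rw [← Real.sqrt_sq_eq_abs]
  exact Real.sqrt_le_sqrt (single_le_sum (f := fun i => F i x ^ 2) (fun _ _ => sq_nonneg _) hi)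

lemma sum_mul_le_sq (s : Finset ι) (F G : ι → X → ℝ) (x : X) :
    ∑ i ∈ s, F i x * G i x ≤ sq s F x * sq s G x :=
  Real.sum_mul_le_sqrt_mul_sqrt s _ _

end basics

section interp
variable {X ι : Type*} [Fintype X]
open Complex

/-- complex exponential power `|a|^w sgn a`. -/
noncomputable def cp (a : ℝ) (w : ℂ) : ℂ := (SignType.sign a : ℝ) * exp (w * (Real.log |a| : ℝ))

lemma cp_norm (a : ℝ) (w : ℂ) : ‖cp a w‖ = |(SignType.sign a : ℝ)| * |a| ^ w.re := by
  unfold cp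
  rw [norm_mul, Complex.norm_real, Real.norm_eq_abs, norm_exp]
  rcases eq_or_ne a 0 with rfl | h
  · simp
  · congr 1
    rw [Real.rpow_def_of_pos (abs_pos.2 h)]
    simp [mul_comm]

lemma cp_norm_rpow (a : ℝ) (w : ℂ) {q : ℝ} (hq : 0 < q) (hw : 0 < w.re) :
    ‖cp a w‖ ^ q = |a| ^ (w.re * q) := by
  rw [cp_norm]
  rcases eq_or_ne a 0 with rfl | h
  · simp [hq.ne', hw.ne', Real.zero_rpow]
  · have : |(SignType.sign a : ℝ)| = 1 := by
      rcases lt_or_gt_of_ne h with h | h <;> simp [h]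
    rw [this, one_mul, ← Real.rpow_mul (abs_nonneg _)]

lemma cp_real (a : ℝ) {w : ℂ} (hw : w = 1) : cp a w = a := by
  subst hw
  unfold cp
  rcases eq_or_ne a 0 with rfl | h
  · simp
  · rw [one_mul, ← Complex.ofReal_exp, Real.exp_log (abs_pos.2 h), ← Complex.ofReal_mul]
    congr 1
    exact sign_mul_abs a

lemma lin_expand [DecidableEq X] (T : (X → ℝ) →ₗ[ℝ] (ι → X → ℝ)) (f : X → ℝ) (i : ι) (x : X) :
    T f i x = ∑ y, f y * T (Pi.single y 1) i x := by
  rw [LinearMap.pi_apply_eq_sum_univ T f]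
  simp only [Finset.sum_apply, Pi.smul_apply, smul_eq_mul]
  apply sum_congr rfl
  intro y _
  have : (fun j => if y = j then (1:ℝ) else 0) = Pi.single y (1:ℝ) := by
    ext j; simp [Pi.single_apply, eq_comm]
  rw [this]

lemma bdry [DecidableEq X] (s : Finset ι) (T : (X → ℝ) →ₗ[ℝ] (ι → X → ℝ)) {q q' A : ℝ}
    (hq : q.HolderConjugate q') (hA : 0 ≤ A)
    (H : ∀ f, nP q (sq s (T f)) ≤ A * nP q f)
    (U : ι → X → ℝ) (hU : ∀ x, sq s U x ≤ 1) (g c : X → ℂ) :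
    ‖∑ x, c x * ∑ i ∈ s, (∑ y, g y * (T (Pi.single y 1) i x : ℝ)) * (U i x : ℝ)‖
      ≤ 2 * A * nP q (fun x => ‖g x‖) * nP q' (fun x => ‖c x‖) := by
  have key : ∀ x, ‖∑ i ∈ s, (∑ y, g y * (T (Pi.single y 1) i x : ℝ)) * (U i x : ℝ)‖ ≤
      sq s (T fun y => (g y).re) x + sq s (T fun y => (g y).im) x := by
    intro x
    have b : ∀ h : X → ℝ, |∑ i ∈ s, T h i x * U i x| ≤ sq s (T h) x := by
      intro h
      have h1 := sum_mul_le_sq s (T h) U x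
      have h2 := sum_mul_le_sq s (fun i x => - T h i x) U x
      have h3 : sq s (fun i x => - T h i x) x = sq s (T h) x := by simp [sq]
      rw [h3] at h2
      simp only [neg_mul, sum_neg_distrib] at h2
      have h4 : sq s (T h) x * sq s U x ≤ sq s (T h) x :=
        mul_le_of_le_one_right (sq_nonneg' _ _ _) (hU x)
      rw [abs_le]; constructor <;> linarith
    refine (Complex.norm_le_abs_re_add_abs_im _).trans (add_le_add ?_ ?_)
    · refine le_trans (le_of_eq ?_) (b _)
      congr 1
      simp only [re_sum, re_mul_ofReal]
      exact sum_congr rfl fun i _ => by rw [lin_expand T]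
    · refine le_trans (le_of_eq ?_) (b _)
      congr 1
      simp only [im_sum, im_mul_ofReal]
      exact sum_congr rfl fun i _ => by rw [lin_expand T]
  calc _ ≤ ∑ x, (sq s (T fun y => (g y).re) x + sq s (T fun y => (g y).im) x) * ‖c x‖ := by
        refine (norm_sum_le _ _).trans (sum_le_sum fun x _ => ?_)
        rw [norm_mul, mul_comm]
        exact mul_le_mul_of_nonneg_right (key x) (norm_nonneg _)
    _ ≤ nP q (fun x => sq s (T fun y => (g y).re) x + sq s (T fun y => (g y).im) x) *
        nP q' (fun x => ‖c x‖) := nP_holder hq _ _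
    _ ≤ _ := by
        apply mul_le_mul_of_nonneg_right _ (nP_nonneg _ _)
        refine (nP_add_le hq.lt.le _ _).trans ?_
        have h1 : nP q (fun y => (g y).re) ≤ nP q (fun y => ‖g y‖) :=
          nP_mono hq.pos fun x => Complex.abs_re_le_norm _
        have h2 : nP q (fun y => (g y).im) ≤ nP q (fun y => ‖g y‖) :=
          nP_mono hq.pos fun x => Complex.abs_im_le_norm _
        have h3 := H fun y => (g y).re
        have h4 := H fun y => (g y).im
        nlinarith [mul_le_mul_of_nonneg_left h1 hA, mul_le_mul_of_nonneg_left h2 hA]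

lemma nP_cp {a : X → ℝ} {w : ℂ} {q P : ℝ} (hq : 0 < q) (hw : w.re * q = P) (hP : 0 < P) :
    nP q (fun x => ‖cp (a x) w‖) = (∑ x, |a x| ^ P) ^ (1 / q) := by
  have hw' : 0 < w.re := by
    by_contra h; push Not at h; nlinarith
  unfold nP
  congr 1
  apply sum_congr rfl
  intro x _
  rw [abs_of_nonneg (norm_nonneg _), cp_norm_rpow _ _ hq hw', hw]

theorem interp (s : Finset ι) (T : (X → ℝ) →ₗ[ℝ] (ι → X → ℝ)) {p0 p1 p θ A0 A1 : ℝ}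
    (h0 : 1 < p0) (h1 : 1 < p1) (hp : 1 < p) (hθ : 0 ≤ θ) (hθ1 : θ ≤ 1)
    (hpe : 1 / p = (1 - θ) / p0 + θ / p1) (hA0 : 0 ≤ A0) (hA1 : 0 ≤ A1)
    (H0 : ∀ f, nP p0 (sq s (T f)) ≤ A0 * nP p0 f)
    (H1 : ∀ f, nP p1 (sq s (T f)) ≤ A1 * nP p1 f) (f : X → ℝ) :
    nP p (sq s (T f)) ≤ 2 * A0 ^ (1 - θ) * A1 ^ θ * nP p f := by
  classical
  set F := sq s (T f) with hF
  have hFn : ∀ x, 0 ≤ F x := fun x => sq_nonneg' _ _ _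
  set U : ι → X → ℝ := fun i x => T f i x / F x with hU
  have hU1 : ∀ x, sq s U x ≤ 1 := by
    intro x
    have : sq s U x = F x / F x := by
      simp only [hU, sq, div_pow]
      rw [← sum_div, Real.sqrt_div' _ (sq_nonneg _), Real.sqrt_sq (hFn x)]
      rfl
    rw [this]; exact div_self_le_one _
  have hp0' : (0:ℝ) < p := by linarith
  let a : ℂ → ℂ := fun z => p * ((1 - z) / p0 + z / p1)
  let b : ℂ → ℂ := fun z => p * ((1 - z) * (1 - 1 / p0) + z * (1 - 1 / p1))
  let Φ : ℂ → ℂ := fun z => ∑ x, cp (F x) (b z) *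
    ∑ i ∈ s, (∑ y, cp (f y) (a z) * (T (Pi.single y 1) i x : ℝ)) * (U i x : ℝ)
  set P := ∑ x, |f x| ^ p with hPdef
  set Q := ∑ x, |F x| ^ p with hQdef
  have hP0 : 0 ≤ P := by positivity
  have hQ0 : 0 ≤ Q := by positivity
  have are : ∀ z : ℂ, (a z).re = p * ((1 - z.re) / p0 + z.re / p1) := by
    intro z; simp [a]
  have bre : ∀ z : ℂ, (b z).re = p * ((1 - z.re) * (1 - 1 / p0) + z.re * (1 - 1 / p1)) := by
    intro z
    have e1 : (1 - 1 / (p0:ℂ)) = ((1 - 1 / p0 : ℝ) : ℂ) := by push_cast; ring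
    have e2 : (1 - 1 / (p1:ℂ)) = ((1 - 1 / p1 : ℝ) : ℂ) := by push_cast; ring
    simp only [b, e1, e2]
    simp
  have c0 : p0.HolderConjugate (p0 / (p0 - 1)) := Real.HolderConjugate.conjExponent h0
  have c1 : p1.HolderConjugate (p1 / (p1 - 1)) := Real.HolderConjugate.conjExponent h1
  have q0 : 0 < p0 - 1 := by linarith
  have q1 : 0 < p1 - 1 := by linarith
  have p00 : 0 < p0 := by linarith
  have p10 : 0 < p1 := by linarith
  have B0 : ∀ z ∈ re ⁻¹' {(0:ℝ)}, ‖Φ z‖ ≤ 2 * A0 * P ^ (1 / p0) * Q ^ (1 - 1 / p0) := by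
    intro z hz
    have hz : z.re = 0 := hz
    refine (bdry s T c0 hA0 H0 U hU1 _ _).trans (le_of_eq ?_)
    rw [nP_cp p00 (P := p) (by rw [are, hz]; field_simp; ring) hp0',
      nP_cp c0.symm.pos (P := p) (by rw [bre, hz]; field_simp; ring) hp0']
    congr 2
    field_simp
  have B1 : ∀ z ∈ re ⁻¹' {(1:ℝ)}, ‖Φ z‖ ≤ 2 * A1 * P ^ (1 / p1) * Q ^ (1 - 1 / p1) := by
    intro z hz
    have hz : z.re = 1 := hz
    refine (bdry s T c1 hA1 H1 U hU1 _ _).trans (le_of_eq ?_)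
    rw [nP_cp p10 (P := p) (by rw [are, hz]; field_simp; ring) hp0',
      nP_cp c1.symm.pos (P := p) (by rw [bre, hz]; field_simp; ring) hp0']
    congr 2
    field_simp
  have dcp : ∀ (α : ℝ) (w : ℂ → ℂ), Differentiable ℂ w → Differentiable ℂ fun z => cp α (w z) := by
    intro α w hw; unfold cp; fun_prop
  have da : Differentiable ℂ a := by simp only [a]; fun_prop
  have db : Differentiable ℂ b := by simp only [b]; fun_prop
  have dΦ : Differentiable ℂ Φ := by
    have e1 := fun x => dcp (F x) b db
    have e2 := fun x => dcp (f x) a da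
    simp only [Φ]
    fun_prop
  have bcp : ∀ (α u v : ℝ) (w : ℂ → ℂ), (∀ z, (w z).re = u + v * z.re) →
      ∃ C, ∀ z : ℂ, 0 ≤ z.re → z.re ≤ 1 → ‖cp α (w z)‖ ≤ C := by
    intro α u v w hw
    refine ⟨|(SignType.sign α : ℝ)| * Real.exp ((|u| + |v|) * |Real.log (|α|)|), ?_⟩
    intro z hz0 hz1
    unfold cp
    rw [norm_mul, Complex.norm_real, Real.norm_eq_abs, norm_exp]
    gcongr
    rw [re_mul_ofReal, hw]
    refine (le_abs_self _).trans ?_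
    rw [abs_mul]
    gcongr
    refine (abs_add_le _ _).trans ?_
    rw [abs_mul, abs_of_nonneg hz0]
    nlinarith [abs_nonneg v]
  have bdd : BddAbove ((norm ∘ Φ) '' HadamardThreeLines.verticalClosedStrip 0 1) := by
    have e1 := fun x => bcp (F x) (p * (1 - 1/p0)) (p * (1/p0 - 1/p1)) b
      (by intro z; rw [bre]; ring)
    have e2 := fun x => bcp (f x) (p * (1/p0)) (p * (1/p1 - 1/p0)) a
      (by intro z; rw [are]; ring)
    choose C1 hC1 using e1
    choose C2 hC2 using e2
    refine ⟨∑ x, C1 x * ∑ i ∈ s, (∑ y, C2 y * |T (Pi.single y 1) i x|) * |U i x|, ?_⟩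
    rintro _ ⟨z, hz, rfl⟩
    have hz : 0 ≤ z.re ∧ z.re ≤ 1 := hz
    simp only [Function.comp, Φ]
    refine (norm_sum_le _ _).trans (sum_le_sum fun x _ => ?_)
    rw [norm_mul]
    refine mul_le_mul (hC1 x z hz.1 hz.2) ?_ (norm_nonneg _) ((norm_nonneg _).trans (hC1 x z hz.1 hz.2))
    refine (norm_sum_le _ _).trans (sum_le_sum fun i _ => ?_)
    rw [norm_mul, Complex.norm_real, Real.norm_eq_abs]
    gcongr
    refine (norm_sum_le _ _).trans (sum_le_sum fun y _ => ?_)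
    rw [norm_mul, Complex.norm_real, Real.norm_eq_abs]
    gcongr
    exact hC2 y z hz.1 hz.2
  have main := HadamardThreeLines.norm_le_interp_of_mem_verticalClosedStrip' (f := Φ) (z := (θ:ℂ))
    zero_lt_one (by simp [HadamardThreeLines.verticalClosedStrip, hθ, hθ1]) dΦ.diffContOnCl bdd B0 B1
  have aθ : a θ = 1 := by
    have : (a θ) = ((p * ((1 - θ) / p0 + θ / p1) : ℝ) : ℂ) := by simp only [a]; push_cast; ring
    rw [this, ← hpe, mul_one_div_cancel hp0'.ne']; simp
  have bθ : b θ = ((p - 1 : ℝ) : ℂ) := by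
    have : (b θ) = ((p * (1 - ((1 - θ) / p0 + θ / p1)) : ℝ) : ℂ) := by
      simp only [b]; push_cast; ring
    rw [this, ← hpe]; congr 1; field_simp
  have ΦQ : Φ θ = (Q : ℂ) := by
    simp only [Φ, Q, aθ, bθ]
    rw [Complex.ofReal_sum]
    apply sum_congr rfl
    intro x _
    have e : ∀ i, (∑ y, cp (f y) 1 * (T (Pi.single y 1) i x : ℝ)) = ((T f i x : ℝ) : ℂ) := by
      intro i
      rw [lin_expand T f]; push_cast
      exact sum_congr rfl fun y _ => by rw [cp_real _ rfl]
    simp_rw [e]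
    have e2 : (∑ i ∈ s, ((T f i x : ℝ) : ℂ) * (U i x : ℝ)) = ((F x : ℝ) : ℂ) := by
      have : ∑ i ∈ s, T f i x * U i x = F x := by
        have : ∑ i ∈ s, T f i x * U i x = F x ^ 2 / F x := by
          rw [hF, sq_sq, sum_div]
          exact sum_congr rfl fun i _ => by simp only [hU]; rw [← hF]; ring
        rw [this, pow_two, mul_self_div_self]
      rw [← this]; push_cast; rfl
    rw [e2]
    unfold cp
    rw [← Complex.ofReal_mul, ← Complex.ofReal_exp, ← Complex.ofReal_mul, ← Complex.ofReal_mul]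
    congr 1
    rcases (hFn x).eq_or_lt with h | h
    · rw [← h]; simp [hp0'.ne']
    · rw [abs_of_pos h]
      simp only [h, sign_pos, SignType.coe_one, one_mul]
      rw [mul_comm (p-1), ← Real.rpow_def_of_pos h, Real.rpow_sub_one h.ne', div_mul_cancel₀ _ h.ne']
  rw [ΦQ] at main
  simp only [ofReal_re, sub_zero, div_one, Complex.norm_real, Real.norm_eq_abs, abs_of_nonneg hQ0] at main
  have conv : (2 * A0 * P ^ (1 / p0) * Q ^ (1 - 1 / p0)) ^ (1 - θ) *
      (2 * A1 * P ^ (1 / p1) * Q ^ (1 - 1 / p1)) ^ θ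
      = 2 * A0 ^ (1 - θ) * A1 ^ θ * (P ^ (1 / p) * Q ^ (1 - 1 / p)) := by
    have t1 : 0 ≤ 1 - 1 / p0 := by rw [sub_nonneg, div_le_one p00]; exact h0.le
    have t2 : 0 ≤ 1 - 1 / p1 := by rw [sub_nonneg, div_le_one p10]; exact h1.le
    have t3 : 0 ≤ 1 - θ := by linarith
    rw [Real.mul_rpow (by positivity) (by positivity), Real.mul_rpow (by positivity) (by positivity),
      Real.mul_rpow (by positivity) (by positivity), Real.mul_rpow (by positivity) (by positivity),
      Real.mul_rpow (by positivity) (by positivity), Real.mul_rpow (by positivity) (by positivity)]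
    simp only [← Real.rpow_mul hP0, ← Real.rpow_mul hQ0]
    have e2 : (2:ℝ) ^ (1 - θ) * 2 ^ θ = 2 := by
      rw [← Real.rpow_add two_pos]; simp
    have eP : P ^ (1 / p0 * (1 - θ)) * P ^ (1 / p1 * θ) = P ^ (1 / p) := by
      rw [← Real.rpow_add_of_nonneg hP0 (by positivity) (by positivity), hpe]
      congr 1; ring
    have eQ : Q ^ ((1 - 1 / p0) * (1 - θ)) * Q ^ ((1 - 1 / p1) * θ) = Q ^ (1 - 1 / p) := by
      rw [← Real.rpow_add_of_nonneg hQ0 (by positivity) (by positivity), hpe]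
      congr 1; ring
    rw [← eP, ← eQ]
    linear_combination (A0 ^ (1 - θ) * A1 ^ θ * (P ^ (1 / p0 * (1 - θ)) * P ^ (1 / p1 * θ) *
      (Q ^ ((1 - 1 / p0) * (1 - θ)) * Q ^ ((1 - 1 / p1) * θ)))) * e2
  rw [conv] at main
  have hnF : nP p F = Q ^ (1 / p) := rfl
  have hnf : nP p f = P ^ (1 / p) := rfl
  rw [hnF, hnf]
  rcases hQ0.eq_or_lt with h | h
  · rw [← h, Real.zero_rpow (by positivity)]; positivity
  · have e3 : Q = Q ^ (1 / p) * Q ^ (1 - 1 / p) := by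
      rw [← Real.rpow_add h]; simp
    have h4 : 0 < Q ^ (1 - 1 / p) := by positivity
    have main' : Q ^ (1 / p) * Q ^ (1 - 1 / p) ≤
        2 * A0 ^ (1 - θ) * A1 ^ θ * P ^ (1 / p) * Q ^ (1 - 1 / p) := by
      rw [← e3]; linarith
    exact le_of_mul_le_mul_right main' h4

end interp
end DF

open MeasureTheory ENNReal
namespace DF
open Finset

section mart
variable {X : Type*} [Fintype X]

open Classical in
/-- conditional expectation with respect to a partition -/
noncomputable def cE (s : Setoid X) (f : X → ℝ) (x : X) : ℝ :=
  (∑ y, if s.r x y then f y else 0) / (∑ y, if s.r x y then 1 else 0)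

lemma cE_meas (s : Setoid X) (f : X → ℝ) {x y : X} (h : s.r x y) : cE s f x = cE s f y := by
  unfold cE
  have : ∀ z, s.r x z ↔ s.r y z :=
    fun z => ⟨fun h1 => s.iseqv.trans (s.iseqv.symm h) h1, fun h1 => s.iseqv.trans h h1⟩
  have e : s.r x = s.r y := funext fun z => propext (this z)
  rw [e]

open Classical in
lemma cE_den_pos (s : Setoid X) (x : X) : 0 < ∑ y, (if s.r x y then (1:ℝ) else 0) := by
  apply sum_pos' (fun y _ => by split_ifs <;> norm_num)
  exact ⟨x, mem_univ _, by simp⟩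

lemma cE_pair (s : Setoid X) (f : X → ℝ) {φ : X → ℝ} (hφ : ∀ x y, s.r x y → φ x = φ y) :
    ∑ x, φ x * cE s f x = ∑ x, φ x * f x := by
  classical
  have h1 : ∀ x, φ x * cE s f x =
      ∑ y, if s.r x y then f y * φ y * (1 / ∑ z, (if s.r y z then (1:ℝ) else 0)) else 0 := by
    intro x
    unfold cE
    rw [div_eq_mul_one_div, ← mul_assoc, mul_sum, sum_mul]
    apply sum_congr rfl
    intro y _
    split_ifs with h
    · have : ∀ z, s.r x z ↔ s.r y z :=
        fun z => ⟨fun h1 => s.iseqv.trans (s.iseqv.symm h) h1, fun h1 => s.iseqv.trans h h1⟩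
      simp_rw [this]
      rw [hφ x y h]; ring
    · simp
  simp_rw [h1]
  rw [sum_comm]
  apply sum_congr rfl
  intro y _
  have : ∀ x, s.r x y ↔ s.r y x := fun x => ⟨fun h => s.iseqv.symm h, fun h => s.iseqv.symm h⟩
  simp_rw [this]
  have h2 := cE_den_pos s y
  set D := ∑ z, (if s.r y z then (1:ℝ) else 0)
  have : (∑ x, if s.r y x then f y * φ y * (1 / D) else 0) = f y * φ y * (1 / D) * D := by
    simp only [D]
    rw [mul_sum]; apply sum_congr rfl; intro x _; split_ifs <;> simp
  rw [this]; field_simp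

lemma cE_add (s : Setoid X) (f g : X → ℝ) (x : X) : cE s (f + g) x = cE s f x + cE s g x := by
  classical
  unfold cE
  rw [← add_div, ← sum_add_distrib]
  congr 1; apply sum_congr rfl; intro y _; split_ifs <;> simp

lemma cE_smul (s : Setoid X) (c : ℝ) (f : X → ℝ) (x : X) : cE s (c • f) x = c * cE s f x := by
  classical
  unfold cE
  rw [← mul_div_assoc, mul_sum]
  congr 1; apply sum_congr rfl; intro y _; split_ifs <;> simp

/-- as a linear map -/
noncomputable def cL (s : Setoid X) : (X → ℝ) →ₗ[ℝ] (X → ℝ) where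
  toFun := cE s
  map_add' f g := by ext x; exact cE_add s f g x
  map_smul' c f := by ext x; exact cE_smul s c f x

lemma cL_apply (s : Setoid X) (f : X → ℝ) : cL s f = cE s f := rfl

lemma cE_mono (s : Setoid X) {f g : X → ℝ} (h : ∀ x, f x ≤ g x) (x : X) : cE s f x ≤ cE s g x := by
  classical
  unfold cE
  apply div_le_div_of_nonneg_right _ (cE_den_pos s x).le
  apply sum_le_sum; intro y _; split_ifs
  · exact h y
  · exact le_rfl

lemma cE_nonneg (s : Setoid X) {f : X → ℝ} (h : ∀ x, 0 ≤ f x) (x : X) : 0 ≤ cE s f x := by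
  classical
  unfold cE
  apply div_nonneg _ (cE_den_pos s x).le
  apply sum_nonneg; intro y _; split_ifs
  · exact h y
  · exact le_rfl

lemma cE_neg (s : Setoid X) (f : X → ℝ) (x : X) : cE s (fun y => - f y) x = - cE s f x := by
  have := cE_smul s (-1) f x
  rw [neg_one_mul, neg_one_smul] at this
  exact this

lemma abs_cE_le (s : Setoid X) (f : X → ℝ) (x : X) : |cE s f x| ≤ cE s (fun y => |f y|) x := by
  rw [abs_le]
  constructor
  · rw [← cE_neg]; exact cE_mono s (fun y => neg_abs_le _) x
  · exact cE_mono s (fun y => le_abs_self _) x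

/-- running maximum -/
noncomputable def mx (a : ℕ → ℝ) : ℕ → ℝ
  | 0 => a 0
  | n + 1 => max (mx a n) (a (n + 1))

lemma le_mx (a : ℕ → ℝ) {n m : ℕ} (h : n ≤ m) : a n ≤ mx a m := by
  induction m with
  | zero => obtain rfl := Nat.le_zero.1 h; exact le_rfl
  | succ m ih =>
    rcases Nat.lt_or_ge m n with h1 | h1
    · obtain rfl : n = m + 1 := by omega
      exact le_max_right _ _
    · exact (ih h1).trans (le_max_left _ _)

lemma mx_mono (a : ℕ → ℝ) : Monotone (mx a) := monotone_nat_of_le_succ fun _ => le_max_left _ _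

lemma mx_le (a b : ℕ → ℝ) (h : ∀ n, a n ≤ b n) (n : ℕ) : mx a n ≤ mx b n := by
  induction n with
  | zero => exact h 0
  | succ n ih => exact max_le_max ih (h _)

lemma mx_nonneg (a : ℕ → ℝ) (h : 0 ≤ a 0) (n : ℕ) : 0 ≤ mx a n := h.trans (le_mx a n.zero_le)

lemma mx_congr {a b : ℕ → ℝ} {n : ℕ} (h : ∀ m ≤ n, a m = b m) : mx a n = mx b n := by
  induction n with
  | zero => exact h 0 le_rfl
  | succ n ih => simp only [mx]; rw [ih fun m hm => h m (by omega), h _ le_rfl]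

/-- a filtration: refining partitions -/
def Filt (F : ℕ → Setoid X) : Prop := ∀ n x y, (F (n + 1)).r x y → (F n).r x y

lemma Filt.le {F : ℕ → Setoid X} (hF : Filt F) {n m : ℕ} (h : n ≤ m) {x y : X}
    (hxy : (F m).r x y) : (F n).r x y := by
  induction m, h using Nat.le_induction with
  | base => exact hxy
  | succ m _ ih => exact ih (hF _ _ _ hxy)

lemma Filt.meas {F : ℕ → Setoid X} (hF : Filt F) (f : X → ℝ) {n m : ℕ} (h : n ≤ m) {x y : X}
    (hxy : (F m).r x y) : cE (F n) f x = cE (F n) f y := cE_meas _ _ (hF.le h hxy)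

lemma doob_path {p : ℝ} (hp : 1 < p) (a : ℕ → ℝ) (ha : ∀ n, 0 ≤ a n) (M : ℕ) :
    (p - 1) / p * mx a M ^ p ≤ mx a 0 ^ (p - 1) * a 0 +
      ∑ n ∈ range M, (mx a (n + 1) ^ (p - 1) - mx a n ^ (p - 1)) * a (n + 1) := by
  induction M with
  | zero =>
    simp only [mx, range_zero, sum_empty, add_zero]
    rw [← Real.rpow_add_one' (ha 0) (by linarith), sub_add_cancel]
    have : (p - 1) / p ≤ 1 := by rw [div_le_one (by linarith)]; linarith
    exact mul_le_of_le_one_left (by have := ha 0; positivity) this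
  | succ M ih =>
    rw [sum_range_succ]
    suffices h : (p - 1) / p * mx a (M + 1) ^ p - (p - 1) / p * mx a M ^ p ≤
        (mx a (M + 1) ^ (p - 1) - mx a M ^ (p - 1)) * a (M + 1) by linarith
    simp only [mx]
    rcases le_total (a (M + 1)) (mx a M) with h | h
    · simp [max_eq_left h]
    · rw [max_eq_right h]
      have hb := mx_nonneg a (ha 0) M
      have hc : p.HolderConjugate (p / (p - 1)) := Real.HolderConjugate.conjExponent hp
      have hp1 : p - 1 ≠ 0 := by linarith
      have y := Real.young_inequality_of_nonneg (ha (M + 1)) (Real.rpow_nonneg hb (p - 1)) hc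
      rw [← Real.rpow_mul hb] at y
      have e1 : (p - 1) * (p / (p - 1)) = p := by field_simp
      rw [e1] at y
      have e2 : a (M + 1) ^ (p - 1) * a (M + 1) = a (M + 1) ^ p := by
        rw [← Real.rpow_add_one' (ha _) (by linarith), sub_add_cancel]
      rw [sub_mul, e2]
      have e3 : mx a M ^ p / (p / (p - 1)) = (p - 1) / p * mx a M ^ p := by field_simp
      have e4 : a (M + 1) ^ p - a (M + 1) ^ p / p = (p - 1) / p * a (M + 1) ^ p := by
        have : p ≠ 0 := by linarith
        field_simp
      rw [e3] at y
      linarith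

lemma doob {F : ℕ → Setoid X} (hF : Filt F) {p : ℝ} (hp : 1 < p) {f : X → ℝ} (hf : ∀ x, 0 ≤ f x)
    (M : ℕ) : nP p (fun x => mx (fun n => cE (F n) f x) M) ≤ p / (p - 1) * nP p f := by
  set m : ℕ → X → ℝ := fun n x => mx (fun n => cE (F n) f x) n with hm
  have hm0 : ∀ n x, 0 ≤ m n x := fun n x => mx_nonneg _ (cE_nonneg _ hf x) n
  have mm : ∀ n x y, (F n).r x y → m n x = m n y := fun n x y h =>
    mx_congr fun k hk => hF.meas f hk h
  have hp0 : 0 < p := by linarith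
  have h1 : (p - 1) / p * ∑ x, m M x ^ p ≤ ∑ x, m M x ^ (p - 1) * f x := by
    rw [mul_sum]
    calc _ ≤ ∑ x, (m 0 x ^ (p - 1) * cE (F 0) f x +
          ∑ n ∈ range M, (m (n + 1) x ^ (p - 1) - m n x ^ (p - 1)) * cE (F (n + 1)) f x) :=
          sum_le_sum fun x _ => doob_path hp _ (fun n => cE_nonneg _ hf x) M
      _ = ∑ x, (m 0 x ^ (p - 1) * f x +
          ∑ n ∈ range M, (m (n + 1) x ^ (p - 1) - m n x ^ (p - 1)) * f x) := by
          rw [sum_add_distrib, sum_add_distrib, sum_comm, sum_comm (s := univ) (t := range M)]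
          congr 1
          · exact cE_pair _ _ fun x y h => by rw [mm 0 x y h]
          · exact sum_congr rfl fun n _ => cE_pair _ _ fun x y h => by
              rw [mm (n + 1) x y h, mm n x y (hF _ _ _ h)]
      _ = _ := by
          apply sum_congr rfl
          intro x _
          rw [← sum_mul, sum_range_sub (fun n => m n x ^ (p - 1))]; ring
  have hc : (p / (p - 1)).HolderConjugate p := (Real.HolderConjugate.conjExponent hp).symm
  have h2 := nP_holder hc (fun x => m M x ^ (p - 1)) f
  have e : nP (p / (p - 1)) (fun x => m M x ^ (p - 1)) = nP p (m M) ^ (p - 1) := by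
    have := nP_pow (q := p / (p - 1)) (a := p - 1) (by linarith) hc.pos (m M)
    simp_rw [abs_of_nonneg (hm0 M _)] at this
    rw [this]
    congr 2
    have : p - 1 ≠ 0 := by linarith
    field_simp
  rw [e] at h2
  have e2 : ∑ x, m M x ^ p = nP p (m M) ^ p := by
    rw [nP_rpow hp0]; simp_rw [abs_of_nonneg (hm0 M _)]
  rw [e2] at h1
  change nP p (m M) ≤ _
  rcases (nP_nonneg p (m M)).eq_or_lt with h | h
  · rw [← h]; have := nP_nonneg p f
    have : 0 ≤ p / (p - 1) := div_nonneg hp0.le (by linarith)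
    positivity
  · have h3 := h1.trans h2
    rw [show nP p (m M) ^ p = nP p (m M) ^ (p - 1) * nP p (m M) by
      rw [← Real.rpow_add_one h.ne', sub_add_cancel]] at h3
    have h4 : 0 < nP p (m M) ^ (p - 1) := by positivity
    have h5 : (p - 1) / p * nP p (m M) ≤ nP p f := by
      apply le_of_mul_le_mul_left _ h4; linarith
    have h6 : 0 < p - 1 := by linarith
    calc nP p (m M) = p / (p - 1) * ((p - 1) / p * nP p (m M)) := by field_simp
      _ ≤ _ := by gcongr

/-- maximal bound for signed functions -/
lemma doob' {F : ℕ → Setoid X} (hF : Filt F) {p : ℝ} (hp : 1 < p) (f : X → ℝ)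
    (M : ℕ) : nP p (fun x => mx (fun n => |cE (F n) f x|) M) ≤ p / (p - 1) * nP p f := by
  have h := doob hF hp (f := fun x => |f x|) (fun x => abs_nonneg _) M
  rw [nP_abs] at h
  refine le_trans (nP_mono (by linarith) fun x => ?_) h
  rw [abs_of_nonneg (mx_nonneg _ (abs_nonneg _) _)]
  exact mx_le _ _ (fun n => abs_cE_le _ _ _) _

end mart
end DF

open MeasureTheory ENNReal
namespace DF
open Finset

lemma elem_ineq {p : ℝ} (hp : 1 < p) (hp2 : p ≤ 2) {a b m : ℝ} (ha : 0 ≤ a) (hb : 0 ≤ b)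
    (ham : a ≤ m) (hbm : b ≤ m) :
    p * (p - 1) / 2 * ((b - a) ^ 2 * m ^ (p - 2)) ≤ b ^ p - a ^ p - p * (a ^ (p - 1) * (b - a)) := by
  rcases (ha.trans ham).eq_or_lt with h0 | h0
  · obtain rfl : a = 0 := by linarith
    obtain rfl : b = 0 := by linarith
    simp
  set c := p * (p - 1) * m ^ (p - 2) with hc
  have mono : ∀ s t, 0 ≤ s → s < t → t ≤ m →
      p * s ^ (p - 1) - c * s ≤ p * t ^ (p - 1) - c * t := by
    intro s t hs hst htm
    have ht : 0 < t := by linarith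
    have h1 := rpow_one_add_le_one_add_mul_self (s := s / t - 1) (p := p - 1)
      (by have : 0 ≤ s / t := by positivity
          linarith) (by linarith) (by linarith)
    rw [add_sub_cancel, Real.div_rpow hs ht.le, div_le_iff₀ (by positivity)] at h1
    have e1 : t ^ (p - 1) = t ^ (p - 2) * t := by
      rw [← Real.rpow_add_one ht.ne']; congr 1; ring
    have h2 : s ^ (p - 1) ≤ t ^ (p - 1) - (p - 1) * t ^ (p - 2) * (t - s) := by
      refine h1.trans (le_of_eq ?_)
      rw [e1]; field_simp; ring
    have h3 : m ^ (p - 2) ≤ t ^ (p - 2) := Real.rpow_le_rpow_of_nonpos ht htm (by linarith)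
    have h4 : (p - 1) * m ^ (p - 2) * (t - s) ≤ (p - 1) * t ^ (p - 2) * (t - s) := by
      have : 0 ≤ t - s := by linarith
      have : 0 ≤ p - 1 := by linarith
      gcongr
    have h5 : s ^ (p - 1) + (p - 1) * m ^ (p - 2) * (t - s) ≤ t ^ (p - 1) := by linarith
    have h6 := mul_le_mul_of_nonneg_left h5 (by linarith : 0 ≤ p)
    rw [hc]; nlinarith [h6]
  have hd : ∀ t, HasDerivAt (fun t : ℝ => t ^ p - c / 2 * t ^ 2) (p * t ^ (p - 1) - c * t) t := by
    intro t
    have h1 := (Real.hasDerivAt_rpow_const (x := t) (p := p) (Or.inr hp.le)).sub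
      ((hasDerivAt_pow 2 t).const_mul (c / 2))
    refine h1.congr_deriv ?_
    push_cast; ring
  have key : (b ^ p - c / 2 * b ^ 2) - (a ^ p - c / 2 * a ^ 2) ≥
      (p * a ^ (p - 1) - c * a) * (b - a) := by
    rcases lt_trichotomy a b with h | h | h
    · obtain ⟨x, hx, he⟩ := exists_hasDerivAt_eq_slope (fun t : ℝ => t ^ p - c / 2 * t ^ 2)
        (fun t => p * t ^ (p - 1) - c * t) h (fun t _ => (hd t).continuousAt.continuousWithinAt)
        (fun t _ => hd t)
      have h1 := mono a x ha hx.1 (hx.2.le.trans hbm)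
      have h2 : 0 < b - a := by linarith
      try simp only at he
      rw [he, le_div_iff₀ h2] at h1
      linarith
    · subst h; simp
    · obtain ⟨x, hx, he⟩ := exists_hasDerivAt_eq_slope (fun t : ℝ => t ^ p - c / 2 * t ^ 2)
        (fun t => p * t ^ (p - 1) - c * t) h (fun t _ => (hd t).continuousAt.continuousWithinAt)
        (fun t _ => hd t)
      have h1 := mono x a (hb.trans hx.1.le) hx.2 ham
      have h2 : 0 < a - b := by linarith
      try simp only at he
      rw [he, div_le_iff₀ h2] at h1
      linarith
  have : c / 2 * (b - a) ^ 2 = p * (p - 1) / 2 * ((b - a) ^ 2 * m ^ (p - 2)) := by rw [hc]; ring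
  rw [← this]
  linarith

section mart2
variable {X : Type*} [Fintype X]

/-- martingale differences -/
noncomputable def mD (F : ℕ → Setoid X) : (X → ℝ) →ₗ[ℝ] (ℕ → X → ℝ) where
  toFun f n x := cE (F (n + 1)) f x - cE (F n) f x
  map_add' f g := by ext n x; simp only [Pi.add_apply, cE_add]; ring
  map_smul' c f := by
    ext n x; simp only [Pi.smul_apply, cE_smul, RingHom.id_apply, smul_eq_mul]; ring

lemma mD_apply (F : ℕ → Setoid X) (f : X → ℝ) (n : ℕ) (x : X) :
    mD F f n x = cE (F (n + 1)) f x - cE (F n) f x := rfl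

lemma pair_mD {F : ℕ → Setoid X} (hF : Filt F) (f : X → ℝ) (n : ℕ) {φ : X → ℝ}
    (hφ : ∀ x y, (F n).r x y → φ x = φ y) : ∑ x, φ x * mD F f n x = 0 := by
  simp only [mD_apply, mul_sub, sum_sub_distrib]
  rw [cE_pair _ _ hφ, cE_pair _ _ fun x y h => hφ x y (hF _ _ _ h), sub_self]

lemma sq_rpow (s : Finset ℕ) (G : ℕ → X → ℝ) (p : ℝ) (x : X) :
    |sq s G x| ^ p = (∑ i ∈ s, (G i x) ^ 2) ^ (p / 2) := by
  rw [abs_of_nonneg (sq_nonneg' _ _ _), sq, Real.sqrt_eq_rpow, ← Real.rpow_mul]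
  · congr 1; ring
  · exact sum_nonneg fun i _ => sq_nonneg _

lemma SF1_pos {F : ℕ → Setoid X} (hF : Filt F) {p : ℝ} (hp : 1 < p) (hp2 : p ≤ 2) {f : X → ℝ}
    (hf : ∀ x, 0 ≤ f x) (M : ℕ) :
    nP p (sq (range M) (mD F f)) ≤ ((2 / (p * (p - 1)) + 1) ^ (1 / p) * (p / (p - 1))) * nP p f := by
  have hp0 : 0 < p := by linarith
  have hp1 : 0 < p - 1 := by linarith
  set m : X → ℝ := fun x => mx (fun n => cE (F n) f x) M with hm
  have hm0 : ∀ x, 0 ≤ m x := fun x => mx_nonneg _ (cE_nonneg _ hf x) M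
  have hfm : ∀ n ≤ M, ∀ x, cE (F n) f x ≤ m x := fun n hn x => le_mx (fun n => cE (F n) f x) hn
  have hf0 : ∀ n x, 0 ≤ cE (F n) f x := fun n x => cE_nonneg _ hf x
  have d := doob hF hp hf M
  change nP p m ≤ _ at d
  have h1 : ∑ x, ∑ n ∈ range M, mD F f n x ^ 2 * m x ^ (p - 2) ≤
      2 / (p * (p - 1)) * ∑ x, m x ^ p := by
    have : p * (p - 1) / 2 * ∑ x, ∑ n ∈ range M, mD F f n x ^ 2 * m x ^ (p - 2) ≤
        ∑ x, m x ^ p := by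
      calc _ ≤ ∑ x, ∑ n ∈ range M, (cE (F (n + 1)) f x ^ p - cE (F n) f x ^ p -
            p * (cE (F n) f x ^ (p - 1) * mD F f n x)) := by
            rw [mul_sum]
            apply sum_le_sum; intro x _
            rw [mul_sum]
            apply sum_le_sum; intro n hn
            have hn := mem_range.1 hn
            exact elem_ineq hp hp2 (hf0 _ _) (hf0 _ _) (hfm _ (by omega) x) (hfm _ (by omega) x)
        _ = ∑ x, ∑ n ∈ range M, (cE (F (n + 1)) f x ^ p - cE (F n) f x ^ p) := by
            simp only [sum_sub_distrib]
            have : ∑ x, ∑ n ∈ range M, p * (cE (F n) f x ^ (p - 1) * mD F f n x) = 0 := by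
              rw [sum_comm]
              apply sum_eq_zero; intro n _
              rw [← mul_sum, pair_mD hF f n, mul_zero]
              intro x y h; rw [cE_meas _ _ h]
            rw [this, sub_zero]
        _ ≤ _ := by
            apply sum_le_sum; intro x _
            rw [sum_range_sub (fun n => cE (F n) f x ^ p)]
            have h1 := Real.rpow_le_rpow (hf0 M x) (hfm M le_rfl x) hp0.le
            have h2 := Real.rpow_nonneg (hf0 0 x) p
            linarith
    have e : ∑ x, ∑ n ∈ range M, mD F f n x ^ 2 * m x ^ (p - 2) = 2 / (p * (p - 1)) *
      (p * (p - 1) / 2 * ∑ x, ∑ n ∈ range M, mD F f n x ^ 2 * m x ^ (p - 2)) := by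
      field_simp
    rw [e]; gcongr
  have h2 : ∑ x, |sq (range M) (mD F f) x| ^ p ≤ (2 / (p * (p - 1)) + 1) * ∑ x, m x ^ p := by
    rw [add_mul, one_mul]
    refine le_trans ?_ (add_le_add h1 le_rfl)
    rw [← sum_add_distrib]
    apply sum_le_sum; intro x _
    rw [sq_rpow, ← sum_mul]
    set D := ∑ n ∈ range M, mD F f n x ^ 2 with hD
    have hD0 : 0 ≤ D := sum_nonneg fun i _ => sq_nonneg _
    rcases (hm0 x).eq_or_lt with h | h
    · have : D = 0 := by
        apply sum_eq_zero; intro n hn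
        have hn := mem_range.1 hn
        have h3 : ∀ n ≤ M, cE (F n) f x = 0 := fun n hn =>
          le_antisymm ((hfm n hn x).trans h.symm.le) (hf0 n x)
        rw [mD_apply, h3 n (by omega), h3 (n + 1) (by omega)]; simp
      rw [this, Real.zero_rpow (by positivity)]
      have := Real.rpow_nonneg (hm0 x) p
      linarith
    · have h3 := Real.geom_mean_le_arith_mean2_weighted (w₁ := p / 2) (w₂ := (2 - p) / 2)
        (p₁ := D * m x ^ (p - 2)) (p₂ := m x ^ p) (by positivity) (by linarith) (by positivity)
        (by positivity) (by ring)
      have e : (D * m x ^ (p - 2)) ^ (p / 2) * (m x ^ p) ^ ((2 - p) / 2) = D ^ (p / 2) := by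
        rw [Real.mul_rpow hD0 (by positivity), ← Real.rpow_mul h.le, ← Real.rpow_mul h.le, mul_assoc,
          ← Real.rpow_add h]
        rw [show (p - 2) * (p / 2) + p * ((2 - p) / 2) = 0 by ring, Real.rpow_zero, mul_one]
      rw [e] at h3
      have h4 : 0 ≤ D * m x ^ (p - 2) := by positivity
      have h5 : 0 ≤ m x ^ p := by positivity
      nlinarith
  have e : ∑ x, m x ^ p = nP p m ^ p := by
    rw [nP_rpow hp0]; simp_rw [abs_of_nonneg (hm0 _)]
  have h3 : nP p (sq (range M) (mD F f)) ≤ (2 / (p * (p - 1)) + 1) ^ (1 / p) * nP p m := by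
    have := nP_nonneg p m
    apply nP_le_of hp0 (by positivity)
    rw [Real.mul_rpow (by positivity) this, ← Real.rpow_mul (by positivity),
      one_div_mul_cancel hp0.ne', Real.rpow_one, ← e]
    exact h2
  refine h3.trans ?_
  rw [mul_assoc]
  gcongr

lemma sq_neg_le_add (s : Finset ℕ) (T : (X → ℝ) →ₗ[ℝ] (ℕ → X → ℝ)) (f g : X → ℝ) (x : X) :
    sq s (T (f - g)) x ≤ sq s (T f) x + sq s (T g) x := by
  have h := sq_add_le s (T f) (T (-g)) x
  have e : sq s (T (-g)) x = sq s (T g) x := by simp [sq]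
  rw [e] at h
  convert h using 2
  rw [sub_eq_add_neg, map_add]; rfl

lemma SF1 {F : ℕ → Setoid X} (hF : Filt F) {p : ℝ} (hp : 1 < p) (hp2 : p ≤ 2) (f : X → ℝ) (M : ℕ) :
    nP p (sq (range M) (mD F f)) ≤
      2 * ((2 / (p * (p - 1)) + 1) ^ (1 / p) * (p / (p - 1))) * nP p f := by
  set C := (2 / (p * (p - 1)) + 1) ^ (1 / p) * (p / (p - 1)) with hC
  have hC0 : 0 ≤ C := by
    have : 0 < p - 1 := by linarith
    positivity
  have e : f = (fun x => max (f x) 0) - fun x => max (-f x) 0 := by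
    ext x; simp only [Pi.sub_apply]
    rcases le_total (f x) 0 with h | h
    · rw [max_eq_right h, max_eq_left (by linarith)]; ring
    · rw [max_eq_left h, max_eq_right (by linarith)]; ring
  have h1 := SF1_pos hF hp hp2 (f := fun x => max (f x) 0) (fun x => le_max_right _ _) M
  have h2 := SF1_pos hF hp hp2 (f := fun x => max (-f x) 0) (fun x => le_max_right _ _) M
  have h3 : nP p (fun x => max (f x) 0) ≤ nP p f := by
    rw [← nP_abs p f]; apply nP_mono (by linarith)
    intro x; rw [abs_of_nonneg (le_max_right _ _)]; exact max_le (le_abs_self _) (abs_nonneg _)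
  have h4 : nP p (fun x => max (-f x) 0) ≤ nP p f := by
    rw [← nP_abs p f]; apply nP_mono (by linarith)
    intro x; rw [abs_of_nonneg (le_max_right _ _)]; exact max_le (neg_le_abs _) (abs_nonneg _)
  have h5 : nP p (sq (range M) (mD F f)) ≤ nP p (sq (range M) (mD F fun x => max (f x) 0)) +
      nP p (sq (range M) (mD F fun x => max (-f x) 0)) := by
    refine le_trans (nP_mono (by linarith) fun x => ?_) (nP_add_le hp.le _ _)
    rw [abs_of_nonneg (sq_nonneg' _ _ _)]
    conv_lhs => rw [e]
    exact sq_neg_le_add _ _ _ _ _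
  have h6 := mul_le_mul_of_nonneg_left h3 hC0
  have h7 := mul_le_mul_of_nonneg_left h4 hC0
  linarith

lemma nP_sqfun {q : ℝ} (hq : 0 < q) (f : X → ℝ) : nP q (fun x => f x ^ 2) = nP (2 * q) f ^ 2 := by
  have := nP_pow (by norm_num : (0:ℝ) < 2) hq f
  simpa using this

lemma SF4 {F : ℕ → Setoid X} (hF : Filt F) {p C : ℝ} (hp : 4 ≤ p) (hC : 0 ≤ C)
    (M : ℕ) (H : ∀ h : X → ℝ, nP (p / (p - 2)) (sq (range M) (mD F h)) ≤ C * nP (p / (p - 2)) h)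
    (f : X → ℝ) :
    nP p (sq (range M) (mD F f)) ≤ √(2 * (1 + C * (2 * C + 1))) * (p / (p - 1)) * nP p f := by
  have hp2 : p - 2 ≠ 0 := by linarith
  set S := sq (range M) (mD F f) with hS
  set Y := nP p S with hY
  have hY0 : 0 ≤ Y := nP_nonneg _ _
  set m : X → ℝ := fun x => mx (fun n => |cE (F n) f x|) M with hm
  have hm0 : ∀ x, 0 ≤ m x := fun x => mx_nonneg _ (abs_nonneg _) M
  have hfm : ∀ n ≤ M, ∀ x, |cE (F n) f x| ≤ m x := fun n hn x => le_mx (fun n => |cE (F n) f x|) hn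
  have d := doob' hF (by linarith : 1 < p) f M
  change nP p m ≤ _ at d
  set A := nP p m with hA
  have hA0 : 0 ≤ A := nP_nonneg _ _
  have hS0 : ∀ x, 0 ≤ S x := fun x => sq_nonneg' _ _ _
  set h : X → ℝ := fun x => |S x| ^ (p - 2) with hh
  have hh0 : ∀ x, 0 ≤ h x := fun x => by positivity
  have nh : nP (p / (p - 2)) h = Y ^ (p - 2) := by
    have := nP_pow (by linarith : 0 < p - 2) (q := p / (p - 2)) (div_pos (by linarith) (by linarith)) S
    rw [mul_div_cancel₀ _ hp2] at this
    exact this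
  have hq : (p / 2).HolderConjugate (p / (p - 2)) := by
    have := Real.HolderConjugate.conjExponent (p := p / 2) (by linarith)
    unfold Real.conjExponent at this
    convert this using 1
    field_simp
  have e1 : Y ^ p = ∑ n ∈ range M, ∑ x, mD F f n x ^ 2 * cE (F (n + 1)) h x := by
    rw [hY, nP_rpow (by linarith)]
    calc _ = ∑ x, ∑ n ∈ range M, mD F f n x ^ 2 * h x := by
          apply sum_congr rfl; intro x _
          rw [← sum_mul, ← sq_sq, hh]
          simp only [abs_of_nonneg (hS0 x)]
          rw [← hS, ← Real.rpow_natCast, ← Real.rpow_add' (hS0 x) (by push_cast; linarith)]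
          congr 1; push_cast; ring
      _ = _ := by
          rw [sum_comm]
          apply sum_congr rfl; intro n _
          symm
          apply cE_pair
          intro x y hxy
          simp only [mD_apply]
          rw [cE_meas _ _ hxy, hF.meas f (Nat.le_succ n) hxy]
  have e2 : ∀ n, ∑ x, mD F f n x ^ 2 * cE (F (n + 1)) h x =
      (∑ x, cE (F (n + 1)) f x ^ 2 * cE (F (n + 1)) h x - ∑ x, cE (F n) f x ^ 2 * cE (F n) h x)
      + ∑ x, (-2 * cE (F n) f x) * (mD F f n x * mD F h n x) := by
    intro n
    have a1 := pair_mD hF f n (φ := fun x => cE (F n) f x * cE (F n) h x) (fun x y hxy => by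
      rw [cE_meas _ f hxy, cE_meas _ h hxy])
    have a2 := pair_mD hF h n (φ := fun x => cE (F n) f x ^ 2) (fun x y hxy => by
      rw [cE_meas _ f hxy])
    have : ∑ x, mD F f n x ^ 2 * cE (F (n + 1)) h x =
      (∑ x, cE (F (n + 1)) f x ^ 2 * cE (F (n + 1)) h x - ∑ x, cE (F n) f x ^ 2 * cE (F n) h x)
      + ∑ x, (-2 * cE (F n) f x) * (mD F f n x * mD F h n x)
      - ∑ x, cE (F n) f x ^ 2 * mD F h n x
      - 2 * ∑ x, (cE (F n) f x * cE (F n) h x) * mD F f n x := by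
      rw [mul_sum, ← sum_sub_distrib, ← sum_add_distrib, ← sum_sub_distrib, ← sum_sub_distrib]
      apply sum_congr rfl; intro x _
      simp only [mD_apply]; ring
    rw [this, a1, a2]; ring
  have e3 : Y ^ p ≤ ∑ x, m x ^ 2 * h x + ∑ x, (m x * S x) * (2 * sq (range M) (mD F h) x) := by
    rw [e1, sum_congr rfl fun n _ => e2 n, sum_add_distrib,
      sum_range_sub (fun n => ∑ x, cE (F n) f x ^ 2 * cE (F n) h x)]
    apply add_le_add
    · have : 0 ≤ ∑ x, cE (F 0) f x ^ 2 * cE (F 0) h x :=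
        sum_nonneg fun x _ => mul_nonneg (sq_nonneg _) (cE_nonneg _ hh0 x)
      have h2 : ∑ x, cE (F M) f x ^ 2 * cE (F M) h x = ∑ x, cE (F M) f x ^ 2 * h x := by
        apply cE_pair; intro x y hxy; rw [cE_meas _ f hxy]
      have h3 : ∑ x, cE (F M) f x ^ 2 * h x ≤ ∑ x, m x ^ 2 * h x := by
        apply sum_le_sum; intro x _
        apply mul_le_mul_of_nonneg_right _ (hh0 x)
        rw [← sq_abs]
        exact pow_le_pow_left₀ (abs_nonneg _) (hfm M le_rfl x) 2
      linarith
    · rw [sum_comm]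
      apply sum_le_sum; intro x _
      calc _ ≤ ∑ n ∈ range M, 2 * m x * (|mD F f n x| * |mD F h n x|) := by
            apply sum_le_sum; intro n hn
            refine (le_abs_self _).trans ?_
            rw [abs_mul, abs_mul, abs_mul, abs_neg, abs_two]
            have := hfm n (mem_range.1 hn).le x
            gcongr
        _ = 2 * m x * ∑ n ∈ range M, |mD F f n x| * |mD F h n x| := by rw [mul_sum]
        _ ≤ 2 * m x * (S x * sq (range M) (mD F h) x) := by
            have := hm0 x
            have := sum_mul_le_sq (range M) (fun n x => |mD F f n x|) (fun n x => |mD F h n x|) x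
            have e : ∀ g : X → ℝ, sq (range M) (fun n x => |mD F g n x|) x = sq (range M) (mD F g) x := by
              intro g; simp [sq]
            rw [e, e] at this
            gcongr
        _ = _ := by ring
  have i1 : ∑ x, m x ^ 2 * h x ≤ A ^ 2 * Y ^ (p - 2) := by
    have := nP_holder hq (fun x => m x ^ 2) h
    rw [nP_sqfun (by linarith), mul_div_cancel₀ _ two_ne_zero, nh] at this
    exact this
  have hC1 : 0 < 2 * C + 1 := by linarith
  have i2 : nP (p / 2) (fun x => m x * S x) ≤ (2 * C + 1) / 2 * A ^ 2 + 1 / (2 * (2 * C + 1)) * Y ^ 2 := by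
    calc _ ≤ nP (p / 2) (fun x => (2 * C + 1) / 2 * m x ^ 2 + 1 / (2 * (2 * C + 1)) * S x ^ 2) := by
          apply nP_mono (by linarith)
          intro x
          rw [abs_of_nonneg (mul_nonneg (hm0 x) (hS0 x))]
          have : (2 * C + 1) / 2 * m x ^ 2 + 1 / (2 * (2 * C + 1)) * S x ^ 2 - m x * S x =
            ((2 * C + 1) * m x - S x) ^ 2 / (2 * (2 * C + 1)) := by field_simp; ring
          have : 0 ≤ ((2 * C + 1) * m x - S x) ^ 2 / (2 * (2 * C + 1)) := by positivity
          linarith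
      _ ≤ _ := by
          refine (nP_add_le (by linarith) _ _).trans (le_of_eq ?_)
          rw [nP_smul (by linarith), nP_smul (by linarith), nP_sqfun (by linarith),
            nP_sqfun (by linarith), mul_div_cancel₀ _ two_ne_zero, abs_of_nonneg (by positivity),
            abs_of_nonneg (by positivity)]
  have i3 : ∑ x, (m x * S x) * (2 * sq (range M) (mD F h) x) ≤
      ((2 * C + 1) / 2 * A ^ 2 + 1 / (2 * (2 * C + 1)) * Y ^ 2) * (2 * (C * Y ^ (p - 2))) := by
    refine (nP_holder hq _ _).trans ?_
    rw [nP_smul (by have := hq.symm.pos; linarith), abs_two]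
    have := H h
    rw [nh] at this
    have := nP_nonneg (p / 2) (fun x => m x * S x)
    have := nP_nonneg (p / (p - 2)) (sq (range M) (mD F h))
    gcongr
  have key : Y ^ 2 ≤ 2 * (1 + C * (2 * C + 1)) * A ^ 2 := by
    rcases hY0.eq_or_lt with h0 | h0
    · rw [← h0, zero_pow two_ne_zero]; positivity
    · have e4 : Y ^ p = Y ^ (p - 2) * Y ^ 2 := by
        rw [← Real.rpow_natCast, ← Real.rpow_add h0]; congr 1; push_cast; ring
      have h4 : 0 < Y ^ (p - 2) := by positivity
      have h5 : Y ^ 2 ≤ A ^ 2 + ((2 * C + 1) / 2 * A ^ 2 + 1 / (2 * (2 * C + 1)) * Y ^ 2) * (2 * C) := by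
        apply le_of_mul_le_mul_left _ h4
        rw [← e4]
        refine (e3.trans (add_le_add i1 i3)).trans (le_of_eq ?_)
        ring
      have h6 : 1 / (2 * (2 * C + 1)) * Y ^ 2 * (2 * C) ≤ Y ^ 2 / 2 := by
        have : 1 / (2 * (2 * C + 1)) * Y ^ 2 * (2 * C) = Y ^ 2 / 2 * ((2 * C) / (2 * C + 1)) := by
          field_simp
        rw [this]
        apply mul_le_of_le_one_right (by positivity)
        rw [div_le_one hC1]; linarith
      nlinarith
  calc Y ≤ √(2 * (1 + C * (2 * C + 1)) * A ^ 2) := Real.le_sqrt_of_sq_le key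
    _ = √(2 * (1 + C * (2 * C + 1))) * A := by
      rw [Real.sqrt_mul (by positivity), Real.sqrt_sq hA0]
    _ ≤ _ := by rw [mul_assoc]; gcongr

end mart2

lemma SF_ge4 {p : ℝ} (hp : 4 ≤ p) : ∃ C : ℝ, 0 ≤ C ∧ ∀ (X : Type) [Fintype X] (F : ℕ → Setoid X),
    Filt F → ∀ (M : ℕ) (f : X → ℝ), nP p (sq (range M) (mD F f)) ≤ C * nP p f := by
  have h1 : 1 < p / (p - 2) := by rw [lt_div_iff₀ (by linarith)]; linarith
  have h2 : p / (p - 2) ≤ 2 := by rw [div_le_iff₀ (by linarith)]; linarith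
  have hp1 : 0 ≤ p / (p - 1) := div_nonneg (by linarith) (by linarith)
  refine ⟨_, ?_, fun X _ F hF M f => SF4 hF hp ?_ M (fun h => SF1 hF h1 h2 h M) f⟩
  · positivity
  · have : 0 < p / (p - 2) - 1 := by linarith
    have : 0 < p / (p - 2) := by linarith
    positivity

/-- square function estimate for martingales -/
theorem SF {p : ℝ} (hp : 1 < p) : ∃ C : ℝ, 0 ≤ C ∧ ∀ (X : Type) [Fintype X] (F : ℕ → Setoid X),
    Filt F → ∀ (M : ℕ) (f : X → ℝ), nP p (sq (range M) (mD F f)) ≤ C * nP p f := by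
  rcases le_or_gt p 2 with h | h
  · refine ⟨_, ?_, fun X _ F hF M f => SF1 hF hp h f M⟩
    have : 0 < p - 1 := by linarith
    positivity
  rcases le_or_gt 4 p with h4 | h4
  · exact SF_ge4 h4
  obtain ⟨C, hC, H⟩ := SF_ge4 (le_refl (4:ℝ))
  set C2 : ℝ := 2 * ((2 / (2 * (2 - 1)) + 1) ^ (1 / 2 : ℝ) * (2 / (2 - 1))) with hC2
  have hC20 : 0 ≤ C2 := by rw [hC2]; norm_num; positivity
  refine ⟨2 * C2 ^ (1 - (2 - 4 / p)) * C ^ (2 - 4 / p), by positivity, fun X _ F hF M f => ?_⟩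
  have h5 : 4 / p < 2 := by rw [div_lt_iff₀ (by linarith)]; linarith
  have h6 : 1 < 4 / p := by rw [lt_div_iff₀ (by linarith)]; linarith
  refine interp (range M) (mD F) (p0 := 2) (p1 := 4) (p := p) (θ := 2 - 4 / p) (by norm_num)
    (by norm_num) hp (by linarith) (by linarith) ?_ hC20 hC
    (fun f => SF1 hF (by norm_num) le_rfl f M) (fun f => H X F hF M f) f
  field_simp; ring

end DF

open MeasureTheory ENNReal
namespace DF
open Finset

section path
open Classical in
/-- next stopping index -/
noncomputable def nxt (a : ℕ → ℝ) (l : ℝ) (M t : ℕ) : ℕ :=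
  Nat.find (p := fun n => M ≤ n ∨ (t < n ∧ l * mx (fun i => |a i|) n < |a n - a t|)) ⟨M, Or.inl le_rfl⟩

lemma nxt_spec (a : ℕ → ℝ) (l : ℝ) (M t : ℕ) : M ≤ nxt a l M t ∨
    (t < nxt a l M t ∧ l * mx (fun i => |a i|) (nxt a l M t) < |a (nxt a l M t) - a t|) := by
  classical
  exact Nat.find_spec (p := fun n => M ≤ n ∨ (t < n ∧ l * mx (fun i => |a i|) n < |a n - a t|)) _

lemma nxt_min {a : ℕ → ℝ} {l : ℝ} {M t n : ℕ} (h : n < nxt a l M t) : n < M ∧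
    (t < n → |a n - a t| ≤ l * mx (fun i => |a i|) n) := by
  classical
  have := Nat.find_min (p := fun n => M ≤ n ∨ (t < n ∧ l * mx (fun i => |a i|) n < |a n - a t|)) _ h
  push Not at this
  exact this

lemma nxt_le (a : ℕ → ℝ) (l : ℝ) (M t : ℕ) : nxt a l M t ≤ M := by
  by_contra h
  have := (nxt_min (not_le.1 h)).1
  omega

lemma le_nxt (a : ℕ → ℝ) (l : ℝ) {M t : ℕ} (h : t ≤ M) : t ≤ nxt a l M t := by
  rcases nxt_spec a l M t with h1 | h1
  · omega
  · omega

lemma lt_nxt (a : ℕ → ℝ) (l : ℝ) {M t : ℕ} (h : t < M) : t < nxt a l M t := by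
  rcases nxt_spec a l M t with h1 | h1
  · omega
  · omega

lemma nxt_congr {a b : ℕ → ℝ} {l : ℝ} {M t : ℕ} (htM : t ≤ M)
    (h : ∀ n ≤ nxt a l M t, a n = b n) : nxt b l M t = nxt a l M t := by
  classical
  have ht := le_nxt a l htM
  have hm : ∀ n ≤ nxt a l M t, mx (fun i => |a i|) n = mx (fun i => |b i|) n := fun n hn =>
    mx_congr fun k hk => by rw [h k (by omega)]
  conv_lhs => rw [nxt]
  rw [Nat.find_eq_iff]
  constructor
  · rcases nxt_spec a l M t with h1 | h1
    · exact Or.inl h1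
    · right
      rw [← hm _ le_rfl, ← h _ le_rfl, ← h t ht]; exact h1
  · intro n hn
    have := nxt_min hn
    push Not
    rw [← hm n hn.le, ← h n hn.le, ← h t ht]; exact this

/-- stopping times -/
noncomputable def tau (a : ℕ → ℝ) (l : ℝ) (M : ℕ) : ℕ → ℕ
  | 0 => 0
  | i + 1 => nxt a l M (tau a l M i)

lemma tau_le (a : ℕ → ℝ) (l : ℝ) (M i : ℕ) : tau a l M i ≤ M := by
  cases i with
  | zero => exact Nat.zero_le _
  | succ i => exact nxt_le _ _ _ _

lemma tau_le_succ (a : ℕ → ℝ) (l : ℝ) (M i : ℕ) : tau a l M i ≤ tau a l M (i + 1) :=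
  le_nxt _ _ (tau_le _ _ _ _)

lemma tau_ge (a : ℕ → ℝ) (l : ℝ) (M i : ℕ) : min i M ≤ tau a l M i := by
  induction i with
  | zero => simp
  | succ i ih =>
    rcases (tau_le a l M i).lt_or_eq with h | h
    · have : tau a l M i < tau a l M (i + 1) := lt_nxt a l h
      omega
    · have := tau_le_succ a l M i
      omega

lemma tau_congr {a b : ℕ → ℝ} {l : ℝ} {M i : ℕ} (h : ∀ n ≤ tau a l M i, a n = b n) :
    tau b l M i = tau a l M i := by
  induction i with
  | zero => rfl
  | succ i ih =>
    have h1 := tau_le_succ a l M i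
    have e := ih fun n hn => h n (hn.trans h1)
    simp only [tau]
    rw [e]
    exact nxt_congr (tau_le _ _ _ _) h

/-- between `k` and `l` there is a stopping time with a large jump -/
lemma exists_jump (a : ℕ → ℝ) {l : ℝ} (hl : 0 < l) {M k n : ℕ} (hkn : k < n) (hn : n ≤ M)
    (hnd : mx (fun i => |a i|) n < 2 * mx (fun i => |a i|) k)
    (h1 : 2 * l * mx (fun i => |a i|) n < |a n - a k|)
    (h2 : |a n - a k| ≤ 4 * l * mx (fun i => |a i|) n) :
    ∃ i < M, k < tau a l M (i + 1) ∧ tau a l M (i + 1) ≤ n ∧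
      |a n - a k| ≤ 8 * |a (tau a l M (i + 1)) - a (tau a l M i)| := by
  classical
  set A := mx (fun i => |a i|) with hA
  have hmono : Monotone A := mx_mono _
  have ex : ∃ i, k < tau a l M (i + 1) := by
    refine ⟨M, ?_⟩
    have := tau_ge a l M (M + 1)
    omega
  have hi := Nat.find_spec ex
  have hmin : ∀ j < Nat.find ex, tau a l M (j + 1) ≤ k := fun j hj => not_lt.1 (Nat.find_min ex hj)
  set i := Nat.find ex
  have hik : tau a l M i ≤ k := by
    rcases Nat.eq_zero_or_pos i with h | h
    · rw [h]; exact Nat.zero_le _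
    · have := hmin (i - 1) (by omega)
      rwa [Nat.sub_add_cancel h] at this
  have hiM : i < M := by
    have := tau_ge a l M i
    omega
  set t := tau a l M i with ht
  have hs : tau a l M (i + 1) = nxt a l M t := rfl
  rw [hs] at hi
  have b1 : ∀ q, k ≤ q → q ≤ n → q < nxt a l M t → |a q - a t| ≤ l * A n := by
    intro q hq hqn hqs
    rcases (hik.trans hq).eq_or_lt with h | h
    · rw [← h]; simp only [sub_self, abs_zero]
      have : 0 ≤ A n := mx_nonneg _ (abs_nonneg _) _
      positivity
    · refine ((nxt_min hqs).2 h).trans ?_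
      have := hmono hqn
      gcongr
  have bk := b1 k le_rfl hkn.le hi
  have hsn : nxt a l M t ≤ n := by
    by_contra hc
    have bn := b1 n hkn.le le_rfl (not_le.1 hc)
    have := abs_sub_le (a n) (a t) (a k)
    rw [abs_sub_comm (a t)] at this
    linarith
  refine ⟨i, hiM, hi, hsn, ?_⟩
  rw [hs, ← ht]
  rcases nxt_spec a l M t with h | h
  · have e : nxt a l M t = n := le_antisymm hsn (hn.trans h)
    rw [e]
    have := abs_sub_le (a n) (a t) (a k)
    rw [abs_sub_comm (a t)] at this
    have h0 : 0 ≤ A n := mx_nonneg _ (abs_nonneg _) _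
    have : 0 ≤ l * A n := by positivity
    nlinarith
  · have h3 : A k ≤ A (nxt a l M t) := hmono hi.le
    have h4 := h.2
    have : l * A k ≤ l * A (nxt a l M t) := by gcongr
    have : l * A n ≤ l * (2 * A k) := by gcongr
    nlinarith

lemma jump_sum (a : ℕ → ℝ) {l : ℝ} (hl : 0 < l) {M : ℕ} {u : ℕ → ℕ} (hu : Monotone u)
    (huM : ∀ j, u j ≤ M) (s : Finset ℕ)
    (hs : ∀ j ∈ s, mx (fun i => |a i|) (u (j + 1)) < 2 * mx (fun i => |a i|) (u j) ∧
      2 * l * mx (fun i => |a i|) (u (j + 1)) < |a (u (j + 1)) - a (u j)| ∧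
      |a (u (j + 1)) - a (u j)| ≤ 4 * l * mx (fun i => |a i|) (u (j + 1))) :
    ∑ j ∈ s, |a (u (j + 1)) - a (u j)| ^ 2 ≤
      64 * ∑ i ∈ range M, (a (tau a l M (i + 1)) - a (tau a l M i)) ^ 2 := by
  classical
  have ex : ∀ j ∈ s, ∃ i < M, u j < tau a l M (i + 1) ∧ tau a l M (i + 1) ≤ u (j + 1) ∧
      |a (u (j + 1)) - a (u j)| ≤ 8 * |a (tau a l M (i + 1)) - a (tau a l M i)| := by
    intro j hj
    obtain ⟨h1, h2, h3⟩ := hs j hj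
    refine exists_jump a hl ?_ (huM _) h1 h2 h3
    refine lt_of_le_of_ne (hu (Nat.le_succ j)) fun e => ?_
    rw [← e, sub_self, abs_zero] at h2
    have h0 : 0 ≤ mx (fun i => |a i|) (u j) := mx_nonneg _ (abs_nonneg _) _
    have : 0 ≤ 2 * l * mx (fun i => |a i|) (u j) := by positivity
    linarith
  choose! ι hι using ex
  have inj : Set.InjOn ι s := by
    have key : ∀ j ∈ s, ∀ j' ∈ s, j < j' → ι j ≠ ι j' := by
      intro j hj j' hj' h e
      have h1 := (hι j hj).2.2.1
      have h2 := (hι j' hj').2.1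
      rw [← e] at h2
      have := hu (show j + 1 ≤ j' by omega)
      omega
    intro j hj j' hj' e
    rcases lt_trichotomy j j' with h | h | h
    · exact absurd e (key j hj j' hj' h)
    · exact h
    · exact absurd e.symm (key j' hj' j hj h)
  calc _ ≤ ∑ j ∈ s, 64 * (a (tau a l M (ι j + 1)) - a (tau a l M (ι j))) ^ 2 := by
        apply sum_le_sum; intro j hj
        have := pow_le_pow_left₀ (abs_nonneg _) (hι j hj).2.2.2 2
        rw [mul_pow, sq_abs (a (tau a l M (ι j + 1)) - a (tau a l M (ι j)))] at this
        linarith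
    _ = 64 * ∑ i ∈ s.image ι, (a (tau a l M (i + 1)) - a (tau a l M i)) ^ 2 := by
        rw [← mul_sum, sum_image inj]
    _ ≤ _ := by
        gcongr
        intro i hi
        obtain ⟨j, hj, rfl⟩ := mem_image.1 hi
        exact mem_range.2 (hι j hj).1

lemma rpow_sum_le_sum {ι : Type*} (s : Finset ι) (b : ι → ℝ) (hb : ∀ i ∈ s, 0 ≤ b i) {t : ℝ}
    (ht : 0 < t) (ht1 : t ≤ 1) : (∑ i ∈ s, b i) ^ t ≤ ∑ i ∈ s, b i ^ t := by
  classical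
  induction s using Finset.induction_on with
  | empty => simp [ht.ne']
  | insert a s ha ih =>
    rw [sum_insert ha, sum_insert ha]
    have h1 := ih fun i hi => hb i (mem_insert_of_mem hi)
    have h2 := Real.rpow_add_le_add_rpow (hb a (mem_insert_self _ _))
      (sum_nonneg fun i hi => hb i (mem_insert_of_mem hi)) ht.le ht1
    linarith

lemma lep_path (a : ℕ → ℝ) {r : ℝ} (hr : 2 < r) {M m0 : ℕ}
    (hm0 : ∀ k ≤ M, ∀ n ≤ M, |a n - a k| ≤ 2 * (1 / 2) ^ m0 * mx (fun i => |a i|) M → a n = a k)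
    {u : ℕ → ℕ} (hu : Monotone u) (huM : ∀ j, u j ≤ M) (J : ℕ) :
    (∑ j ∈ range J, |a (u (j + 1)) - a (u j)| ^ r) ^ (1 / r) ≤ 4 * mx (fun i => |a i|) M +
      ∑ m ∈ range m0, 128 * ((1 / 2 : ℝ) ^ ((r - 2) / r)) ^ m * (mx (fun i => |a i|) M +
        √(∑ i ∈ range M, (a (tau a ((1 / 2) ^ m / 2) M (i + 1)) -
          a (tau a ((1 / 2) ^ m / 2) M i)) ^ 2)) := by
  classical
  have hr0 : 0 < r := by linarith
  set A := mx (fun i => |a i|) with hA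
  have hmono : Monotone A := mx_mono _
  have hA0 : ∀ n, 0 ≤ A n := fun n => mx_nonneg _ (abs_nonneg _) _
  set δ : ℕ → ℝ := fun j => |a (u (j + 1)) - a (u j)| with hδ
  have hδ0 : ∀ j, 0 ≤ δ j := fun j => abs_nonneg _
  have huj : ∀ j, u j ≤ u (j + 1) := fun j => hu (Nat.le_succ j)
  have hδA : ∀ j, δ j ≤ 2 * A (u (j + 1)) := by
    intro j
    have h1 : |a (u (j + 1))| ≤ A (u (j + 1)) := le_mx (fun i => |a i|) le_rfl
    have h2 : |a (u j)| ≤ A (u (j + 1)) := le_mx (fun i => |a i|) (huj j)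
    have := abs_sub (a (u (j + 1))) (a (u j))
    linarith
  set S : ℕ → ℝ := fun m => ∑ i ∈ range M, (a (tau a ((1 / 2) ^ m / 2) M (i + 1)) -
          a (tau a ((1 / 2) ^ m / 2) M i)) ^ 2 with hS
  have hS0 : ∀ m, 0 ≤ S m := fun m => sum_nonneg fun i _ => sq_nonneg _
  -- classes
  set cl : ℕ → Finset ℕ := fun m => (range J).filter fun j => A (u (j + 1)) < 2 * A (u j) ∧
      2 * ((1 / 2) ^ m / 2) * A (u (j + 1)) < δ j ∧ δ j ≤ 4 * ((1 / 2) ^ m / 2) * A (u (j + 1))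
    with hcl
  have cl_sum : ∀ m, ∑ j ∈ cl m, δ j ^ r ≤ (2 * (1 / 2) ^ m * A M) ^ (r - 2) * (64 * S m) := by
    intro m
    have h1 := jump_sum a (l := (1 / 2) ^ m / 2) (by positivity) hu huM (cl m)
      (fun j hj => (mem_filter.1 hj).2)
    have hp : 0 ≤ (2 * (1 / 2) ^ m * A M) ^ (r - 2) := by
      have := hA0 M; positivity
    refine le_trans ?_ (mul_le_mul_of_nonneg_left h1 hp)
    rw [mul_sum]
    apply sum_le_sum; intro j hj
    have h2 := (mem_filter.1 hj).2.2.2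
    have h3 := hmono (huM (j + 1))
    have h4 : δ j ≤ 2 * (1 / 2) ^ m * A M := by
      refine h2.trans ?_
      rw [show 4 * ((1 / 2 : ℝ) ^ m / 2) = 2 * (1 / 2) ^ m by ring]
      gcongr
    change δ j ^ r ≤ _ * δ j ^ 2
    rw [show δ j ^ r = δ j ^ (r - 2) * δ j ^ 2 by
      rw [← Real.rpow_natCast, ← Real.rpow_add' (hδ0 j) (by push_cast; linarith)]
      congr 1; push_cast; ring]
    have := Real.rpow_le_rpow (hδ0 j) h4 (by linarith : 0 ≤ r - 2)
    gcongr
  have dbl : ∀ j, 2 * A (u j) ≤ A (u (j + 1)) → δ j ^ r ≤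
      2 * 2 ^ r * (A (u (j + 1)) ^ r - A (u j) ^ r) := by
    intro j h
    have h1 := Real.rpow_le_rpow (hδ0 j) (hδA j) hr0.le
    have h2 := Real.rpow_le_rpow (by have := hA0 (u j); positivity) h hr0.le
    rw [Real.mul_rpow (by norm_num) (hA0 _)] at h1 h2
    have h3 : (2:ℝ) ≤ 2 ^ r := by
      conv_lhs => rw [← Real.rpow_one 2]
      exact Real.rpow_le_rpow_of_exponent_le (by norm_num) (by linarith)
    have h4 : 0 ≤ A (u j) ^ r := Real.rpow_nonneg (hA0 _) _
    have h5 : 2 * A (u j) ^ r ≤ A (u (j + 1)) ^ r := by nlinarith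
    nlinarith
  have tot : ∑ j ∈ range J, δ j ^ r ≤ 2 * 2 ^ r * A M ^ r + ∑ m ∈ range m0, ∑ j ∈ cl m, δ j ^ r := by
    have pt : ∀ j ∈ range J, δ j ^ r ≤ 2 * 2 ^ r * (A (u (j + 1)) ^ r - A (u j) ^ r) +
        ∑ m ∈ range m0, if j ∈ cl m then δ j ^ r else 0 := by
      intro j hj
      have n1 : 0 ≤ ∑ m ∈ range m0, if j ∈ cl m then δ j ^ r else 0 :=
        sum_nonneg fun m _ => by split_ifs; exacts [Real.rpow_nonneg (hδ0 j) _, le_rfl]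
      have n2 : 0 ≤ 2 * 2 ^ r * (A (u (j + 1)) ^ r - A (u j) ^ r) := by
        have := Real.rpow_le_rpow (hA0 _) (hmono (huj j)) hr0.le
        have : 0 ≤ A (u (j + 1)) ^ r - A (u j) ^ r := by linarith
        positivity
      rcases le_or_gt (2 * A (u j)) (A (u (j + 1))) with h | h
      · linarith [dbl j h]
      · by_cases hz : δ j = 0
        · rw [hz, Real.zero_rpow hr0.ne']
          rw [hz, Real.zero_rpow hr0.ne'] at n1
          linarith
        · have hAj := hA0 (u (j + 1))
          have ex : ∃ m, 2 * ((1 / 2) ^ m / 2) * A (u (j + 1)) < δ j := by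
            refine ⟨m0, ?_⟩
            by_contra hc
            apply hz
            rw [hδ]; simp only
            rw [hm0 (u j) (huM _) (u (j + 1)) (huM _) ?_, sub_self, abs_zero]
            refine (not_lt.1 hc).trans ?_
            have := hmono (huM (j + 1))
            have h9 : (0:ℝ) < (1 / 2) ^ m0 := by positivity
            calc 2 * ((1 / 2) ^ m0 / 2) * A (u (j + 1)) ≤ 2 * ((1 / 2) ^ m0 / 2) * A M := by gcongr
              _ ≤ _ := by nlinarith [hA0 M]
          have hm := Nat.find_spec ex
          have hmin := fun k hk => not_lt.1 (Nat.find_min ex (m := k) hk)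
          set m := Nat.find ex
          have hmm : m < m0 := by
            by_contra hc
            apply hz
            rw [hδ]; simp only
            rw [hm0 (u j) (huM _) (u (j + 1)) (huM _) ?_, sub_self, abs_zero]
            rcases Nat.eq_zero_or_pos m0 with h0 | h0
            · rw [h0]; have := hδA j; have := hmono (huM (j + 1))
              simp only [hδ] at *
              simp; linarith
            · have := hmin (m0 - 1) (by omega)
              refine this.trans ?_
              have e : (1 / 2 : ℝ) ^ (m0 - 1) = 2 * (1 / 2) ^ m0 := by
                conv_rhs => rw [← Nat.sub_add_cancel h0, pow_succ]
                ring
              rw [e]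
              have := hmono (huM (j + 1))
              calc _ = 2 * (1 / 2) ^ m0 * A (u (j + 1)) := by ring
                _ ≤ _ := by gcongr
          have hjm : j ∈ cl m := by
            refine mem_filter.2 ⟨hj, h, hm, ?_⟩
            rcases Nat.eq_zero_or_pos m with h0 | h0
            · rw [h0]; have := hδA j; norm_num; linarith
            · refine (hmin (m - 1) (by omega)).trans (le_of_eq ?_)
              have e : (1 / 2 : ℝ) ^ (m - 1) = 2 * (1 / 2) ^ m := by
                conv_rhs => rw [← Nat.sub_add_cancel h0, pow_succ]
                ring
              rw [e]; ring
          have := single_le_sum (f := fun m => if j ∈ cl m then δ j ^ r else 0) (s := range m0)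
            (fun m _ => by split_ifs; exacts [Real.rpow_nonneg (hδ0 j) _, le_rfl]) (mem_range.2 hmm)
          simp only [hjm, if_true] at this
          linarith
    refine (sum_le_sum pt).trans ?_
    rw [sum_add_distrib]
    apply add_le_add
    · rw [← mul_sum, sum_range_sub (fun j => A (u j) ^ r)]
      have h1 := Real.rpow_le_rpow (hA0 _) (hmono (huM J)) hr0.le
      have h2 := Real.rpow_nonneg (hA0 (u 0)) r
      gcongr; linarith
    · rw [sum_comm]
      apply le_of_eq
      apply sum_congr rfl; intro m _
      rw [← sum_filter]
      apply sum_congr _ fun _ _ => rfl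
      ext j; simp only [hcl, mem_filter]; tauto
  have h1r : 1 / r ≤ 1 := by rw [div_le_one hr0]; linarith
  have h1r0 : 0 < 1 / r := by positivity
  have hT0 : ∀ m, 0 ≤ (2 * (1 / 2) ^ m * A M) ^ (r - 2) * (64 * S m) := fun m => by
    have := hA0 M; have := hS0 m; positivity
  calc (∑ j ∈ range J, δ j ^ r) ^ (1 / r)
      ≤ (2 * 2 ^ r * A M ^ r + ∑ m ∈ range m0, (2 * (1 / 2) ^ m * A M) ^ (r - 2) * (64 * S m)) ^ (1 / r) := by
        apply Real.rpow_le_rpow (sum_nonneg fun j _ => Real.rpow_nonneg (hδ0 j) _) _ h1r0.le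
        refine tot.trans ?_
        gcongr with m hm
        exact cl_sum m
    _ ≤ (2 * 2 ^ r * A M ^ r) ^ (1 / r) +
        ∑ m ∈ range m0, ((2 * (1 / 2) ^ m * A M) ^ (r - 2) * (64 * S m)) ^ (1 / r) := by
        refine (Real.rpow_add_le_add_rpow (by have := hA0 M; positivity)
          (sum_nonneg fun m _ => hT0 m) h1r0.le h1r).trans ?_
        gcongr
        exact rpow_sum_le_sum _ _ (fun m _ => hT0 m) h1r0 h1r
    _ ≤ _ := by
        apply add_le_add
        · have := hA0 M
          rw [Real.mul_rpow (by positivity) (by positivity), Real.mul_rpow (by positivity) (by positivity),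
            ← Real.rpow_mul (hA0 M), ← Real.rpow_mul (by norm_num), mul_one_div_cancel hr0.ne',
            Real.rpow_one, Real.rpow_one]
          have : (2:ℝ) ^ (1 / r) ≤ 2 := by
            conv_rhs => rw [← Real.rpow_one 2]
            exact Real.rpow_le_rpow_of_exponent_le (by norm_num) h1r
          nlinarith
        · apply sum_le_sum; intro m _
          have hAM := hA0 M
          have hSm := hS0 m
          set κ := (r - 2) / r with hκ
          have hκ0 : 0 ≤ κ := div_nonneg (by linarith) hr0.le
          have hκ1 : κ ≤ 1 := by rw [hκ, div_le_one hr0]; linarith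
          have hk2 : 2 / r = 1 - κ := by rw [hκ]; field_simp; ring
          have e1 : ((2 * (1 / 2) ^ m * A M) ^ (r - 2) * (64 * S m)) ^ (1 / r) =
              2 ^ κ * ((1 / 2) ^ κ) ^ m * 64 ^ (1 / r) * (A M ^ κ * √(S m) ^ (1 - κ)) := by
            rw [Real.mul_rpow (by positivity) (by positivity), ← Real.rpow_mul (by positivity),
              show (r - 2) * (1 / r) = κ by rw [hκ]; ring, Real.mul_rpow (by positivity) hAM,
              Real.mul_rpow (by positivity) (by positivity), Real.mul_rpow (by positivity) hSm,
              Real.sqrt_eq_rpow, ← Real.rpow_mul hSm, ← Real.rpow_natCast,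
              ← Real.rpow_natCast, ← Real.rpow_mul (by norm_num), ← Real.rpow_mul (by norm_num),
              mul_comm κ, show 1 / 2 * (1 - κ) = 1 / r by rw [← hk2]; ring]
            ring
          rw [e1]
          have y := Real.geom_mean_le_arith_mean2_weighted hκ0 (by linarith : 0 ≤ 1 - κ) hAM
            (Real.sqrt_nonneg (S m)) (by ring)
          have y2 : A M ^ κ * √(S m) ^ (1 - κ) ≤ A M + √(S m) := by
            have := Real.sqrt_nonneg (S m)
            nlinarith
          have b1 : (2:ℝ) ^ κ ≤ 2 := by
            conv_rhs => rw [← Real.rpow_one 2]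
            exact Real.rpow_le_rpow_of_exponent_le (by norm_num) hκ1
          have b2 : (64:ℝ) ^ (1 / r) ≤ 64 := by
            conv_rhs => rw [← Real.rpow_one 64]
            exact Real.rpow_le_rpow_of_exponent_le (by norm_num) h1r
          calc _ ≤ 2 * ((1 / 2) ^ κ) ^ m * 64 * (A M + √(S m)) := by gcongr
            _ = _ := by ring

end path

section stp
variable {X : Type*} [Fintype X]

/-- partition attached to a stopping time -/
def stopS (F : ℕ → Setoid X) (τ : X → ℕ) (h : ∀ x y, (F (τ x)).r x y → τ y = τ x) : Setoid X where
  r x y := (F (τ x)).r x y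
  iseqv := ⟨fun x => (F (τ x)).iseqv.refl x,
    fun {x y} hxy => by rw [h x y hxy]; exact (F (τ x)).iseqv.symm hxy,
    fun {x y z} hxy hyz => by
      rw [h x y hxy] at hyz; exact (F (τ x)).iseqv.trans hxy hyz⟩

lemma lep_sq {p C : ℝ} {F : ℕ → Setoid X} (hF : Filt F)
    (H : ∀ (P : ℕ → Setoid X), Filt P → ∀ (M : ℕ) (f : X → ℝ),
      nP p (sq (range M) (mD P f)) ≤ C * nP p f) (f : X → ℝ) (l : ℝ) (M : ℕ) :
    nP p (fun x => √(∑ i ∈ range M, (cE (F (tau (fun n => cE (F n) f x) l M (i + 1))) f x -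
      cE (F (tau (fun n => cE (F n) f x) l M i)) f x) ^ 2)) ≤ C * nP p f := by
  have hst : ∀ i x y, (F (tau (fun n => cE (F n) f x) l M i)).r x y →
      tau (fun n => cE (F n) f y) l M i = tau (fun n => cE (F n) f x) l M i := by
    intro i x y hxy
    exact tau_congr fun n hn => hF.meas f hn hxy
  exact H (fun i => stopS F (fun x => tau (fun n => cE (F n) f x) l M i) (hst i))
    (fun i x y hxy => hF.le (tau_le_succ _ _ _ _) hxy) M f

end stp

/-- Lepingle -/
theorem lepingle {p r : ℝ} (hp : 1 < p) (hr : 2 < r) : ∃ C : ℝ, 0 ≤ C ∧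
    ∀ (X : Type) [Fintype X] (F : ℕ → Setoid X), Filt F → ∀ (M : ℕ) (f : X → ℝ),
    ∃ B : X → ℝ, nP p B ≤ C * nP p f ∧ ∀ x (u : ℕ → ℕ), Monotone u → (∀ j, u j ≤ M) → ∀ J,
      (∑ j ∈ range J, |cE (F (u (j + 1))) f x - cE (F (u j)) f x| ^ r) ^ (1 / r) ≤ B x := by
  obtain ⟨C, hC, H⟩ := SF hp
  have hp0 : 0 < p := by linarith
  have hr0 : 0 < r := by linarith
  set ρ : ℝ := (1 / 2 : ℝ) ^ ((r - 2) / r) with hρ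
  have hρ0 : 0 ≤ ρ := by positivity
  have hρ1 : ρ < 1 := Real.rpow_lt_one (by norm_num) (by norm_num) (div_pos (by linarith) hr0)
  set D := p / (p - 1) with hD
  have hD0 : 0 ≤ D := div_nonneg hp0.le (by linarith)
  refine ⟨4 * D + (1 - ρ)⁻¹ * (128 * (D + C)), ?_, fun X _ F hF M f => ?_⟩
  · have : 0 < 1 - ρ := by linarith
    positivity
  have hev : ∀ᶠ m0 : ℕ in Filter.atTop, ∀ x : X, ∀ k ∈ range (M + 1), ∀ n ∈ range (M + 1),
      |cE (F n) f x - cE (F k) f x| ≤ 2 * (1 / 2) ^ m0 * mx (fun i => |cE (F i) f x|) M →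
        cE (F n) f x = cE (F k) f x := by
    rw [Filter.eventually_all]; intro x
    rw [Filter.eventually_all_finset]; intro k _
    rw [Filter.eventually_all_finset]; intro n _
    by_cases he : cE (F n) f x = cE (F k) f x
    · exact Filter.Eventually.of_forall fun _ _ => he
    · have h1 : 0 < |cE (F n) f x - cE (F k) f x| := abs_pos.2 (sub_ne_zero.2 he)
      have h2 : Filter.Tendsto (fun m0 : ℕ => 2 * (1 / 2 : ℝ) ^ m0 * mx (fun i => |cE (F i) f x|) M)
          Filter.atTop (nhds (2 * 0 * mx (fun i => |cE (F i) f x|) M)) :=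
        ((_root_.tendsto_pow_atTop_nhds_zero_of_lt_one (by norm_num) (by norm_num)).const_mul 2).mul_const _
      rw [mul_zero, zero_mul] at h2
      filter_upwards [h2.eventually (gt_mem_nhds h1)] with m0 hm h3
      exact absurd h3 (not_le.2 hm)
  obtain ⟨m0, hm0⟩ := hev.exists
  set S : ℕ → X → ℝ := fun m x => √(∑ i ∈ range M,
    (cE (F (tau (fun n => cE (F n) f x) ((1 / 2) ^ m / 2) M (i + 1))) f x -
      cE (F (tau (fun n => cE (F n) f x) ((1 / 2) ^ m / 2) M i)) f x) ^ 2) with hS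
  set A : X → ℝ := fun x => mx (fun i => |cE (F i) f x|) M with hA
  refine ⟨fun x => 4 * A x + ∑ m ∈ range m0, 128 * ρ ^ m * (A x + S m x), ?_, ?_⟩
  · have hAn : nP p A ≤ D * nP p f := doob' hF hp f M
    have hSn : ∀ m, nP p (S m) ≤ C * nP p f := fun m =>
      lep_sq hF (fun P hP M f => H X P hP M f) f _ M
    have hf := nP_nonneg p f
    calc _ ≤ nP p (fun x => 4 * A x) + ∑ m ∈ range m0, nP p (fun x => 128 * ρ ^ m * (A x + S m x)) :=
          (nP_add_le hp.le _ _).trans (add_le_add le_rfl (nP_sum_le hp.le _ _))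
      _ ≤ 4 * (D * nP p f) + ∑ m ∈ range m0, ρ ^ m * (128 * (D + C) * nP p f) := by
          gcongr with m hm
          · rw [nP_smul hp0, abs_of_nonneg (by norm_num)]; gcongr
          · rw [nP_smul hp0, abs_of_nonneg (by positivity)]
            have := nP_add_le hp.le A (S m)
            calc _ ≤ 128 * ρ ^ m * (D * nP p f + C * nP p f) := by
                  gcongr; linarith [hSn m]
              _ = _ := by ring
      _ ≤ 4 * (D * nP p f) + (1 - ρ)⁻¹ * (128 * (D + C) * nP p f) := by
          rw [← sum_mul]
          gcongr
          rw [← tsum_geometric_of_lt_one hρ0 hρ1]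
          exact (summable_geometric_of_lt_one hρ0 hρ1).sum_le_tsum _ fun m _ => by positivity
      _ = _ := by ring
  · intro x u hu huM J
    exact lep_path (fun n => cE (F n) f x) hr (fun k hk n hn h => hm0 x k (mem_range.2 (by omega)) n
      (mem_range.2 (by omega)) h) hu huM J

end DF

open MeasureTheory ENNReal
namespace DF
open Finset

section av
variable {G : Type} [AddCommGroup G] [Fintype G] {ι κ : Type} [Fintype ι] [Fintype κ]

/-- averaging operator along a finite family of shifts -/
noncomputable def av (v : ι → G) : (G → ℝ) →ₗ[ℝ] (G → ℝ) where
  toFun f x := (∑ i, f (x - v i)) / Fintype.card ι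
  map_add' f g := by ext x; simp only [Pi.add_apply, sum_add_distrib, add_div]
  map_smul' c f := by
    ext x; simp only [Pi.smul_apply, smul_eq_mul, RingHom.id_apply, ← mul_sum, mul_div_assoc]

lemma av_apply (v : ι → G) (f : G → ℝ) (x : G) : av v f x = (∑ i, f (x - v i)) / Fintype.card ι := rfl

lemma av_mono (v : ι → G) {f g : G → ℝ} (h : ∀ x, f x ≤ g x) (x : G) : av v f x ≤ av v g x := by
  rw [av_apply, av_apply]; gcongr; exact h _

lemma av_nonneg (v : ι → G) {f : G → ℝ} (h : ∀ x, 0 ≤ f x) (x : G) : 0 ≤ av v f x := by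
  rw [av_apply]; exact div_nonneg (sum_nonneg fun i _ => h _) (by positivity)

lemma abs_av_le (v : ι → G) (f : G → ℝ) (x : G) : |av v f x| ≤ av v (fun y => |f y|) x := by
  rw [av_apply, av_apply, abs_div, Nat.abs_cast]
  gcongr; exact abs_sum_le_sum_abs _ _

lemma av_const [Nonempty ι] (v : ι → G) (c : ℝ) (x : G) : av v (fun _ => c) x = c := by
  rw [av_apply, sum_const, card_univ, nsmul_eq_mul, mul_div_cancel_left₀]
  exact_mod_cast Fintype.card_ne_zero

lemma av_cs (v : ι → G) (f g : G → ℝ) (x : G) :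
    av v (fun y => f y * g y) x ^ 2 ≤ av v (fun y => f y ^ 2) x * av v (fun y => g y ^ 2) x := by
  simp only [av_apply]
  rw [div_pow, div_mul_div_comm, ← pow_two]
  gcongr
  exact sum_mul_sq_le_sq_mul_sq _ _ _

lemma nP_shift (p : ℝ) (f : G → ℝ) (s : G) : nP p (fun x => f (x + s)) = nP p f := by
  unfold nP
  congr 1
  exact Equiv.sum_comp (Equiv.addRight s) (fun x => |f x| ^ p)

lemma nP_shift' (p : ℝ) (f : G → ℝ) (s : G) : nP p (fun x => f (x - s)) = nP p f := by
  simp_rw [sub_eq_add_neg]; exact nP_shift p f (-s)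

lemma av_adj (v : ι → G) (f g : G → ℝ) :
    ∑ x, g x * av v f x = ∑ x, av (fun i => - v i) g x * f x := by
  simp only [av_apply]
  simp_rw [mul_div_assoc', div_mul_eq_mul_div, mul_sum, sum_mul]
  rw [← sum_div, ← sum_div]
  congr 1
  rw [sum_comm, sum_comm (s := univ (α := G))]
  apply sum_congr rfl; intro i _
  rw [← Equiv.sum_comp (Equiv.addRight (v i))]
  simp

lemma av_nP_le [Nonempty ι] (v : ι → G) {p : ℝ} (hp : 1 ≤ p) (f : G → ℝ) : nP p (av v f) ≤ nP p f := by
  have hc : (0:ℝ) < Fintype.card ι := by exact_mod_cast Fintype.card_pos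
  have e : av v f = fun x => (Fintype.card ι : ℝ)⁻¹ * ∑ i, f (x - v i) := by
    ext x; rw [av_apply, div_eq_inv_mul]
  rw [e, nP_smul (by linarith), abs_of_nonneg (by positivity)]
  rw [inv_mul_le_iff₀ hc]
  refine (nP_sum_le hp _ _).trans (le_of_eq ?_)
  simp [nP_shift', sum_const]

end av

section transfer
variable {G : Type} [AddCommGroup G] [Fintype G]

/-- averaging a family over translates -/
lemma trans_avg {p C : ℝ} (hp : 1 ≤ p) (f : G → ℝ) (B : G → G → ℝ)
    (hB : ∀ s, nP p (B s) ≤ C * nP p (fun x => f (x - s))) :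
    nP p (fun x => (Fintype.card G : ℝ)⁻¹ * ∑ s, B s (x + s)) ≤ C * nP p f := by
  have hc : (0:ℝ) < Fintype.card G := by exact_mod_cast Fintype.card_pos
  rw [nP_smul (by linarith), abs_of_nonneg (by positivity), inv_mul_le_iff₀ hc]
  refine (nP_sum_le hp _ _).trans ?_
  simp_rw [nP_shift]
  refine (sum_le_sum fun s _ => hB s).trans (le_of_eq ?_)
  simp [nP_shift', sum_const]

end transfer

/-- the group -/
abbrev GG (d K : ℕ) : Type := Fin d → ZMod (3 ^ K)

section grid
variable {d K : ℕ}

/-- shifts of the centred box of radius `N` -/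
def bx (d K N : ℕ) (a : Fin d → Fin (2 * N + 1)) : GG d K := fun j => ((a j : ℕ) : ZMod (3 ^ K)) - N

/-- cube average -/
noncomputable def MN (d K N : ℕ) : (GG d K → ℝ) →ₗ[ℝ] (GG d K → ℝ) := av (bx d K N)

/-- `(3^k-1)/2` -/
def NN (k : ℕ) : ℕ := (3 ^ k - 1) / 2

lemma NN_spec (k : ℕ) : 2 * NN k + 1 = 3 ^ k := by
  unfold NN
  have : 3 ^ k % 2 = 1 := by rw [Nat.pow_mod]; simp
  have : 0 < 3 ^ k := by positivity
  omega

lemma NN_succ (k : ℕ) : NN (k + 1) = NN k + 3 ^ k := by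
  have h1 := NN_spec k
  have h2 := NN_spec (k + 1)
  rw [pow_succ] at h2; omega

lemma bx_rev (N : ℕ) (a : Fin d → Fin (2 * N + 1)) :
    - bx d K N a = bx d K N (fun j => Fin.rev (a j)) := by
  ext j
  simp only [bx, Pi.neg_apply, Fin.val_rev]
  have : (a j : ℕ) + 1 ≤ 2 * N + 1 := (a j).2
  rw [Nat.cast_sub this]; push_cast; ring

/-- reversal of the box -/
def revE (d N : ℕ) : (Fin d → Fin (2 * N + 1)) ≃ (Fin d → Fin (2 * N + 1)) :=
  Equiv.piCongrRight fun _ => Fin.revPerm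

lemma MN_neg (N : ℕ) : av (fun a => - bx d K N a) = MN d K N := by
  apply LinearMap.ext; intro f; funext x
  simp only [MN, av_apply]
  congr 1
  rw [← Equiv.sum_comp (revE d N)]
  simp_rw [bx_rev]
  apply sum_congr rfl; intro a _
  congr 2; ext j; simp [revE, bx]

lemma MN_adj (N : ℕ) (f g : GG d K → ℝ) : ∑ x, g x * MN d K N f x = ∑ x, MN d K N g x * f x := by
  rw [MN, av_adj, MN_neg, MN]

/-- decomposition of the group -/
def grE (d K k : ℕ) (hk : k ≤ K) :
    GG d K ≃ (Fin d → Fin (3 ^ (K - k))) × (Fin d → Fin (3 ^ k)) where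
  toFun z := (fun j => ⟨(z j).val / 3 ^ k, by
      rw [Nat.div_lt_iff_lt_mul (by positivity), ← pow_add, Nat.sub_add_cancel hk]
      exact ZMod.val_lt _⟩,
    fun j => ⟨(z j).val % 3 ^ k, Nat.mod_lt _ (by positivity)⟩)
  invFun q := fun j => ((3 ^ k * (q.1 j : ℕ) + (q.2 j : ℕ) : ℕ) : ZMod (3 ^ K))
  left_inv z := by
    ext j; simp only
    rw [Nat.div_add_mod, ZMod.natCast_zmod_val]
  right_inv q := by
    have hlt : ∀ j, 3 ^ k * (q.1 j : ℕ) + (q.2 j : ℕ) < 3 ^ K := by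
      intro j
      have h1 := (q.1 j).2
      have h2 := (q.2 j).2
      have h3 : 3 ^ K = 3 ^ k * 3 ^ (K - k) := by rw [← pow_add]; congr 1; omega
      rw [h3]
      calc _ < 3 ^ k * (q.1 j : ℕ) + 3 ^ k := by omega
        _ = 3 ^ k * ((q.1 j : ℕ) + 1) := by ring
        _ ≤ _ := Nat.mul_le_mul_left _ h1
    apply Prod.ext
    · ext j
      simp only [ZMod.val_natCast_of_lt (hlt j)]
      rw [Nat.mul_add_div (by positivity), Nat.div_eq_of_lt (q.2 j).2, add_zero]
    · ext j
      simp only [ZMod.val_natCast_of_lt (hlt j)]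
      rw [Nat.mul_add_mod, Nat.mod_eq_of_lt (q.2 j).2]

/-- cubes of side `3^k` -/
def lev (d K k : ℕ) : Setoid (GG d K) where
  r x y := ∀ j, (x j).val / 3 ^ k = (y j).val / 3 ^ k
  iseqv := ⟨fun _ _ => rfl, fun h j => (h j).symm, fun h1 h2 j => (h1 j).trans (h2 j)⟩

lemma lev_mono {k l : ℕ} (h : k ≤ l) {x y : GG d K} (hxy : (lev d K k).r x y) :
    (lev d K l).r x y := by
  intro j
  obtain ⟨m, rfl⟩ := Nat.exists_eq_add_of_le h
  rw [pow_add, ← Nat.div_div_eq_div_mul, ← Nat.div_div_eq_div_mul, hxy j]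

lemma lev_filt : Filt (fun n => lev d K (K - n)) := fun _ _ _ h => lev_mono (by omega) h

/-- cast of a digit vector -/
def dg (d K k : ℕ) (a : Fin d → Fin (3 ^ k)) : GG d K := fun j => ((a j : ℕ) : ZMod (3 ^ K))

lemma lev_iff {k : ℕ} (hk : k ≤ K) (x y : GG d K) :
    (lev d K k).r x y ↔ (grE d K k hk x).1 = (grE d K k hk y).1 := by
  simp only [grE, Equiv.coe_fn_mk, funext_iff, Fin.mk.injEq]
  rfl

lemma grE_symm {k : ℕ} (hk : k ≤ K) (y : GG d K) (b : Fin d → Fin (3 ^ k)) :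
    (grE d K k hk).symm ((grE d K k hk y).1, b) = y - dg d K k (grE d K k hk y).2 + dg d K k b := by
  ext j
  have h : y j = ((3 ^ k * ((y j).val / 3 ^ k) + (y j).val % 3 ^ k : ℕ) : ZMod (3 ^ K)) := by
    rw [Nat.div_add_mod, ZMod.natCast_zmod_val]
  simp only [grE, dg, Equiv.coe_fn_symm_mk, Pi.add_apply, Pi.sub_apply, Equiv.coe_fn_mk]
  push_cast at h ⊢
  linear_combination -h

lemma cE_lev {k : ℕ} (hk : k ≤ K) (g : GG d K → ℝ) (y : GG d K) :
    cE (lev d K k) g y =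
      (∑ b, g (y - dg d K k (grE d K k hk y).2 + dg d K k b)) / ((3 ^ k) ^ d : ℕ) := by
  classical
  have key : ∀ g : GG d K → ℝ, (∑ z, if (lev d K k).r y z then g z else 0) =
      ∑ b, g (y - dg d K k (grE d K k hk y).2 + dg d K k b) := by
    intro g
    rw [← Equiv.sum_comp (grE d K k hk).symm, Fintype.sum_prod_type]
    simp_rw [lev_iff hk, Equiv.apply_symm_apply]
    rw [sum_eq_single (grE d K k hk y).1]
    · simp only [if_true]
      simp_rw [grE_symm hk]
    · intro c _ hc
      apply sum_eq_zero; intro b _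
      rw [if_neg (Ne.symm hc)]
    · simp
  have h1 := key g
  have h2 := key fun _ => 1
  simp only [cE]
  convert congrArg₂ (· / ·) h1 h2 using 2
  simp

lemma MN_dg (k : ℕ) (f : GG d K → ℝ) (x : GG d K) :
    MN d K (NN k) f x = (∑ a, f (x - (dg d K k a - fun _ => (NN k : ZMod (3 ^ K))))) / ((3 ^ k) ^ d : ℕ) := by
  rw [MN, av_apply]
  congr 1
  · rw [← Equiv.sum_comp (Equiv.piCongrRight fun _ : Fin d => finCongr (NN_spec k))]
    rfl
  · rw [Fintype.card_fun, Fintype.card_fin, Fintype.card_fin, NN_spec]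

lemma MN_dg' (k : ℕ) (f : GG d K → ℝ) (x : GG d K) :
    MN d K (NN k) f x = (∑ a, f (x + (dg d K k a - fun _ => (NN k : ZMod (3 ^ K))))) / ((3 ^ k) ^ d : ℕ) := by
  rw [← MN_neg, av_apply]
  congr 1
  · rw [← Equiv.sum_comp (Equiv.piCongrRight fun _ : Fin d => finCongr (NN_spec k))]
    simp_rw [sub_neg_eq_add]
    rfl
  · rw [Fintype.card_fun, Fintype.card_fin, Fintype.card_fin, NN_spec]

/-- square of the triadic averages -/
noncomputable def T2 (d K k : ℕ) : (GG d K → ℝ) →ₗ[ℝ] (GG d K → ℝ) := MN d K (NN k) ∘ₗ MN d K (NN k)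

lemma T2_apply (k : ℕ) (f : GG d K → ℝ) : T2 d K k f = MN d K (NN k) (MN d K (NN k) f) := rfl

/-- the triadic averages are averages of conditional expectations (Rota) -/
lemma T2_id {k : ℕ} (hk : k ≤ K) (f : GG d K → ℝ) (x : GG d K) :
    T2 d K k f x = (Fintype.card (GG d K) : ℝ)⁻¹ *
      ∑ s, cE (lev d K k) (fun y => f (y - s)) (x + s) := by
  rw [T2_apply, MN_dg]
  simp_rw [MN_dg', cE_lev hk]
  rw [← sum_div, ← sum_div]
  have e1 : ∑ s : GG d K, ∑ b, f (x + s - dg d K k (grE d K k hk (x + s)).2 + dg d K k b - s) =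
      ∑ y : GG d K, ∑ b, f (x - dg d K k (grE d K k hk y).2 + dg d K k b) := by
    conv_rhs => rw [← Equiv.sum_comp (Equiv.addLeft x)]
    apply sum_congr rfl; intro s _
    apply sum_congr rfl; intro b _
    congr 1; simp only [Equiv.coe_addLeft]; abel
  rw [e1, ← Equiv.sum_comp (grE d K k hk).symm, Fintype.sum_prod_type]
  simp_rw [Equiv.apply_symm_apply]
  rw [sum_const, card_univ, nsmul_eq_mul]
  have e2 : Fintype.card (GG d K) = Fintype.card (Fin d → Fin (3 ^ (K - k))) * (3 ^ k) ^ d := by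
    rw [Fintype.card_congr (grE d K k hk), Fintype.card_prod]; simp
  have hc1 : (Fintype.card (Fin d → Fin (3 ^ (K - k))) : ℝ) ≠ 0 := by
    exact_mod_cast Fintype.card_ne_zero
  have hc2 : (((3 ^ k) ^ d : ℕ) : ℝ) ≠ 0 := by positivity
  rw [e2, Nat.cast_mul]
  have e3 : ∑ a, ∑ b, f (x - dg d K k a + dg d K k b) =
    ∑ a, ∑ b, f (x - (dg d K k a - fun _ => (NN k : ZMod (3 ^ K))) +
      (dg d K k b - fun _ => (NN k : ZMod (3 ^ K)))) := by
    apply sum_congr rfl; intro s _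
    apply sum_congr rfl; intro b _
    congr 1; abel
  rw [e3]
  field_simp

lemma T2_top_const (f : GG d K → ℝ) (x y : GG d K) : T2 d K K f x = T2 d K K f y := by
  rw [T2_id le_rfl, T2_id le_rfl]
  congr 1
  apply sum_congr rfl; intro s _
  apply cE_meas
  intro j
  rw [Nat.div_eq_of_lt (ZMod.val_lt _), Nat.div_eq_of_lt (ZMod.val_lt _)]

lemma MN_zero (f : GG d K → ℝ) : MN d K 0 f = f := by
  ext x
  rw [MN, av_apply]
  simp only [mul_zero, zero_add]
  have : bx d K 0 = fun _ => 0 := by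
    ext a j; simp [bx]
  rw [this]; simp

lemma T2_zero (f : GG d K → ℝ) : T2 d K 0 f = f := by
  rw [T2_apply]; simp [NN, MN_zero]

/-- differences of consecutive squared averages -/
noncomputable def SD (d K i : ℕ) : (GG d K → ℝ) →ₗ[ℝ] (GG d K → ℝ) := T2 d K i - T2 d K (i + 1)

lemma SD_apply (i : ℕ) (f : GG d K → ℝ) (x : GG d K) :
    SD d K i f x = T2 d K i f x - T2 d K (i + 1) f x := rfl

lemma SD_decomp (f : GG d K → ℝ) : f = ∑ i ∈ range K, SD d K i f + T2 d K K f := by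
  ext x
  simp only [Pi.add_apply, Finset.sum_apply, SD_apply]
  have := sum_range_sub (fun i => - T2 d K i f x) K
  simp only [neg_sub_neg] at this
  rw [this, T2_zero]; ring

end grid

/-- maximal function for the squared averages -/
lemma T2_max {d K : ℕ} {p : ℝ} (hp : 1 < p) {f : GG d K → ℝ} (hf : ∀ x, 0 ≤ f x) :
    ∃ B : GG d K → ℝ, nP p B ≤ p / (p - 1) * nP p f ∧ ∀ x, ∀ k ≤ K, T2 d K k f x ≤ B x := by
  refine ⟨_, trans_avg hp.le f (fun s x => mx (fun n => cE (lev d K (K - n)) (fun y => f (y - s)) x) K)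
    (fun s => doob lev_filt hp (fun x => hf _) K), fun x k hk => ?_⟩
  rw [T2_id hk]
  gcongr with s hs
  have := le_mx (fun n => cE (lev d K (K - n)) (fun y => f (y - s)) (x + s)) (show K - k ≤ K by omega)
  rwa [Nat.sub_sub_self hk] at this

lemma sq_smul {X ι : Type*} (s : Finset ι) (c : ℝ) (F : ι → X → ℝ) (x : X) :
    sq s (fun i x => c * F i x) x = |c| * sq s F x := by
  simp only [sq, mul_pow, ← mul_sum]
  rw [Real.sqrt_mul (sq_nonneg c), Real.sqrt_sq_eq_abs]

/-- Littlewood-Paley estimate -/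
lemma LP {p : ℝ} (hp : 1 < p) : ∃ C : ℝ, 0 ≤ C ∧ ∀ (d K : ℕ) (f : GG d K → ℝ),
    nP p (sq (range K) (fun i => SD d K i f)) ≤ C * nP p f := by
  obtain ⟨C, hC, H⟩ := SF hp
  refine ⟨C, hC, fun d K f => ?_⟩
  refine le_trans (nP_mono (by linarith) fun x => ?_) (trans_avg hp.le f
    (fun s x => sq (range K) (mD (fun n => lev d K (K - n)) (fun y => f (y - s))) x)
    (fun s => H _ _ lev_filt K _))
  rw [abs_of_nonneg (sq_nonneg' _ _ _)]
  have e : sq (range K) (fun i => SD d K i f) x = sq (range K) (fun n x => ∑ s : GG d K,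
      ((Fintype.card (GG d K) : ℝ)⁻¹ * mD (fun n => lev d K (K - n)) (fun y => f (y - s)) (K - 1 - n) (x + s))) x := by
    unfold sq
    congr 1
    apply sum_congr rfl; intro i hi
    have hi := mem_range.1 hi
    congr 1
    simp only
    rw [SD_apply, T2_id (by omega), T2_id (by omega), ← mul_sub, ← sum_sub_distrib, mul_sum]
    apply sum_congr rfl; intro s _
    rw [mD_apply, show K - (K - 1 - i + 1) = i by omega, show K - (K - 1 - i) = i + 1 by omega]
  rw [e]
  refine (sq_sum_le _ _ _ _).trans (le_of_eq ?_)
  rw [mul_sum]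
  apply sum_congr rfl; intro s _
  rw [sq_smul (range K) ((Fintype.card (GG d K) : ℝ)⁻¹)
    (fun n x => mD (fun n => lev d K (K - n)) (fun y => f (y - s)) (K - 1 - n) (x + s)),
    abs_of_nonneg (by positivity)]
  unfold sq
  congr 2
  exact sum_range_reflect (fun n => mD (fun n => lev d K (K - n)) (fun y => f (y - s)) n (x + s) ^ 2) K

lemma lr_sum_le {ι : Type*} {r : ℝ} (hr : 1 ≤ r) (s : Finset ι) (J : ℕ) (D : ι → ℕ → ℝ) :
    (∑ j ∈ range J, |∑ i ∈ s, D i j| ^ r) ^ (1 / r) ≤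
      ∑ i ∈ s, (∑ j ∈ range J, |D i j| ^ r) ^ (1 / r) := by
  have := nP_sum_le (X := Fin J) hr s (fun i j => D i j)
  simp only [nP] at this
  simpa only [Finset.sum_range] using this

/-- variational estimate for the squared averages -/
lemma T2_var {p r : ℝ} (hp : 1 < p) (hr : 2 < r) : ∃ C : ℝ, 0 ≤ C ∧ ∀ (d K : ℕ) (f : GG d K → ℝ),
    ∃ B : GG d K → ℝ, nP p B ≤ C * nP p f ∧ ∀ x (u : ℕ → ℕ), Monotone u → (∀ j, u j ≤ K) → ∀ J,
      (∑ j ∈ range J, |T2 d K (u (j + 1)) f x - T2 d K (u j) f x| ^ r) ^ (1 / r) ≤ B x := by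
  obtain ⟨C, hC, H⟩ := lepingle hp hr
  refine ⟨C, hC, fun d K f => ?_⟩
  choose B hB1 hB2 using fun s : GG d K => H _ _ lev_filt K (fun y => f (y - s))
  refine ⟨_, trans_avg hp.le f B hB1, fun x u hu huK J => ?_⟩
  have e : ∀ j, T2 d K (u (j + 1)) f x - T2 d K (u j) f x = ∑ s : GG d K,
      (Fintype.card (GG d K) : ℝ)⁻¹ * (cE (lev d K (u (j + 1))) (fun y => f (y - s)) (x + s) -
        cE (lev d K (u j)) (fun y => f (y - s)) (x + s)) := by
    intro j
    rw [T2_id (huK _), T2_id (huK _), ← mul_sub, ← sum_sub_distrib, mul_sum]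
  simp_rw [e]
  refine (lr_sum_le (by linarith) _ J _).trans ?_
  rw [mul_sum]
  apply sum_le_sum; intro s _
  have hr0 : 0 < r := by linarith
  have hc : (0:ℝ) ≤ (Fintype.card (GG d K) : ℝ)⁻¹ := by positivity
  simp_rw [abs_mul, abs_of_nonneg hc, Real.mul_rpow hc (abs_nonneg _), ← mul_sum]
  rw [Real.mul_rpow (by positivity) (sum_nonneg fun _ _ => by positivity), ← Real.rpow_mul hc,
    mul_one_div_cancel hr0.ne', Real.rpow_one]
  gcongr
  have h := hB2 s (x + s) (fun j => K - u (J - j)) (fun i j hij => by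
    have := hu (show J - j ≤ J - i by omega); simp only; omega) (fun j => by omega) J
  refine le_trans (le_of_eq ?_) h
  congr 1
  rw [← sum_range_reflect]
  apply sum_congr rfl; intro j hj
  have hj := mem_range.1 hj
  rw [Nat.sub_sub_self (huK _), Nat.sub_sub_self (huK _), abs_sub_comm,
    show J - 1 - j + 1 = J - j by omega, show J - (j + 1) = J - 1 - j by omega]

end DF

open MeasureTheory ENNReal
namespace DF
open Finset

section dirichlet

/-- normalized Dirichlet kernel -/
noncomputable def DN (N : ℕ) (t : ℝ) : ℝ :=
  (1 + 2 * ∑ n ∈ range N, Real.cos ((n + 1 : ℝ) * t)) / (2 * N + 1)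

lemma DN_mul (N : ℕ) (t : ℝ) :
    DN N t * (2 * N + 1) = 1 + 2 * ∑ n ∈ range N, Real.cos ((n + 1 : ℝ) * t) := by
  unfold DN; exact div_mul_cancel₀ _ (by positivity)

lemma one_sub_DN (N : ℕ) (t : ℝ) :
    (1 - DN N t) * (2 * N + 1) = 2 * ∑ n ∈ range N, (1 - Real.cos ((n + 1 : ℝ) * t)) := by
  rw [sub_mul, DN_mul, sum_sub_distrib]; simp; ring

lemma DN_le_one (N : ℕ) (t : ℝ) : DN N t ≤ 1 := by
  have h := one_sub_DN N t
  have : 0 ≤ 2 * ∑ n ∈ range N, (1 - Real.cos ((n + 1 : ℝ) * t)) :=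
    mul_nonneg (by norm_num) (sum_nonneg fun n _ => by linarith [Real.cos_le_one ((n + 1 : ℝ) * t)])
  rw [← h] at this
  have := nonneg_of_mul_nonneg_left this (by positivity)
  linarith

lemma abs_DN_le_one (N : ℕ) (t : ℝ) : |DN N t| ≤ 1 := by
  unfold DN
  rw [abs_div, div_le_one (by positivity), abs_of_pos (by positivity : (0:ℝ) < 2 * N + 1)]
  have : |∑ n ∈ range N, Real.cos ((n + 1 : ℝ) * t)| ≤ N := by
    refine (abs_sum_le_sum_abs _ _).trans ?_
    refine (sum_le_sum fun n _ => Real.abs_cos_le_one _).trans ?_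
    simp
  refine (abs_add_le _ _).trans ?_
  rw [abs_one, abs_mul, abs_two]; linarith

lemma DN_sin (N : ℕ) (t : ℝ) :
    DN N t * (2 * N + 1) * Real.sin (t / 2) = Real.sin ((2 * N + 1) * (t / 2)) := by
  rw [DN_mul]
  induction N with
  | zero => simp
  | succ N ih =>
    rw [sum_range_succ, mul_add, ← add_assoc, add_mul, ih]
    push_cast
    have h := Real.sin_sub_sin ((2 * (N + 1) + 1 : ℝ) * (t / 2)) ((2 * N + 1 : ℝ) * (t / 2))
    rw [show ((2 * (N + 1) + 1 : ℝ) * (t / 2) - (2 * N + 1 : ℝ) * (t / 2)) / 2 = t / 2 by ring,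
      show ((2 * (N + 1) + 1 : ℝ) * (t / 2) + (2 * N + 1 : ℝ) * (t / 2)) / 2 = (N + 1) * t by ring] at h
    linarith

lemma one_sub_DN_le (N : ℕ) (t : ℝ) : 1 - DN N t ≤ (N:ℝ) ^ 2 * t ^ 2 / 2 := by
  have h := one_sub_DN N t
  have h2 : ∑ n ∈ range N, (1 - Real.cos ((n + 1 : ℝ) * t)) ≤ ∑ n ∈ range N, ((N:ℝ) ^ 2 * t ^ 2 / 2) := by
    apply sum_le_sum; intro n hn
    have h1 := Real.one_sub_sq_div_two_le_cos (x := (n + 1 : ℝ) * t)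
    have h3 : (n + 1 : ℝ) ≤ N := by exact_mod_cast mem_range.1 hn
    have h4 : ((n + 1 : ℝ) * t) ^ 2 ≤ (N:ℝ) ^ 2 * t ^ 2 := by rw [mul_pow]; gcongr
    linarith
  rw [sum_const, card_range, nsmul_eq_mul] at h2
  have h5 : (1 - DN N t) * (2 * N + 1) ≤ (N:ℝ) ^ 2 * t ^ 2 / 2 * (2 * N + 1) := by
    rw [h]
    have : 0 ≤ (N:ℝ) ^ 2 * t ^ 2 / 2 := by positivity
    nlinarith
  exact le_of_mul_le_mul_right h5 (by positivity)

lemma sum_sq_range (N : ℕ) : ∑ n ∈ range N, ((n:ℝ) + 1) ^ 2 = (N:ℝ) * (N + 1) * (2 * N + 1) / 6 := by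
  induction N with
  | zero => simp
  | succ N ih => rw [sum_range_succ, ih]; push_cast; ring

lemma pi_sq_lt : Real.pi ^ 2 < 10 := by
  have := Real.pi_lt_d2
  have := Real.pi_pos
  nlinarith

lemma le_one_sub_DN {N : ℕ} {t : ℝ} (ht : N * |t| ≤ Real.pi) : (N:ℝ) ^ 2 * t ^ 2 / 15 ≤ 1 - DN N t := by
  have h := one_sub_DN N t
  have h2 : ∑ n ∈ range N, (((n:ℝ) + 1) ^ 2 * (t ^ 2 / 5)) ≤
      ∑ n ∈ range N, (1 - Real.cos ((n + 1 : ℝ) * t)) := by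
    apply sum_le_sum; intro n hn
    have h3 : (n + 1 : ℝ) ≤ N := by exact_mod_cast mem_range.1 hn
    have h1 := Real.cos_le_one_sub_mul_cos_sq (x := (n + 1 : ℝ) * t) (by
      rw [abs_mul, abs_of_nonneg (by positivity)]
      refine le_trans ?_ ht; gcongr)
    have h4 : (1:ℝ) / 5 ≤ 2 / Real.pi ^ 2 := by
      rw [div_le_div_iff₀ (by norm_num) (by positivity)]; linarith [pi_sq_lt]
    have h5 : 1 / 5 * ((n + 1 : ℝ) * t) ^ 2 ≤ 2 / Real.pi ^ 2 * ((n + 1 : ℝ) * t) ^ 2 := by gcongr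
    have : ((n:ℝ) + 1) ^ 2 * (t ^ 2 / 5) = 1 / 5 * ((n + 1 : ℝ) * t) ^ 2 := by ring
    linarith
  rw [← sum_mul, sum_sq_range] at h2
  have h5 : (N:ℝ) ^ 2 * t ^ 2 / 15 * (2 * N + 1) ≤ (1 - DN N t) * (2 * N + 1) := by
    rw [h]
    refine le_trans ?_ (mul_le_mul_of_nonneg_left h2 (by norm_num))
    have : 0 ≤ (N:ℝ) * (2 * N + 1) * t ^ 2 := by positivity
    nlinarith
  exact le_of_mul_le_mul_right h5 (by positivity)

lemma DN_sq_le {N : ℕ} {t : ℝ} (ht : |t| ≤ Real.pi) :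
    DN N t ^ 2 ≤ 1 / (1 + (N:ℝ) ^ 2 * t ^ 2 / 15) := by
  have hpi := Real.pi_pos
  set L : ℝ := 2 * N + 1 with hL
  have hL0 : 0 < L := by positivity
  set x : ℝ := (N:ℝ) ^ 2 * t ^ 2 / 15 with hx
  have hx0 : 0 ≤ x := by positivity
  rw [le_div_iff₀ (by positivity)]
  rcases le_or_gt (L * (|t| / 2)) Real.pi with h | h
  · -- DN ≥ 0
    have h0 : 0 ≤ DN N t := by
      rcases eq_or_ne t 0 with h1 | h1
      · subst h1; unfold DN; simp; positivity
      · have hs := DN_sin N |t|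
        have e : DN N |t| = DN N t := by
          unfold DN
          congr 2; congr 1; apply sum_congr rfl; intro n _
          rw [← Real.cos_abs ((n + 1 : ℝ) * t), abs_mul, abs_of_nonneg (by positivity : (0:ℝ) ≤ n + 1)]
        rw [e] at hs
        have p1 : 0 < |t| := abs_pos.2 h1
        have s1 : 0 < Real.sin (|t| / 2) := Real.sin_pos_of_pos_of_lt_pi (by positivity) (by linarith)
        have s2 : 0 ≤ Real.sin ((2 * N + 1) * (|t| / 2)) :=
          Real.sin_nonneg_of_nonneg_of_le_pi (by positivity) h
        rw [← hs] at s2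
        exact nonneg_of_mul_nonneg_left (nonneg_of_mul_nonneg_left s2 s1) hL0
    have h1 : x ≤ 1 - DN N t := le_one_sub_DN (by
      refine le_trans ?_ h
      rw [hL]; nlinarith [abs_nonneg t])
    have h2 := DN_le_one N t
    have h3 : DN N t ^ 2 ≤ 1 - x := by nlinarith
    nlinarith
  · have ht0 : 0 < |t| := by
      rcases (abs_nonneg t).eq_or_lt with h1 | h1
      · rw [← h1] at h; simp at h; linarith
      · exact h1
    have s1 : |t| / Real.pi ≤ |Real.sin (t / 2)| := by
      have e : |Real.sin (t / 2)| = Real.sin (|t| / 2) := by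
        rw [Real.abs_sin_eq_sin_abs_of_abs_le_pi (by rw [abs_div, abs_two]; linarith), abs_div, abs_two]
      rw [e]
      have := Real.mul_le_sin (x := |t| / 2) (by positivity) (by linarith)
      refine le_trans (le_of_eq ?_) this
      field_simp
    have hs := congrArg abs (DN_sin N t)
    rw [abs_mul, abs_mul, abs_of_pos hL0] at hs
    have h3 : |DN N t| * L * (|t| / Real.pi) ≤ 1 := by
      refine le_trans ?_ (Real.abs_sin_le_one ((2 * N + 1) * (t / 2)))
      rw [← hs]; gcongr
    have h4 : |DN N t| * (L * |t|) ≤ Real.pi := by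
      have : |DN N t| * L * (|t| / Real.pi) = |DN N t| * (L * |t|) / Real.pi := by ring
      rw [this, div_le_one hpi] at h3; exact h3
    set y := L * |t| with hy
    have hy2 : 2 * Real.pi < y := by rw [hy]; linarith
    have h5 : DN N t ^ 2 * y ^ 2 ≤ Real.pi ^ 2 := by
      rw [← sq_abs (DN N t), ← mul_pow]
      exact pow_le_pow_left₀ (by positivity) h4 2
    have h6 : x ≤ y ^ 2 / 60 := by
      rw [hx, hy, mul_pow, sq_abs]
      have : 4 * (N:ℝ) ^ 2 ≤ L ^ 2 := by rw [hL]; nlinarith [(Nat.cast_nonneg N : (0:ℝ) ≤ N)]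
      have : 4 * (N:ℝ) ^ 2 * t ^ 2 ≤ L ^ 2 * t ^ 2 := by gcongr
      linarith
    have h7 : 4 * Real.pi ^ 2 ≤ y ^ 2 := by nlinarith
    have h8 : DN N t ^ 2 * (4 * Real.pi ^ 2) ≤ DN N t ^ 2 * y ^ 2 := by gcongr
    have h9 : DN N t ^ 2 * x ≤ DN N t ^ 2 * (y ^ 2 / 60) := by gcongr
    have h10 : DN N t ^ 2 ≤ 1 / 4 := by
      have : 0 < Real.pi ^ 2 := by positivity
      nlinarith
    nlinarith [pi_sq_lt]

lemma DN_diff {N h : ℕ} (hN : 1 ≤ N) (hh : N + h ≤ 4 * N) (t : ℝ) :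
    |DN (N + h) t - DN N t| ≤ 9 * (h / N) * min 1 ((N:ℝ) ^ 2 * t ^ 2) := by
  have hN0 : (0:ℝ) < N := by exact_mod_cast hN
  have e : (DN (N + h) t - DN N t) * (2 * (N + h : ℕ) + 1) =
      2 * ∑ n ∈ range h, (Real.cos ((N + n + 1 : ℝ) * t) - DN N t) := by
    have h1 := DN_mul (N + h) t
    have h2 := DN_mul N t
    rw [sum_range_add] at h1
    rw [sub_mul, h1, sum_sub_distrib, sum_const, card_range, nsmul_eq_mul]
    push_cast
    linear_combination -h2
  set D := DN N t with hD
  have b : ∀ n ∈ range h, |Real.cos ((N + n + 1 : ℝ) * t) - D| ≤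
      9 * min 1 ((N:ℝ) ^ 2 * t ^ 2) := by
    intro n hn
    have hn : ((N + n + 1 : ℕ) : ℝ) ≤ (4 * N : ℕ) := by
      have := mem_range.1 hn
      exact_mod_cast (by omega : N + n + 1 ≤ 4 * N)
    push_cast at hn
    have c1 := Real.cos_le_one ((N + n + 1 : ℝ) * t)
    have c2 := Real.neg_one_le_cos ((N + n + 1 : ℝ) * t)
    have d1 := DN_le_one N t
    have d2 := (abs_le.1 (abs_DN_le_one N t)).1
    rw [← hD] at d1 d2
    have h3 := Real.one_sub_sq_div_two_le_cos (x := (N + n + 1 : ℝ) * t)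
    have h4 : ((N + n + 1 : ℝ) * t) ^ 2 ≤ (4 * N) ^ 2 * t ^ 2 := by rw [mul_pow]; gcongr
    have h5 := one_sub_DN_le N t
    rw [← hD] at h5
    have h6 : 0 ≤ (N:ℝ) ^ 2 * t ^ 2 := by positivity
    rcases min_cases 1 ((N:ℝ) ^ 2 * t ^ 2) with ⟨h, _⟩ | ⟨h, _⟩ <;> rw [h, abs_le] <;>
      constructor <;> nlinarith
  set m := min 1 ((N:ℝ) ^ 2 * t ^ 2) with hm
  have hm0 : 0 ≤ m := by rw [hm]; positivity
  have hb := (abs_sum_le_sum_abs _ _).trans (sum_le_sum b)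
  rw [sum_const, card_range, nsmul_eq_mul] at hb
  have e2 := congrArg abs e
  rw [abs_mul, abs_mul, abs_two, abs_of_pos (by positivity : (0:ℝ) < 2 * (N + h : ℕ) + 1)] at e2
  have h7 : |DN (N + h) t - D| * (2 * N) ≤ 2 * (h * (9 * m)) := by
    refine le_trans ?_ ((le_of_eq e2).trans (by gcongr))
    gcongr
    push_cast
    linarith [(Nat.cast_nonneg h : (0:ℝ) ≤ h)]
  rw [show 9 * ((h:ℝ) / N) * m = (h * (9 * m)) / N by ring, le_div_iff₀ hN0]
  linarith

end dirichlet
end DF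

open MeasureTheory ENNReal
namespace DF
open Finset

section mult
variable {d : ℕ}

lemma prod_diff {ι : Type} (s : Finset ι) {a b q : ι → ℝ} {κ : ℝ} (hκ : 0 ≤ κ)
    (ha : ∀ i, |a i| ≤ q i) (hb : ∀ i, |b i| ≤ q i) (hq : ∀ i, q i ≤ 1)
    (hab : ∀ i, |a i - b i| ≤ κ * (1 - q i)) :
    |∏ i ∈ s, a i - ∏ i ∈ s, b i| ≤ κ * (1 - ∏ i ∈ s, q i) := by
  classical
  have q0 : ∀ i, 0 ≤ q i := fun i => (abs_nonneg _).trans (ha i)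
  induction s using Finset.induction_on with
  | empty => simp
  | insert i s hi ih =>
    rw [prod_insert hi, prod_insert hi, prod_insert hi]
    have h1 : |∏ i ∈ s, a i| ≤ ∏ i ∈ s, q i := by
      rw [abs_prod]; exact prod_le_prod (fun i _ => abs_nonneg _) fun i _ => ha i
    have h2 : ∏ i ∈ s, q i ≤ 1 := prod_le_one (fun i _ => q0 i) fun i _ => hq i
    set A := ∏ i ∈ s, a i
    set B := ∏ i ∈ s, b i
    set Q := ∏ i ∈ s, q i
    have e : a i * A - b i * B = (a i - b i) * A + b i * (A - B) := by ring
    have h3 : |(a i - b i) * A| ≤ κ * (1 - q i) * Q := by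
      rw [abs_mul]; exact mul_le_mul (hab i) h1 (abs_nonneg _) ((abs_nonneg _).trans (hab i))
    have h4 : |b i * (A - B)| ≤ q i * (κ * (1 - Q)) := by
      rw [abs_mul]; exact mul_le_mul (hb i) ih (abs_nonneg _) (q0 i)
    rw [e]
    refine (abs_add_le _ _).trans ((add_le_add h3 h4).trans ?_)
    have := mul_nonneg hκ (mul_nonneg (sub_nonneg.2 (hq i)) (sub_nonneg.2 h2))
    nlinarith

/-- multiplier of the cube average -/
noncomputable def mN (N : ℕ) (θ : Fin d → ℝ) : ℝ := ∏ j, DN N (θ j)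

lemma abs_mN_le (N : ℕ) (θ : Fin d → ℝ) : |mN N θ| ≤ 1 := by
  unfold mN; rw [abs_prod]
  exact prod_le_one (fun i _ => abs_nonneg _) fun i _ => abs_DN_le_one _ _

lemma mN_diff {N h : ℕ} (hN : 1 ≤ N) (hh : N + h ≤ 4 * N) {θ : Fin d → ℝ} (hθ : ∀ j, |θ j| ≤ Real.pi) :
    |mN (N + h) θ - mN N θ| ≤ 288 * (h / N) := by
  have hN0 : (0:ℝ) < N := by exact_mod_cast hN
  have hκ : (0:ℝ) ≤ 288 * (h / N) := by positivity
  have key := prod_diff (univ : Finset (Fin d)) (a := fun j => DN (N + h) (θ j)) (b := fun j => DN N (θ j))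
    (q := fun j => 1 / √(1 + (N:ℝ) ^ 2 * θ j ^ 2 / 15)) hκ
    (by
      intro j
      rw [← Real.sqrt_one, ← Real.sqrt_div (by norm_num), ← Real.sqrt_sq_eq_abs]
      simp only [Real.sqrt_one]
      apply Real.sqrt_le_sqrt
      refine (DN_sq_le (hθ j)).trans ?_
      gcongr; omega)
    (by
      intro j
      rw [← Real.sqrt_one, ← Real.sqrt_div (by norm_num), ← Real.sqrt_sq_eq_abs]
      simp only [Real.sqrt_one]
      exact Real.sqrt_le_sqrt (DN_sq_le (hθ j)))
    (by
      intro j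
      have : 1 ≤ √(1 + (N:ℝ) ^ 2 * θ j ^ 2 / 15) := by
        rw [Real.one_le_sqrt]; have : 0 ≤ (N:ℝ) ^ 2 * θ j ^ 2 / 15 := by positivity
        linarith
      rw [div_le_one (by linarith)]; exact this)
    (by
      intro j
      refine (DN_diff hN hh (θ j)).trans ?_
      have hx : 0 ≤ (N:ℝ) ^ 2 * θ j ^ 2 / 15 := by positivity
      set x := (N:ℝ) ^ 2 * θ j ^ 2 / 15 with hxd
      have e : (N:ℝ) ^ 2 * θ j ^ 2 = 15 * x := by rw [hxd]; ring
      rw [e]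
      have s1 : 1 ≤ √(1 + x) := by rw [Real.one_le_sqrt]; linarith
      have s2 : √(1 + x) ^ 2 = 1 + x := Real.sq_sqrt (by linarith)
      set s := √(1 + x)
      have : min 1 (15 * x) ≤ 32 * (1 - 1 / s) := by
        have e3 : 1 - 1 / s = (s - 1) / s := by field_simp
        rw [e3, show 32 * ((s - 1) / s) = 32 * (s - 1) / s by ring, le_div_iff₀ (by linarith)]
        rcases le_or_gt s (31 / 30) with h | h
        · refine (mul_le_mul_of_nonneg_right (min_le_right _ _) (by linarith)).trans ?_
          have : 15 * x = 15 * (s - 1) * (s + 1) := by nlinarith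
          rw [this]
          have h7 : 15 * ((s + 1) * s) ≤ 32 := by nlinarith
          nlinarith [mul_le_mul_of_nonneg_left h7 (by linarith : 0 ≤ s - 1)]
        · refine (mul_le_mul_of_nonneg_right (min_le_left _ _) (by linarith)).trans ?_
          linarith
      have h0 : (0:ℝ) ≤ h / N := by positivity
      nlinarith [mul_le_mul_of_nonneg_left this h0])
  refine key.trans ?_
  have : 0 ≤ ∏ j, (1 / √(1 + (N:ℝ) ^ 2 * θ j ^ 2 / 15)) := prod_nonneg fun j _ => by positivity
  nlinarith

lemma one_sub_mN (N : ℕ) (θ : Fin d → ℝ) : 1 - mN N θ ≤ (N:ℝ) ^ 2 * (∑ j, θ j ^ 2) / 2 := by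
  have : ∀ s : Finset (Fin d), |1 - ∏ j ∈ s, DN N (θ j)| ≤ ∑ j ∈ s, (N:ℝ) ^ 2 * θ j ^ 2 / 2 := by
    intro s
    induction s using Finset.induction_on with
    | empty => simp
    | insert i s hi ih =>
      rw [prod_insert hi, sum_insert hi]
      have e : 1 - DN N (θ i) * ∏ j ∈ s, DN N (θ j) =
        (1 - DN N (θ i)) + DN N (θ i) * (1 - ∏ j ∈ s, DN N (θ j)) := by ring
      rw [e]
      refine (abs_add_le _ _).trans (add_le_add ?_ ?_)
      · rw [abs_of_nonneg (by linarith [DN_le_one N (θ i)])]; exact one_sub_DN_le _ _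
      · rw [abs_mul]
        exact (mul_le_of_le_one_left (abs_nonneg _) (abs_DN_le_one _ _)).trans ih
  refine (le_abs_self _).trans ((this univ).trans (le_of_eq ?_))
  rw [← sum_div, ← mul_sum]

lemma mN_sq_le (N : ℕ) {θ : Fin d → ℝ} (hθ : ∀ j, |θ j| ≤ Real.pi) :
    mN N θ ^ 2 ≤ 1 / (1 + (N:ℝ) ^ 2 * (∑ j, θ j ^ 2) / 15) := by
  unfold mN
  rw [← prod_pow]
  refine (prod_le_prod (fun i _ => sq_nonneg _) fun i _ => DN_sq_le (hθ i)).trans ?_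
  simp only [one_div, Finset.prod_inv_distrib]
  have h0 : 0 ≤ ∑ j, θ j ^ 2 := sum_nonneg fun i _ => sq_nonneg _
  have : ∀ s : Finset (Fin d), 1 + ∑ i ∈ s, (N:ℝ) ^ 2 * θ i ^ 2 / 15 ≤ ∏ i ∈ s, (1 + (N:ℝ) ^ 2 * θ i ^ 2 / 15) := by
    intro s
    induction s using Finset.induction_on with
    | empty => simp
    | insert i s hi ih =>
      rw [prod_insert hi, sum_insert hi]
      have a1 : 0 ≤ (N:ℝ) ^ 2 * θ i ^ 2 / 15 := by positivity
      have a2 : 0 ≤ ∑ i ∈ s, (N:ℝ) ^ 2 * θ i ^ 2 / 15 := sum_nonneg fun i _ => by positivity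
      nlinarith
  have := this univ
  rw [← sum_div, ← mul_sum] at this
  gcongr

/-- `3^k` times the Euclidean size of the angle vector -/
noncomputable def yy (k : ℕ) (θ : Fin d → ℝ) : ℝ := 3 ^ k * √(∑ j, θ j ^ 2)

lemma yy_nonneg (k : ℕ) (θ : Fin d → ℝ) : 0 ≤ yy k θ := by unfold yy; positivity

lemma yy_sq (k : ℕ) (θ : Fin d → ℝ) : yy k θ ^ 2 = (3 ^ k) ^ 2 * ∑ j, θ j ^ 2 := by
  unfold yy; rw [mul_pow, Real.sq_sqrt (sum_nonneg fun i _ => sq_nonneg _)]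

lemma NN_cast (k : ℕ) : (NN k : ℝ) = (3 ^ k - 1) / 2 := by
  have : ((2 * NN k + 1 : ℕ) : ℝ) = ((3 ^ k : ℕ) : ℝ) := by rw [NN_spec]
  push_cast at this; linarith

lemma one_le_three_pow (k : ℕ) : (1:ℝ) ≤ 3 ^ k := one_le_pow₀ (by norm_num)

lemma NN_ge {k : ℕ} (hk : 1 ≤ k) : (3:ℝ) ^ k / 3 ≤ NN k := by
  rw [NN_cast]
  have : (3:ℝ) ^ 1 ≤ 3 ^ k := pow_le_pow_right₀ (by norm_num) hk
  linarith

lemma one_sub_mN' {k ν : ℕ} (h2 : ν ≤ NN (k + 1)) (θ : Fin d → ℝ) : 1 - mN ν θ ≤ 9 / 8 * yy k θ ^ 2 := by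
  refine (one_sub_mN ν θ).trans ?_
  rw [yy_sq]
  have : (ν:ℝ) ≤ 3 / 2 * 3 ^ k := by
    have : (ν:ℝ) ≤ NN (k + 1) := by exact_mod_cast h2
    rw [NN_cast] at this
    rw [pow_succ] at this; linarith
  have h3 : (ν:ℝ) ^ 2 ≤ (3 / 2 * 3 ^ k) ^ 2 := by gcongr
  have h0 : 0 ≤ ∑ j, θ j ^ 2 := sum_nonneg fun i _ => sq_nonneg _
  nlinarith [mul_le_mul_of_nonneg_right h3 h0]

lemma mN_sq_le' {k ν : ℕ} (hk : 1 ≤ k) (h1 : NN k ≤ ν) {θ : Fin d → ℝ} (hθ : ∀ j, |θ j| ≤ Real.pi) :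
    mN ν θ ^ 2 * (1 + yy k θ ^ 2 / 135) ≤ 1 := by
  have h := mN_sq_le ν hθ
  have h0 : 0 ≤ ∑ j, θ j ^ 2 := sum_nonneg fun i _ => sq_nonneg _
  rw [le_div_iff₀ (by positivity)] at h
  refine le_trans ?_ h
  gcongr mN ν θ ^ 2 * (1 + ?_)
  rw [yy_sq]
  have h3 : (3:ℝ) ^ k / 3 ≤ ν := (NN_ge hk).trans (by exact_mod_cast h1)
  have h4 : ((3:ℝ) ^ k / 3) ^ 2 ≤ (ν:ℝ) ^ 2 := by gcongr
  nlinarith [mul_le_mul_of_nonneg_right h4 h0]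

lemma mN_mul_yy {k ν : ℕ} (hk : 1 ≤ k) (h1 : NN k ≤ ν) {θ : Fin d → ℝ} (hθ : ∀ j, |θ j| ≤ Real.pi) :
    |mN ν θ| * yy k θ ≤ 12 := by
  have h := mN_sq_le' hk h1 hθ
  have h2 : (|mN ν θ| * yy k θ) ^ 2 ≤ 12 ^ 2 := by
    rw [mul_pow, sq_abs]; nlinarith [sq_nonneg (mN ν θ)]
  exact abs_le_of_sq_le_sq' h2 (by norm_num) |>.2

/-- multiplier decay conditions at scale `k` -/
def Gd (C : ℝ) (k : ℕ) (θ : Fin d → ℝ) (m : ℝ) : Prop :=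
  |m| ≤ C * yy k θ ∧ (1 ≤ k → |m| * yy k θ ≤ C)

lemma Gd_base {k ν : ℕ} (h1 : NN k ≤ ν) (h2 : ν ≤ NN (k + 1)) {θ : Fin d → ℝ} (hθ : ∀ j, |θ j| ≤ Real.pi) :
    Gd 24 k θ (mN ν θ - mN (NN k) θ ^ 2) := by
  have y0 := yy_nonneg k θ
  have a1 := abs_le.1 (abs_mN_le ν θ)
  have a2 := abs_le.1 (abs_mN_le (NN k) θ)
  refine ⟨?_, fun hk => ?_⟩
  · have b1 := one_sub_mN' h2 θ
    have b2 := one_sub_mN' (h1.trans h2) θ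
    rw [abs_le]
    rcases le_or_gt 1 (yy k θ) with h | h
    · constructor <;> nlinarith
    · have : yy k θ ^ 2 ≤ yy k θ := by nlinarith
      constructor <;> nlinarith
  · have b1 := mN_mul_yy hk h1 hθ
    have b2 := mN_mul_yy hk le_rfl hθ
    refine (mul_le_mul_of_nonneg_right (abs_sub _ _) y0).trans ?_
    rw [add_mul, abs_pow]
    have : |mN (NN k) θ| ^ 2 ≤ |mN (NN k) θ| := by
      nlinarith [abs_mN_le (NN k) θ, abs_nonneg (mN (NN k) θ)]
    nlinarith

lemma Gd_sub {k : ℕ} {θ : Fin d → ℝ} {C C' m m' : ℝ} (h : Gd C k θ m) (h' : Gd C' k θ m') :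
    Gd (C + C') k θ (m - m') := by
  have y0 := yy_nonneg k θ
  refine ⟨(abs_sub _ _).trans (by linarith [h.1, h'.1]), fun hk => ?_⟩
  refine (mul_le_mul_of_nonneg_right (abs_sub _ _) y0).trans ?_
  rw [add_mul]; linarith [h.2 hk, h'.2 hk]

/-- multiplier of SD -/
noncomputable def sN (i : ℕ) (θ : Fin d → ℝ) : ℝ := mN (NN i) θ ^ 2 - mN (NN (i + 1)) θ ^ 2

lemma DN_succ {θ : ℝ} (hθ : |θ| ≤ Real.pi) (i : ℕ) : |DN (NN (i + 1)) θ| ≤ |DN (NN i) θ| := by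
  have hpi := Real.pi_pos
  rcases eq_or_ne θ 0 with h | h
  · subst h
    have : ∀ N, DN N 0 = 1 := by
      intro N; unfold DN; simp; rw [div_eq_one_iff_eq (by positivity)]; ring
    rw [this, this]
  · have h1 := DN_sin (NN i) θ
    have h2 := DN_sin (NN (i + 1)) θ
    have c : ∀ k, (2 * (NN k : ℝ) + 1) = 3 ^ k := fun k => by rw [NN_cast]; ring
    rw [c] at h1 h2
    have s0 : 0 < |Real.sin (θ / 2)| := by
      rw [abs_pos]
      intro h0
      have := (Real.sin_eq_zero_iff_of_lt_of_lt (by linarith [(abs_le.1 hθ).1]) (by linarith [(abs_le.1 hθ).2])).1 h0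
      exact h (by linarith)
    have h3 := Real.sin_three_mul (3 ^ i * (θ / 2))
    rw [← mul_assoc, ← pow_succ', ← h1, ← h2] at h3
    rw [h1] at h3
    have e : DN (NN (i + 1)) θ * 3 * (3 ^ i * Real.sin (θ / 2)) =
        DN (NN i) θ * (3 - 4 * Real.sin (3 ^ i * (θ / 2)) ^ 2) * (3 ^ i * Real.sin (θ / 2)) := by
      rw [pow_succ] at h3
      linear_combination h3 - (3 - 4 * Real.sin (3 ^ i * (θ / 2)) ^ 2) * h1
    have e' := mul_right_cancel₀ (mul_ne_zero (by positivity) (abs_pos.1 s0)) e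
    have e2 := congrArg abs e'
    rw [abs_mul, abs_mul] at e2
    have : |3 - 4 * Real.sin (3 ^ i * (θ / 2)) ^ 2| ≤ 3 := by
      rw [abs_le]
      constructor <;> nlinarith [Real.sin_sq_le_one (3 ^ i * (θ / 2)), sq_nonneg (Real.sin (3 ^ i * (θ / 2)))]
    have := mul_le_mul_of_nonneg_left this (abs_nonneg (DN (NN i) θ))
    rw [← e2, abs_of_pos (by norm_num : (0:ℝ) < 3)] at this
    linarith

lemma sN_nonneg (i : ℕ) {θ : Fin d → ℝ} (hθ : ∀ j, |θ j| ≤ Real.pi) : 0 ≤ sN i θ := by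
  unfold sN
  rw [sub_nonneg, sq_le_sq]
  unfold mN; rw [abs_prod, abs_prod]
  exact prod_le_prod (fun _ _ => abs_nonneg _) fun j _ => DN_succ (hθ j) i

lemma sN_le_one (i : ℕ) (θ : Fin d → ℝ) : sN i θ ≤ 1 := by
  unfold sN
  have a2 := abs_le.1 (abs_mN_le (NN i) θ)
  nlinarith [sq_nonneg (mN (NN (i + 1)) θ)]

lemma sum_sN_le (K : ℕ) (θ : Fin d → ℝ) : ∑ i ∈ range K, sN i θ ≤ 1 := by
  unfold sN
  rw [sum_range_sub']
  have a2 := abs_le.1 (abs_mN_le (NN 0) θ)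
  nlinarith [sq_nonneg (mN (NN K) θ)]

lemma sN_le_yy (i : ℕ) (θ : Fin d → ℝ) : sN i θ ≤ 3 / 2 * yy i θ := by
  have y0 := yy_nonneg i θ
  rcases le_or_gt (2 / 3) (yy i θ) with h | h
  · exact (sN_le_one i θ).trans (by linarith)
  · have b1 := one_sub_mN' (le_refl (NN (i + 1))) θ
    have a2 := abs_le.1 (abs_mN_le (NN i) θ)
    have a3 := abs_le.1 (abs_mN_le (NN (i + 1)) θ)
    unfold sN
    nlinarith

lemma sN_mul_yy {i : ℕ} (hi : 1 ≤ i) {θ : Fin d → ℝ} (hθ : ∀ j, |θ j| ≤ Real.pi) : sN i θ * yy i θ ≤ 6 := by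
  have y0 := yy_nonneg i θ
  have h := mN_sq_le' hi le_rfl hθ
  have h2 : sN i θ ≤ mN (NN i) θ ^ 2 := by unfold sN; nlinarith [sq_nonneg (mN (NN (i + 1)) θ)]
  have h3 : mN (NN i) θ ^ 2 * yy i θ ≤ mN (NN i) θ ^ 2 * (6 * (1 + yy i θ ^ 2 / 135)) := by
    gcongr; nlinarith [sq_nonneg (yy i θ - 45 / 4)]
  nlinarith [mul_le_mul_of_nonneg_right h2 y0]

lemma ds_le {C : ℝ} {k : ℕ} {θ : Fin d → ℝ} {m : ℝ} (hθ : ∀ j, |θ j| ≤ Real.pi) (h : Gd C k θ m)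
    (hC : |m| ≤ C) {i n : ℕ} (hn : i = k + n ∨ k = i + n) : |m| * sN i θ ≤ 6 * C * (1 / 3) ^ n := by
  have y0 := yy_nonneg k θ
  have s0 := sN_nonneg i hθ
  have C0 : 0 ≤ C := (abs_nonneg _).trans hC
  have t0 : (0:ℝ) < 3 ^ n := by positivity
  rw [one_div, inv_pow, ← div_eq_mul_inv, le_div_iff₀ t0]
  rcases Nat.eq_zero_or_pos n with h0 | h0
  · subst h0
    rw [pow_zero, mul_one]
    have := mul_le_mul hC (sN_le_one i θ) s0 C0
    linarith
  rcases hn with hn | hn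
  · have e : yy i θ = 3 ^ n * yy k θ := by subst hn; unfold yy; rw [pow_add]; ring
    have h1 := sN_mul_yy (by omega : 1 ≤ i) hθ
    rw [e] at h1
    have h2 := mul_le_mul_of_nonneg_right h.1 (mul_nonneg s0 t0.le)
    have h3 := mul_le_mul_of_nonneg_left h1 C0
    nlinarith
  · have e : yy k θ = 3 ^ n * yy i θ := by subst hn; unfold yy; rw [pow_add]; ring
    have h1 := sN_le_yy i θ
    have h2 := h.2 (by omega)
    rw [e] at h2
    have h3 := mul_le_mul_of_nonneg_left h1 (mul_nonneg (abs_nonneg m) t0.le)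
    nlinarith

lemma dds_le {C η ε : ℝ} {k : ℕ} {θ : Fin d → ℝ} {m : ℝ} (hθ : ∀ j, |θ j| ≤ Real.pi) (h : Gd C k θ m)
    (hη : 0 ≤ η) (hη1 : η ≤ 1) (hC : |m| ≤ C * η) (hC0 : 0 ≤ C) (hε : 0 < ε) (hε1 : ε ≤ 1 / 2)
    {i n : ℕ} (hn : i = k + n ∨ k = i + n) :
    m ^ 2 * sN i θ ≤ (6 * C) ^ 2 * (η ^ (1 - ε) * ((1 / 3) ^ n : ℝ) ^ ε) ^ 2 := by
  have s0 := sN_nonneg i hθ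
  have s1 := sN_le_one i θ
  have h1 := ds_le hθ h (hC.trans (mul_le_of_le_one_right hC0 hη1)) hn
  set a : ℝ := (1 / 3) ^ n
  have a0 : 0 ≤ a := by positivity
  have m0 := abs_nonneg m
  have h2 : |m| * √(sN i θ) ≤ (6 * C) * (η ^ (1 - ε) * a ^ ε) := by
    have e1 : |m| = |m| ^ (1 - ε) * |m| ^ ε := by
      rw [← Real.rpow_add' m0 (by norm_num)]; simp
    have e2 : √(sN i θ) ≤ sN i θ ^ ε := by
      rw [Real.sqrt_eq_rpow]
      rcases s0.eq_or_lt with h | h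
      · rw [← h, Real.zero_rpow (by norm_num), Real.zero_rpow hε.ne']
      · exact Real.rpow_le_rpow_of_exponent_ge h s1 hε1
    calc |m| * √(sN i θ) ≤ |m| * sN i θ ^ ε := by gcongr
      _ = |m| ^ (1 - ε) * (|m| * sN i θ) ^ ε := by
        rw [Real.mul_rpow m0 s0, ← mul_assoc, ← e1]
      _ ≤ (6 * C * η) ^ (1 - ε) * (6 * C * a) ^ ε := by
        gcongr
        · linarith
        · nlinarith
      _ = ((6 * C) ^ (1 - ε) * (6 * C) ^ ε) * (η ^ (1 - ε) * a ^ ε) := by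
        rw [Real.mul_rpow (by positivity) hη, Real.mul_rpow (by positivity) a0]; ring
      _ = _ := by
        rw [← Real.rpow_add' (by positivity) (by norm_num)]; simp
  have h3 := pow_le_pow_left₀ (by positivity) h2 2
  rw [mul_pow, mul_pow, sq_abs, Real.sq_sqrt s0] at h3
  exact h3

end mult
end DF

open MeasureTheory ENNReal
namespace DF
open Finset

section fourier
variable {d K : ℕ}

/-- Fourier transform on the finite group -/
noncomputable def ft (f : GG d K → ℝ) (ψ : AddChar (GG d K) ℂ) : ℂ := ∑ x, (f x : ℂ) * ψ (-x)

lemma ft_planch (f : GG d K → ℝ) :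
    ∑ ψ : AddChar (GG d K) ℂ, ‖ft f ψ‖ ^ 2 = Fintype.card (GG d K) * ∑ x, f x ^ 2 := by
  have h : ((∑ ψ : AddChar (GG d K) ℂ, ‖ft f ψ‖ ^ 2 : ℝ) : ℂ) =
      ((Fintype.card (GG d K) * ∑ x, f x ^ 2 : ℝ) : ℂ) := by
    push_cast
    have h1 : ∀ ψ : AddChar (GG d K) ℂ, (‖ft f ψ‖ : ℂ) ^ 2 = ∑ x, ∑ y, (f x * f y : ℂ) * ψ (y - x) := by
      intro ψ
      rw [← Complex.mul_conj']
      unfold ft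
      rw [map_sum, sum_mul_sum]
      apply sum_congr rfl; intro x _
      apply sum_congr rfl; intro y _
      rw [map_mul, ← AddChar.map_neg_eq_conj, neg_neg, Complex.conj_ofReal, sub_eq_neg_add, AddChar.map_add_eq_mul]
      ring
    simp_rw [h1]
    rw [sum_comm]
    rw [mul_sum]
    apply sum_congr rfl; intro x _
    rw [sum_comm]
    have h2 : ∀ y, ∑ ψ : AddChar (GG d K) ℂ, (f x * f y : ℂ) * ψ (y - x) =
        if y = x then (Fintype.card (GG d K) : ℂ) * (f x) ^ 2 else 0 := by
      intro y
      rw [← mul_sum, AddChar.sum_apply_eq_ite]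
      by_cases h : y = x
      · subst h; simp; ring
      · simp [h, sub_ne_zero.2 h]
    simp_rw [h2]
    simp
  exact_mod_cast h

/-- the angles of a character -/
noncomputable def ang (ψ : AddChar (GG d K) ℂ) (j : Fin d) : ℝ := Complex.arg (ψ (Pi.single j 1))

lemma ang_le (ψ : AddChar (GG d K) ℂ) (j : Fin d) : |ang ψ j| ≤ Real.pi := Complex.abs_arg_le_pi _

lemma ang_spec (ψ : AddChar (GG d K) ℂ) (j : Fin d) :
    ψ (Pi.single j 1) = Complex.exp (ang ψ j * Complex.I) := by
  have := Complex.norm_mul_exp_arg_mul_I (ψ (Pi.single j 1))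
  rw [AddChar.norm_apply] at this
  simpa [ang] using this.symm

lemma exp_sum (N : ℕ) (t : ℝ) :
    ∑ b ∈ range (2 * N + 1), Complex.exp ((t * ((b:ℝ) - N) : ℝ) * Complex.I) = ((DN N t * (2 * N + 1) : ℝ) : ℂ) := by
  rw [DN_mul]
  induction N with
  | zero => simp
  | succ N ih =>
    rw [show 2 * (N + 1) + 1 = (2 * N + 1 + 1) + 1 by ring, sum_range_succ, sum_range_succ']
    have e : ∀ b : ℕ, t * (((b + 1 : ℕ):ℝ) - (N + 1 : ℕ)) = t * ((b:ℝ) - N) := by intro b; push_cast; ring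
    simp_rw [e]
    rw [ih, sum_range_succ]
    have e1 : (t * (((2 * N + 1 : ℕ):ℝ) - N)) = (N + 1) * t := by push_cast; ring
    have e2 : (t * (((0 : ℕ):ℝ) - (N + 1 : ℕ))) = - ((N + 1) * t) := by push_cast; ring
    rw [e1, e2, mul_add, ← add_assoc, Complex.ofReal_add _ (2 * Real.cos _), Complex.ofReal_mul 2, Complex.ofReal_cos,
      Complex.cos]
    generalize ∑ x ∈ range N, Real.cos ((x + 1 : ℝ) * t) = S
    push_cast
    ring_nf

lemma char_bx (ψ : AddChar (GG d K) ℂ) (N : ℕ) (a : Fin d → Fin (2 * N + 1)) :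
    ψ (bx d K N a) = ∏ j, Complex.exp ((ang ψ j * (((a j : ℕ):ℝ) - N) : ℝ) * Complex.I) := by
  have h : bx d K N a = ∑ j, (((a j : ℕ) : ℤ) - (N:ℤ)) • (Pi.single j 1 : GG d K) := by
    ext i
    simp [bx, Finset.sum_apply, Pi.single_apply]
  have hs : ∀ (s : Finset (Fin d)) (g : Fin d → GG d K), ψ (∑ j ∈ s, g j) = ∏ j ∈ s, ψ (g j) := by
    intro s g
    induction s using Finset.induction_on with
    | empty => simp
    | insert i s hi ih => rw [sum_insert hi, prod_insert hi, AddChar.map_add_eq_mul, ih]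
  rw [h, hs]
  apply prod_congr rfl; intro j _
  rw [AddChar.map_zsmul_eq_zpow, ang_spec, ← Complex.exp_int_mul]
  congr 1
  push_cast; ring

lemma char_sum (ψ : AddChar (GG d K) ℂ) (N : ℕ) :
    ∑ a, ψ (bx d K N a) = ((mN N (ang ψ) * (2 * N + 1) ^ d : ℝ) : ℂ) := by
  simp_rw [char_bx]
  have := Finset.prod_univ_sum (fun _ : Fin d => (univ : Finset (Fin (2 * N + 1))))
    (fun j b => Complex.exp ((ang ψ j * (((b : ℕ):ℝ) - N) : ℝ) * Complex.I))
  rw [Fintype.piFinset_univ] at this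
  rw [← this]
  have e : ∀ j, ∑ b : Fin (2 * N + 1), Complex.exp ((ang ψ j * (((b : ℕ):ℝ) - N) : ℝ) * Complex.I) =
      ((DN N (ang ψ j) * (2 * N + 1) : ℝ) : ℂ) := by
    intro j
    rw [← exp_sum, Fin.sum_univ_eq_sum_range (fun b => Complex.exp ((ang ψ j * ((b:ℝ) - N) : ℝ) * Complex.I))]
  simp_rw [e]
  rw [← Complex.ofReal_prod, prod_mul_distrib, prod_const, card_univ, Fintype.card_fin]
  rfl

/-- `T` is a Fourier multiplier with real symbol `m` -/
def HM (T : (GG d K → ℝ) →ₗ[ℝ] (GG d K → ℝ)) (m : (Fin d → ℝ) → ℝ) : Prop :=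
  ∀ f ψ, ft (T f) ψ = (m (ang ψ) : ℂ) * ft f ψ

lemma HM_sub {T T' : (GG d K → ℝ) →ₗ[ℝ] (GG d K → ℝ)} {m m' : (Fin d → ℝ) → ℝ} (h : HM T m) (h' : HM T' m') :
    HM (T - T') (fun θ => m θ - m' θ) := by
  intro f ψ
  have : ft ((T - T') f) ψ = ft (T f) ψ - ft (T' f) ψ := by
    unfold ft; rw [← sum_sub_distrib]; apply sum_congr rfl; intro x _
    rw [LinearMap.sub_apply, Pi.sub_apply]; push_cast; ring
  rw [this, h, h']; push_cast; ring

lemma HM_comp {T T' : (GG d K → ℝ) →ₗ[ℝ] (GG d K → ℝ)} {m m' : (Fin d → ℝ) → ℝ} (h : HM T m) (h' : HM T' m') :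
    HM (T ∘ₗ T') (fun θ => m θ * m' θ) := by
  intro f ψ
  rw [LinearMap.comp_apply, h, h']; push_cast; ring

lemma HM_MN (N : ℕ) : HM (MN d K N) (mN N) := by
  intro f ψ
  have e : ∀ x, (MN d K N f x : ℂ) * ψ (-x) = (∑ a, ((f (x - bx d K N a) : ℂ) * ψ (-x))) / (2 * N + 1) ^ d := by
    intro x
    unfold MN; rw [av_apply]; push_cast
    rw [Fintype.card_fun, Fintype.card_fin, Fintype.card_fin, ← sum_mul]; push_cast
    ring
  unfold ft
  simp_rw [e]
  rw [← sum_div, sum_comm]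
  have e2 : ∀ a, ∑ x, ((f (x - bx d K N a) : ℂ) * ψ (-x)) = ψ (- bx d K N a) * ∑ x, (f x : ℂ) * ψ (-x) := by
    intro a
    rw [← Equiv.sum_comp (Equiv.addRight (bx d K N a)), mul_sum]
    apply sum_congr rfl; intro x _
    simp only [Equiv.coe_addRight, add_sub_cancel_right, neg_add_rev, AddChar.map_add_eq_mul]; ring
  simp_rw [e2]
  rw [← sum_mul]
  have e3 : ∑ a, ψ (- bx d K N a) = ((mN N (ang ψ) * (2 * N + 1) ^ d : ℝ) : ℂ) := by
    simp_rw [AddChar.map_neg_eq_conj]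
    rw [← map_sum, char_sum, Complex.conj_ofReal]
  rw [e3]
  push_cast
  have : (2 * (N:ℂ) + 1) ^ d ≠ 0 := by
    apply pow_ne_zero; exact_mod_cast (by positivity : ((2 * N + 1 : ℕ)) ≠ 0)
  field_simp

lemma HM_T2 (k : ℕ) : HM (T2 d K k) (fun θ => mN (NN k) θ ^ 2) := by
  have := HM_comp (HM_MN (d := d) (K := K) (NN k)) (HM_MN (NN k))
  simp_rw [← pow_two] at this
  exact this

lemma HM_SD (i : ℕ) : HM (SD d K i) (sN i) := HM_sub (HM_T2 i) (HM_T2 (i + 1))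

lemma L2_bound {ι : Type} (s : Finset ι) (T : ι → (GG d K → ℝ) →ₗ[ℝ] (GG d K → ℝ)) (m : ι → (Fin d → ℝ) → ℝ)
    (hT : ∀ i ∈ s, HM (T i) (m i)) {B : ℝ} (hB : 0 ≤ B)
    (hm : ∀ θ : Fin d → ℝ, (∀ j, |θ j| ≤ Real.pi) → ∑ i ∈ s, m i θ ^ 2 ≤ B ^ 2) (f : GG d K → ℝ) :
    nP 2 (sq s (fun i => T i f)) ≤ B * nP 2 f := by
  have hc : (0:ℝ) < Fintype.card (GG d K) := by exact_mod_cast Fintype.card_pos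
  apply nP_le_of (by norm_num) (mul_nonneg hB (nP_nonneg _ _))
  have e0 : (B * nP 2 f) ^ (2:ℝ) = B ^ 2 * ∑ x, f x ^ 2 := by
    rw [Real.mul_rpow hB (nP_nonneg _ _), nP_rpow (by norm_num)]
    norm_num
  have e1 : ∑ x, |sq s (fun i => T i f) x| ^ (2:ℝ) = ∑ i ∈ s, ∑ x, T i f x ^ 2 := by
    rw [sum_comm]; apply sum_congr rfl; intro x _
    rw [Real.rpow_two, sq_abs, sq_sq]
  rw [e0, e1]
  refine le_of_mul_le_mul_left ?_ hc
  rw [mul_sum]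
  calc ∑ i ∈ s, (Fintype.card (GG d K) : ℝ) * ∑ x, T i f x ^ 2
      = ∑ i ∈ s, ∑ ψ : AddChar (GG d K) ℂ, m i (ang ψ) ^ 2 * ‖ft f ψ‖ ^ 2 := by
        apply sum_congr rfl; intro i hi
        rw [← ft_planch]
        apply sum_congr rfl; intro ψ _
        rw [hT i hi f ψ, norm_mul, mul_pow, Complex.norm_real, Real.norm_eq_abs, sq_abs]
    _ = ∑ ψ : AddChar (GG d K) ℂ, (∑ i ∈ s, m i (ang ψ) ^ 2) * ‖ft f ψ‖ ^ 2 := by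
        rw [sum_comm]; simp_rw [sum_mul]
    _ ≤ ∑ ψ : AddChar (GG d K) ℂ, B ^ 2 * ‖ft f ψ‖ ^ 2 := by
        gcongr with ψ _
        exact hm _ (ang_le ψ)
    _ = _ := by rw [← mul_sum, ft_planch]; ring

end fourier
end DF

open MeasureTheory ENNReal
namespace DF
open Finset

section sqf
variable {d K : ℕ}

lemma sq_mono {X ι : Type*} (s : Finset ι) {F G : ι → X → ℝ} {x : X} (h : ∀ i ∈ s, |F i x| ≤ |G i x|) :
    sq s F x ≤ sq s G x := by
  unfold sq
  apply Real.sqrt_le_sqrt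
  exact sum_le_sum fun i hi => sq_le_sq.2 (h i hi)

/-- operators at scales `k` with index `m` -/
structure OpF (d K n : ℕ) (C0 η : ℝ) (D : ℕ → ℕ → (GG d K → ℝ) →ₗ[ℝ] (GG d K → ℝ)) : Prop where
  kill : ∀ k m c, D k m (fun _ => c) = 0
  mult : ∀ k ∈ range K, ∀ m ∈ range n, ∃ δ : (Fin d → ℝ) → ℝ, HM (D k m) δ ∧
    ∀ θ : Fin d → ℝ, (∀ j, |θ j| ≤ Real.pi) → Gd C0 k θ (δ θ) ∧ |δ θ| ≤ C0 * η

lemma piece {n : ℕ} {C0 η : ℝ} (hC0 : 0 ≤ C0) (hη : 0 ≤ η) (hη1 : η ≤ 1)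
    {D : ℕ → ℕ → (GG d K → ℝ) →ₗ[ℝ] (GG d K → ℝ)} (hD : OpF d K n C0 η D)
    {p0 p θ ε W CL : ℝ} (h0 : 1 < p0) (hp : 1 < p) (hθ : 0 ≤ θ) (hθ1 : θ ≤ 1)
    (hpe : 1 / p = (1 - θ) / p0 + θ / 2) (hε : 0 < ε) (hε1 : ε ≤ 1 / 2) (hW : 0 ≤ W) (hCL : 0 ≤ CL)
    (HL : ∀ f, nP p0 (sq (range K) (fun i => SD d K i f)) ≤ CL * nP p0 f)
    (HW : ∀ g : ℕ → GG d K → ℝ, nP p0 (sq (range K ×ˢ range n) (fun i => D i.1 i.2 (g i.1))) ≤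
      W * nP p0 (sq (range K) g))
    (P : Finset ℕ) (e : ℕ → ℕ) (he : Set.InjOn e P) (hP : ∀ k ∈ P, k < K ∧ e k < K) (a : ℕ)
    (ha : ∀ k ∈ P, e k = k + a ∨ k = e k + a) (f : GG d K → ℝ) :
    nP p (sq (range K ×ˢ range n) (fun i => if i.1 ∈ P then D i.1 i.2 (SD d K (e i.1) f) else 0)) ≤
      2 * (W * CL) ^ (1 - θ) * (6 * C0 * (√n * η ^ (1 - ε)) * ((1 / 3) ^ a : ℝ) ^ ε) ^ θ * nP p f := by
  classical
  set s := range K ×ˢ range n with hs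
  let T : (GG d K → ℝ) →ₗ[ℝ] (ℕ × ℕ → GG d K → ℝ) :=
    LinearMap.pi (fun i => if i.1 ∈ P then (D i.1 i.2) ∘ₗ (SD d K (e i.1)) else 0)
  have hT : ∀ f i, T f i = if i.1 ∈ P then D i.1 i.2 (SD d K (e i.1) f) else 0 := by
    intro f i
    simp only [T, LinearMap.pi_apply]
    split_ifs <;> rfl
  have hT' : ∀ f, (fun i : ℕ × ℕ => if i.1 ∈ P then D i.1 i.2 (SD d K (e i.1) f) else 0) = T f := by
    intro f; ext i; rw [hT]
  rw [hT']
  have sub : ∀ b : ℕ → ℝ, (∀ i, 0 ≤ b i) → ∑ k ∈ P, b (e k) ≤ ∑ i ∈ range K, b i := by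
    intro b hb
    rw [← sum_image (f := b) he]
    apply sum_le_sum_of_subset_of_nonneg
    · intro i hi
      obtain ⟨k, hk, rfl⟩ := mem_image.1 hi
      exact mem_range.2 (hP k hk).2
    · intro i _ _; exact hb i
  refine interp s T h0 (by norm_num) hp hθ hθ1 hpe (by positivity) (by positivity) ?_ ?_ f
  · intro f
    let g : ℕ → GG d K → ℝ := fun k => if k ∈ P then SD d K (e k) f else 0
    have e1 : T f = fun i => D i.1 i.2 (g i.1) := by
      ext i : 1
      rw [hT]; simp only [g]; split_ifs <;> simp
    rw [e1]
    refine (HW g).trans ?_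
    rw [mul_assoc]
    refine mul_le_mul_of_nonneg_left (le_trans (nP_mono (by linarith) fun x => ?_) (HL f)) hW
    rw [abs_of_nonneg (sq_nonneg' _ _ _)]
    unfold sq
    apply Real.sqrt_le_sqrt
    refine le_trans (le_of_eq ?_) (sub (fun i => SD d K i f x ^ 2) fun i => sq_nonneg _)
    have : P = (range K).filter (· ∈ P) := by
      ext k; simp only [mem_filter, mem_range]; exact ⟨fun h => ⟨(hP k h).1, h⟩, fun h => h.2⟩
    rw [this, sum_filter]
    apply sum_congr rfl; intro k _
    simp only [g]
    split_ifs <;> simp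
  · intro f
    choose! δ hδ1 hδ2 using hD.mult
    have e1 : T f = fun i => (if i.1 ∈ P then (D i.1 i.2) ∘ₗ (SD d K (e i.1)) else 0) f := by
      ext i : 1
      rw [hT]; split_ifs <;> rfl
    rw [e1]
    refine L2_bound s _ (fun i θ => if i.1 ∈ P then δ i.1 i.2 θ * sN (e i.1) θ else 0) ?_ (by positivity) ?_ f
    · intro i hi
      rw [hs, mem_product] at hi
      split_ifs with h
      · exact HM_comp (hδ1 _ hi.1 _ hi.2) (HM_SD _)
      · intro f ψ; simp [ft]
    · intro θ hθ
      rw [hs, sum_product]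
      set R : ℝ := (6 * C0) ^ 2 * (η ^ (1 - ε) * ((1 / 3) ^ a : ℝ) ^ ε) ^ 2 with hR
      have hR0 : 0 ≤ R := by positivity
      calc ∑ k ∈ range K, ∑ m ∈ range n, (if k ∈ P then δ k m θ * sN (e k) θ else 0) ^ 2
          ≤ ∑ k ∈ range K, (if k ∈ P then n * (R * sN (e k) θ) else 0) := by
            apply sum_le_sum; intro k hk
            split_ifs with h
            · rw [← card_range n, ← nsmul_eq_mul, card_range]
              rw [← card_range n, ← sum_const, card_range]
              apply sum_le_sum; intro m hm
              have := dds_le hθ (hδ2 k hk m hm θ hθ).1 hη hη1 (hδ2 k hk m hm θ hθ).2 hC0 hε hε1 (ha k h)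
              have h2 := mul_le_mul_of_nonneg_right this (sN_nonneg (e k) hθ)
              calc _ = δ k m θ ^ 2 * sN (e k) θ * sN (e k) θ := by ring
                _ ≤ _ := h2
            · simp
        _ = ∑ k ∈ P, n * (R * sN (e k) θ) := by
            rw [← sum_filter]
            apply sum_congr _ fun _ _ => rfl
            ext k; simp only [mem_filter, mem_range]; exact ⟨fun h => h.2, fun h => ⟨(hP k h).1, h⟩⟩
        _ = n * R * ∑ k ∈ P, sN (e k) θ := by rw [mul_sum]; apply sum_congr rfl; intro k _; ring
        _ ≤ n * R * 1 := by
            gcongr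
            exact (sub (fun i => sN i θ) fun i => sN_nonneg i hθ).trans (sum_sN_le K θ)
        _ = _ := by
            rw [hR]
            have : (√(n:ℝ)) ^ 2 = n := Real.sq_sqrt (by positivity)
            calc _ = (√(n:ℝ)) ^ 2 * ((6 * C0) ^ 2 * (η ^ (1 - ε) * ((1 / 3) ^ a : ℝ) ^ ε) ^ 2) := by rw [this, mul_one]
              _ = _ := by ring

lemma split_sum (k K : ℕ) (hk : k < K) (F : ℕ → ℝ) :
    ∑ i ∈ range K, F i = ∑ a ∈ range K, ((if k + a < K then F (k + a) else 0) +
      (if a < k then F (k - 1 - a) else 0)) := by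
  have h1 : ∑ i ∈ range K, F i = ∑ i ∈ range k, F i + ∑ i ∈ range (K - k), F (k + i) := by
    rw [← sum_range_add]; congr 2; omega
  rw [sum_add_distrib, ← sum_filter, ← sum_filter, h1, add_comm, ← sum_range_reflect F k]
  congr 1
  · apply sum_congr _ fun _ _ => rfl
    ext a; simp only [mem_range, mem_filter]; omega
  · apply sum_congr _ fun _ _ => rfl
    ext a; simp only [mem_range, mem_filter]; omega

lemma SQ {p0 p θ ε C0 : ℝ} (h0 : 1 < p0) (hp : 1 < p) (hθ : 0 < θ) (hθ1 : θ ≤ 1)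
    (hpe : 1 / p = (1 - θ) / p0 + θ / 2) (hε : 0 < ε) (hε1 : ε ≤ 1 / 2) (hC0 : 0 ≤ C0) :
    ∃ C : ℝ, 0 ≤ C ∧ ∀ (d K n : ℕ) (η W : ℝ) (D : ℕ → ℕ → (GG d K → ℝ) →ₗ[ℝ] (GG d K → ℝ)),
      0 ≤ η → η ≤ 1 → 0 ≤ W → OpF d K n C0 η D →
      (∀ g : ℕ → GG d K → ℝ, nP p0 (sq (range K ×ˢ range n) (fun i => D i.1 i.2 (g i.1))) ≤
        W * nP p0 (sq (range K) g)) →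
      ∀ f, nP p (sq (range K ×ˢ range n) (fun i => D i.1 i.2 f)) ≤
        C * W ^ (1 - θ) * (√n * η ^ (1 - ε)) ^ θ * nP p f := by
  obtain ⟨CL, hCL, HL⟩ := LP h0
  set q : ℝ := ((1 / 3 : ℝ) ^ ε) ^ θ with hq
  have hq0 : 0 < q := by positivity
  have hq1 : q < 1 := by
    apply Real.rpow_lt_one (by positivity) _ hθ
    exact Real.rpow_lt_one (by norm_num) (by norm_num) hε
  have hq2 : 0 < 1 - q := by linarith
  refine ⟨4 * CL ^ (1 - θ) * (6 * C0) ^ θ / (1 - q), by positivity, ?_⟩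
  intro d K n η W D hη hη1 hW hD HW f
  classical
  set s := range K ×ˢ range n with hs
  set E : ℝ := √n * η ^ (1 - ε) with hE
  have hE0 : 0 ≤ E := by positivity
  let F1 : ℕ → ℕ × ℕ → GG d K → ℝ := fun a i =>
    if i.1 ∈ (range K).filter (fun k => k + a < K) then D i.1 i.2 (SD d K (i.1 + a) f) else 0
  let F2 : ℕ → ℕ × ℕ → GG d K → ℝ := fun a i =>
    if i.1 ∈ (range K).filter (fun k => a < k) then D i.1 i.2 (SD d K (i.1 - 1 - a) f) else 0
  have cst : ∀ a : ℕ, 2 * (W * CL) ^ (1 - θ) * (6 * C0 * E * ((1 / 3) ^ a : ℝ) ^ ε) ^ θ * nP p f =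
      2 * (CL ^ (1 - θ) * (6 * C0) ^ θ) * W ^ (1 - θ) * E ^ θ * nP p f * q ^ a := by
    intro a
    have : (((1 / 3) ^ a : ℝ) ^ ε) ^ θ = q ^ a := by
      have p1 : (0:ℝ) ≤ 1 / 3 := by norm_num
      rw [hq, ← Real.rpow_natCast, ← Real.rpow_natCast, ← Real.rpow_mul p1, ← Real.rpow_mul p1,
        ← Real.rpow_mul p1, ← Real.rpow_mul p1]
      congr 1; ring
    rw [Real.mul_rpow hW hCL, Real.mul_rpow (by positivity) (by positivity), Real.mul_rpow (by positivity) hE0, this]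
    ring
  have B1 : ∀ a ∈ range K, nP p (sq s (F1 a)) ≤
      2 * (CL ^ (1 - θ) * (6 * C0) ^ θ) * W ^ (1 - θ) * E ^ θ * nP p f * q ^ a := by
    intro a _
    rw [← cst]
    refine piece hC0 hη hη1 hD h0 hp hθ.le hθ1 hpe hε hε1 hW hCL (HL d K) HW _ (fun k => k + a)
      (fun x _ y _ h => by simpa using h) ?_ a (fun k _ => Or.inl rfl) f
    intro k hk; simp only [mem_filter, mem_range] at hk; exact hk
  have B2 : ∀ a ∈ range K, nP p (sq s (F2 a)) ≤
      2 * (CL ^ (1 - θ) * (6 * C0) ^ θ) * W ^ (1 - θ) * E ^ θ * nP p f * q ^ a := by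
    intro a _
    have h := piece hC0 hη hη1 hD h0 hp hθ.le hθ1 hpe hε hε1 hW hCL (HL d K) HW
      ((range K).filter (fun k => a < k)) (fun k => k - 1 - a)
      (fun x hx y hy h => by simp at hx hy h; omega) (by intro k hk; simp at hk; omega) (a + 1)
      (fun k hk => by simp at hk; omega) f
    refine h.trans ?_
    rw [cst]
    gcongr 2 * (CL ^ (1 - θ) * (6 * C0) ^ θ) * W ^ (1 - θ) * E ^ θ * nP p f * ?_
    · have := nP_nonneg p f; positivity
    · exact pow_le_pow_of_le_one hq0.le hq1.le (Nat.le_succ a)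
  have pt : ∀ x, |sq s (fun i => D i.1 i.2 f) x| ≤ ∑ a ∈ range K, (sq s (F1 a) x + sq s (F2 a) x) := by
    intro x
    rw [abs_of_nonneg (sq_nonneg' _ _ _)]
    have e1 : sq s (fun i => D i.1 i.2 f) x = sq s (fun i x => ∑ a ∈ range K, (F1 a i x + F2 a i x)) x := by
      unfold sq
      congr 1
      apply sum_congr rfl
      intro i hi
      rw [hs, mem_product] at hi
      congr 1
      have c : T2 d K K f = fun _ => T2 d K K f 0 := by ext y; exact T2_top_const f y 0
      show D i.1 i.2 f x = _
      conv_lhs => rw [SD_decomp f, map_add, c, hD.kill, add_zero, map_sum, Finset.sum_apply]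
      rw [split_sum i.1 K (mem_range.1 hi.1)]
      apply sum_congr rfl; intro a _
      simp only [F1, F2, mem_filter, hi.1, true_and]
      congr 1 <;> split_ifs <;> rfl
    rw [e1]
    refine (sq_sum_le s (range K) (fun a i x => F1 a i x + F2 a i x) x).trans ?_
    exact sum_le_sum fun a _ => sq_add_le s (F1 a) (F2 a) x
  refine (nP_mono (by linarith) pt).trans ((nP_sum_le hp.le _ _).trans ?_)
  set Z := 2 * (CL ^ (1 - θ) * (6 * C0) ^ θ) * W ^ (1 - θ) * E ^ θ * nP p f with hZ
  have hZ0 : 0 ≤ Z := by have := nP_nonneg p f; positivity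
  calc ∑ a ∈ range K, nP p (fun x => sq s (F1 a) x + sq s (F2 a) x)
      ≤ ∑ a ∈ range K, 2 * Z * q ^ a := by
        apply sum_le_sum; intro a ha
        refine (nP_add_le hp.le _ _).trans ?_
        have := add_le_add (B1 a ha) (B2 a ha)
        calc _ ≤ _ := this
          _ = _ := by ring
    _ = 2 * Z * ∑ a ∈ range K, q ^ a := by rw [mul_sum]
    _ ≤ 2 * Z * (1 / (1 - q)) := by
        gcongr
        rw [one_div, ← tsum_geometric_of_lt_one hq0.le hq1]
        exact (summable_geometric_of_lt_one hq0.le hq1).sum_le_tsum _ fun i _ => by positivity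
    _ = _ := by rw [hZ]; ring

end sqf
end DF

open MeasureTheory ENNReal
namespace DF
open Finset

section boot
variable {d K : ℕ}

/-- admissible radii: one per triadic scale -/
def Ad (K : ℕ) (ν : ℕ → ℕ) : Prop := ∀ k < K, NN k ≤ ν k ∧ ν k ≤ NN (k + 1)

lemma NN_le_succ (k : ℕ) : NN k ≤ NN (k + 1) := by rw [NN_succ]; exact Nat.le_add_right _ _

lemma Ad_NN (K : ℕ) : Ad K NN := fun k _ => ⟨le_rfl, NN_le_succ k⟩

/-- maximal inequality for lacunary choices -/
def Mx (d K : ℕ) (A q : ℝ) : Prop := ∀ ν, Ad K ν → ∀ f : GG d K → ℝ, (∀ x, 0 ≤ f x) →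
  ∃ B : GG d K → ℝ, nP q B ≤ A * nP q f ∧ ∀ x, ∀ k < K, MN d K (ν k) f x ≤ B x

lemma Mx_mono {A A' q : ℝ} (h : A ≤ A') (H : Mx d K A q) : Mx d K A' q := by
  intro ν hν f hf
  obtain ⟨B, h1, h2⟩ := H ν hν f hf
  exact ⟨B, h1.trans (mul_le_mul_of_nonneg_right h (nP_nonneg _ _)), h2⟩

lemma V1 {u A : ℝ} (hu1 : 1 < u) (hu2 : u < 2) (hA : 0 ≤ A) (H : Mx d K A (u / (2 - u)))
    {ν : ℕ → ℕ} (hν : Ad K ν) (g : ℕ → GG d K → ℝ) :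
    nP u (sq (range K) (fun k => MN d K (ν k) (g k))) ≤ √A * nP u (sq (range K) g) := by
  have hu0 : 0 < u := by linarith
  have hb : 0 < 2 - u := by linarith
  set F := sq (range K) g with hF
  have F0 : ∀ x, 0 ≤ F x := sq_nonneg' _ _
  set S := sq (range K) (fun k => MN d K (ν k) (g k)) with hS
  have S0 : ∀ x, 0 ≤ S x := sq_nonneg' _ _
  obtain ⟨B, hB1, hB2⟩ := H ν hν (fun x => |F x| ^ (2 - u)) (fun x => by positivity)
  set N := nP u F with hN
  have N0 : 0 ≤ N := nP_nonneg _ _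
  let w : ℕ → GG d K → ℝ := fun k x => g k x ^ 2 * F x ^ (-(2 - u))
  have w0 : ∀ k x, 0 ≤ w k x := fun k x => mul_nonneg (sq_nonneg _) (Real.rpow_nonneg (F0 x) _)
  let V : GG d K → ℝ := fun x => ∑ k ∈ range K, MN d K (ν k) (w k) x
  have V0 : ∀ x, 0 ≤ V x := fun x => sum_nonneg fun k _ => av_nonneg _ (w0 k) x
  have pt : ∀ x, S x ^ 2 ≤ |B x| * V x := by
    intro x
    rw [hS, sq_sq, mul_sum]
    apply sum_le_sum; intro k hk
    have e : g k = fun y => (g k y * F y ^ (-(2 - u) / 2)) * F y ^ ((2 - u) / 2) := by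
      ext y
      rcases (F0 y).eq_or_lt with h | h
      · have := abs_le_sq g y hk
        rw [← hF, ← h] at this
        have : g k y = 0 := abs_nonpos_iff.1 this
        simp [this]
      · rw [mul_assoc, ← Real.rpow_add h]
        ring_nf; simp
    have h1 := av_cs (bx d K (ν k)) (fun y => g k y * F y ^ (-(2 - u) / 2)) (fun y => F y ^ ((2 - u) / 2)) x
    rw [← e] at h1
    have e2 : (fun y => (g k y * F y ^ (-(2 - u) / 2)) ^ 2) = w k := by
      ext y
      rw [mul_pow, ← Real.rpow_mul_natCast (F0 y)]
      simp only [w]; congr 2; push_cast; ring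
    have e3 : (fun y => (F y ^ ((2 - u) / 2)) ^ 2) = fun y => |F y| ^ (2 - u) := by
      ext y
      rw [← Real.rpow_mul_natCast (F0 y), abs_of_nonneg (F0 y)]
      congr 1; push_cast; ring
    rw [e2, e3] at h1
    refine h1.trans ?_
    rw [mul_comm]
    refine mul_le_mul_of_nonneg_right ((hB2 x k (mem_range.1 hk)).trans (le_abs_self _)) (av_nonneg _ (w0 k) x)
  have sumV : ∑ x, |V x| ^ (1:ℝ) = ∑ x, |F x| ^ u := by
    simp_rw [Real.rpow_one, fun x => abs_of_nonneg (V0 x)]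
    rw [sum_comm]
    have : ∀ k, ∑ x, MN d K (ν k) (w k) x = ∑ x, w k x := by
      intro k
      have := MN_adj (d := d) (K := K) (ν k) (w k) (fun _ => 1)
      simp only [one_mul] at this
      rw [this]
      apply sum_congr rfl; intro x _
      rw [MN, av_const, one_mul]
    simp_rw [this]
    rw [sum_comm]
    apply sum_congr rfl; intro x _
    simp only [w]
    rw [← sum_mul, ← sq_sq, ← hF, abs_of_nonneg (F0 x)]
    rcases (F0 x).eq_or_lt with h | h
    · rw [← h, Real.zero_rpow hu0.ne']; simp
    · rw [← Real.rpow_natCast, ← Real.rpow_add h]; congr 1; push_cast; ring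
  have hc : (2 / (2 - u)).HolderConjugate (2 / u) := by
    rw [Real.holderConjugate_iff]
    refine ⟨by rw [lt_div_iff₀ hb]; linarith, ?_⟩
    rw [inv_div, inv_div]; ring
  apply nP_le_of hu0 (by positivity)
  calc ∑ x, |S x| ^ u ≤ ∑ x, |B x| ^ (u / 2) * |V x| ^ (u / 2) := by
        apply sum_le_sum; intro x _
        rw [← Real.mul_rpow (abs_nonneg _) (abs_nonneg _), abs_of_nonneg (V0 x), abs_of_nonneg (S0 x)]
        calc S x ^ u = (S x ^ 2) ^ (u / 2) := by
              rw [← Real.rpow_natCast, ← Real.rpow_mul (S0 x)]; congr 1; push_cast; ring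
          _ ≤ _ := by
              apply Real.rpow_le_rpow (sq_nonneg _) (pt x) (by positivity)
    _ ≤ _ := nP_holder hc _ _
    _ = nP (u / (2 - u)) B ^ (u / 2) * nP 1 V ^ (u / 2) := by
        rw [nP_pow (by positivity) (by positivity), nP_pow (by positivity) (by positivity)]
        congr 3 <;> field_simp
    _ ≤ (A * N ^ (2 - u)) ^ (u / 2) * (N ^ u) ^ (u / 2) := by
        have hx : nP (u / (2 - u)) B ≤ A * N ^ (2 - u) := by
          refine hB1.trans (le_of_eq ?_)
          rw [nP_pow hb (by positivity)]
          congr 3; field_simp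
        have hy : nP 1 V ≤ N ^ u := by
          apply le_of_eq
          have := nP_rpow (p := 1) one_pos V
          rw [Real.rpow_one, sumV] at this
          rw [this, hN, nP_rpow hu0]
        exact mul_le_mul (Real.rpow_le_rpow (nP_nonneg _ _) hx (by positivity))
          (Real.rpow_le_rpow (nP_nonneg _ _) hy (by positivity))
          (Real.rpow_nonneg (nP_nonneg _ _) _) (by positivity)
    _ = (√A * N) ^ u := by
        rw [Real.mul_rpow hA (by positivity), mul_assoc, ← Real.mul_rpow (by positivity) (by positivity),
          ← Real.rpow_add' N0 (by norm_num), Real.mul_rpow (by positivity) N0, Real.sqrt_eq_rpow, ← Real.rpow_mul hA,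
          ← Real.rpow_mul N0]
        congr 2 <;> ring

lemma V2 {p0 A : ℝ} (hp0 : 2 < p0) (hA : 0 ≤ A) (H : Mx d K A (p0 / (p0 - 2)))
    {ν : ℕ → ℕ} (hν : Ad K ν) (g : ℕ → GG d K → ℝ) :
    nP p0 (sq (range K) (fun k => MN d K (ν k) (g k))) ≤ √A * nP p0 (sq (range K) g) := by
  have hb : 0 < p0 - 2 := by linarith
  have hs : 1 < p0 / 2 := by linarith
  set s := p0 / 2 with hsd
  set F := sq (range K) g with hF
  set S := sq (range K) (fun k => MN d K (ν k) (g k)) with hS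
  let V : GG d K → ℝ := fun x => ∑ k ∈ range K, MN d K (ν k) (fun y => g k y ^ 2) x
  have V0 : ∀ x, 0 ≤ V x := fun x => sum_nonneg fun k _ => av_nonneg _ (fun y => sq_nonneg _) x
  have pt : ∀ x, |S x ^ 2| ≤ V x := by
    intro x
    rw [abs_of_nonneg (sq_nonneg _), hS, sq_sq]
    apply sum_le_sum; intro k hk
    have h1 := av_cs (bx d K (ν k)) (g k) (fun y => 1) x
    simp only [mul_one, one_pow] at h1
    rw [av_const, mul_one] at h1
    exact h1
  obtain ⟨B, hB1, hB2⟩ := H ν hν (fun x => |V x| ^ (s - 1)) (fun x => by positivity)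
  have hc : s.HolderConjugate (p0 / (p0 - 2)) := by
    rw [Real.holderConjugate_iff]
    refine ⟨hs, ?_⟩
    rw [hsd, inv_div, inv_div]; field_simp; ring
  set Y := nP s V with hY
  have Y0 : 0 ≤ Y := nP_nonneg _ _
  have N0 : 0 ≤ nP p0 F := nP_nonneg _ _
  have key : Y ^ s ≤ nP p0 F ^ 2 * (A * Y ^ (s - 1)) := by
    rw [hY, nP_rpow (by linarith)]
    calc ∑ x, |V x| ^ s = ∑ x, |V x| ^ (s - 1) * V x := by
          apply sum_congr rfl; intro x _
          rw [abs_of_nonneg (V0 x), ← Real.rpow_add_one' (V0 x) (by linarith)]; congr 1; ring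
      _ = ∑ k ∈ range K, ∑ x, |V x| ^ (s - 1) * MN d K (ν k) (fun y => g k y ^ 2) x := by
          rw [sum_comm]; apply sum_congr rfl; intro x _; rw [← mul_sum]
      _ = ∑ k ∈ range K, ∑ x, MN d K (ν k) (fun x => |V x| ^ (s - 1)) x * g k x ^ 2 := by
          apply sum_congr rfl; intro k _; rw [MN_adj (ν k) _ (fun x => |V x| ^ (s - 1))]
      _ ≤ ∑ k ∈ range K, ∑ x, B x * g k x ^ 2 := by
          apply sum_le_sum; intro k hk; apply sum_le_sum; intro x _
          exact mul_le_mul_of_nonneg_right (hB2 x k (mem_range.1 hk)) (sq_nonneg _)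
      _ = ∑ x, (F x) ^ 2 * B x := by
          rw [sum_comm]; apply sum_congr rfl; intro x _
          rw [← mul_sum, hF, sq_sq, mul_comm]
      _ ≤ _ := nP_holder hc _ _
      _ ≤ nP p0 F ^ 2 * (A * nP s V ^ (s - 1)) := by
          rw [nP_sqfun (by linarith), show 2 * s = p0 by rw [hsd]; ring]
          gcongr
          refine hB1.trans (le_of_eq ?_)
          rw [nP_pow (by linarith) (by positivity)]
          congr 3; rw [hsd]; field_simp
  have h2 : Y ≤ A * nP p0 F ^ 2 := by
    rcases Y0.eq_or_lt with h | h
    · rw [← h]; positivity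
    · have e : Y ^ s = Y ^ (s - 1) * Y := by rw [← Real.rpow_add_one h.ne']; congr 1; ring
      have p1 : 0 < Y ^ (s - 1) := Real.rpow_pos_of_pos h _
      rw [e] at key
      refine le_of_mul_le_mul_left (key.trans (le_of_eq ?_)) p1
      ring
  have h3 : nP p0 S ^ 2 ≤ (√A * nP p0 F) ^ 2 := by
    rw [mul_pow, Real.sq_sqrt hA]
    refine le_trans ?_ h2
    have := nP_sqfun (q := s) (by linarith) S
    rw [show 2 * s = p0 by rw [hsd]; ring] at this
    rw [← this]
    exact nP_mono (by linarith) pt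
  exact (abs_le_of_sq_le_sq' h3 (by positivity)).2

lemma MN_const (N : ℕ) (c : ℝ) : MN d K N (fun _ => c) = fun _ => c := by
  ext x; exact av_const _ _ _

lemma T2_const (k : ℕ) (c : ℝ) : T2 d K k (fun _ => c) = fun _ => c := by
  rw [T2_apply, MN_const, MN_const]

lemma OpF_base {ν : ℕ → ℕ} (hν : Ad K ν) :
    OpF d K 1 24 1 (fun k _ => MN d K (ν k) - T2 d K k) where
  kill k m c := by rw [LinearMap.sub_apply, MN_const, T2_const, sub_self]
  mult k hk m hm := by
    refine ⟨_, HM_sub (HM_MN _) (HM_T2 _), fun θ hθ => ⟨Gd_base (hν k (mem_range.1 hk)).1 (hν k (mem_range.1 hk)).2 hθ, ?_⟩⟩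
    have a1 := abs_le.1 (abs_mN_le (ν k) θ)
    have a2 := abs_le.1 (abs_mN_le (NN k) θ)
    rw [abs_le]; constructor <;> nlinarith

lemma sq_prod_one {X : Type*} (F : ℕ × ℕ → X → ℝ) : sq (range K ×ˢ range 1) F = sq (range K) (fun k => F (k, 0)) := by
  ext x; unfold sq; rw [sum_product]; simp

/-- vector bound for M - T2 -/
lemma W_base {q A : ℝ} (hq : 1 ≤ q) (hA : 1 ≤ A)
    (H : ∀ ν, Ad K ν → ∀ g : ℕ → GG d K → ℝ, nP q (sq (range K) (fun k => MN d K (ν k) (g k))) ≤ √A * nP q (sq (range K) g))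
    {ν : ℕ → ℕ} (hν : Ad K ν) (g : ℕ → GG d K → ℝ) :
    nP q (sq (range K ×ˢ range 1) (fun i => (MN d K (ν i.1) - T2 d K i.1) (g i.1))) ≤ 2 * A * nP q (sq (range K) g) := by
  rw [sq_prod_one]
  have h1 := H ν hν g
  have h2 := H NN (Ad_NN K) (fun k => MN d K (NN k) (g k))
  have h3 := H NN (Ad_NN K) g
  have N0 := nP_nonneg q (sq (range K) g)
  have s1 : √A ≤ A := by
    rw [Real.sqrt_le_left (by linarith)]; nlinarith
  have s2 : √A * √A = A := Real.mul_self_sqrt (by linarith)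
  have h4 : nP q (sq (range K) (fun k => MN d K (NN k) (MN d K (NN k) (g k)))) ≤ A * nP q (sq (range K) g) := by
    refine h2.trans ((mul_le_mul_of_nonneg_left h3 (Real.sqrt_nonneg _)).trans (le_of_eq ?_))
    rw [← mul_assoc, s2]
  calc _ ≤ nP q (fun x => sq (range K) (fun k => MN d K (ν k) (g k)) x +
        sq (range K) (fun k => MN d K (NN k) (MN d K (NN k) (g k))) x) := by
        apply nP_mono (by linarith); intro x
        rw [abs_of_nonneg (sq_nonneg' _ _ _)]
        have := sq_add_le (range K) (fun k => MN d K (ν k) (g k)) (fun k x => (-1) * MN d K (NN k) (MN d K (NN k) (g k)) x) x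
        rw [sq_smul] at this
        simp only [abs_neg, abs_one, one_mul, neg_mul, ← sub_eq_add_neg] at this
        exact this
    _ ≤ _ := nP_add_le hq _ _
    _ ≤ _ := by nlinarith

lemma boot {q : ℝ} (hq : 1 < q) (hq2 : q < 2) : ∃ C : ℝ, 1 ≤ C ∧ ∀ d K A, 1 ≤ A → Mx d K A q → Mx d K (C * A ^ (2 - q)) q := by
  set u := 2 * q / (q + 1) with hu
  have hu1 : 1 < u := by rw [hu, lt_div_iff₀ (by linarith)]; linarith
  have hu2 : u < 2 := by rw [hu, div_lt_iff₀ (by linarith)]; linarith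
  have huq : u / (2 - u) = q := by
    rw [div_eq_iff (by linarith), hu]; field_simp; ring
  obtain ⟨C, hC, H⟩ := SQ (p0 := u) (p := q) (θ := q - 1) (ε := 1 / 2) (C0 := 24) hu1 hq (by linarith) (by linarith)
    (by rw [hu]; field_simp; ring) (by norm_num) le_rfl (by norm_num)
  have hqq : 1 ≤ q / (q - 1) := by rw [le_div_iff₀ (by linarith)]; linarith
  have t0 : (0:ℝ) ≤ 2 ^ (2 - q) := by positivity
  refine ⟨q / (q - 1) + C * 2 ^ (2 - q), by nlinarith [mul_nonneg hC t0], fun d K A hA hM ν hν f hf => ?_⟩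
  obtain ⟨B, hB1, hB2⟩ := T2_max hq hf
  have hV : ∀ ν, Ad K ν → ∀ g : ℕ → GG d K → ℝ, nP u (sq (range K) (fun k => MN d K (ν k) (g k))) ≤ √A * nP u (sq (range K) g) :=
    fun ν hν g => V1 hu1 hu2 (by linarith) (by rw [huq]; exact hM) hν g
  have h1 := H d K 1 1 (2 * A) _ zero_le_one le_rfl (by linarith) (OpF_base hν)
    (fun g => W_base hu1.le hA hV hν g) f
  rw [sq_prod_one] at h1
  refine ⟨fun x => B x + sq (range K) (fun k => (MN d K (ν k) - T2 d K k) f) x, ?_, fun x k hk => ?_⟩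
  · refine (nP_add_le hq.le _ _).trans ((add_le_add hB1 h1).trans ?_)
    have N0 := nP_nonneg q f
    have a1 : 1 ≤ A ^ (2 - q) := Real.one_le_rpow hA (by linarith)
    have e : (2 * A) ^ (1 - (q - 1)) = 2 ^ (2 - q) * A ^ (2 - q) := by
      rw [Real.mul_rpow (by norm_num) (by linarith)]; congr 2 <;> ring
    rw [e]
    simp only [Nat.cast_one, Real.sqrt_one, Real.one_rpow, mul_one]
    have : q / (q - 1) ≤ q / (q - 1) * A ^ (2 - q) := le_mul_of_one_le_right (by linarith) a1
    nlinarith [mul_le_mul_of_nonneg_right this N0]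
  · have h2 := hB2 x k hk.le
    have h3 := (le_abs_self _).trans (abs_le_sq (fun k => (MN d K (ν k) - T2 d K k) f) x (mem_range.2 hk))
    rw [LinearMap.sub_apply, Pi.sub_apply] at h3
    linarith

lemma Mx_trivial {q : ℝ} (hq : 1 ≤ q) (d K : ℕ) : Mx d K K q := by
  intro ν hν f hf
  refine ⟨fun x => ∑ k ∈ range K, MN d K (ν k) f x, ?_, fun x k hk => ?_⟩
  · refine (nP_sum_le hq _ _).trans ?_
    refine (sum_le_sum fun k _ => av_nP_le _ hq f).trans ?_
    simp
  · exact single_le_sum (f := fun k => MN d K (ν k) f x) (fun k _ => av_nonneg _ hf x) (mem_range.2 hk)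

/-- dimension-free lacunary maximal inequality -/
lemma Mx_all {q : ℝ} (hq : 1 < q) (hq2 : q < 2) : ∃ C : ℝ, 1 ≤ C ∧ ∀ d K, Mx d K C q := by
  obtain ⟨C, hC, H⟩ := boot hq hq2
  set S : ℝ := C ^ (1 / (q - 1)) with hS
  have S1 : 1 ≤ S := Real.one_le_rpow hC (by have : 0 < q - 1 := by linarith
                                             positivity)
  have eS : C = S ^ (q - 1) := by
    rw [hS, ← Real.rpow_mul (by linarith), one_div_mul_cancel (by linarith), Real.rpow_one]
  set ρ : ℝ := (1 / 2) ^ (q - 1) with hρ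
  have ρ0 : 0 < ρ := by positivity
  have ρ1 : ρ < 1 := Real.rpow_lt_one (by norm_num) (by norm_num) (by linarith)
  refine ⟨2 * S, by linarith, fun d K => ?_⟩
  have step : ∀ A, 2 * S ≤ A → Mx d K A q → Mx d K (ρ * A) q := by
    intro A hA hM
    refine Mx_mono ?_ (H d K A (by linarith) hM)
    have A0 : 0 < A := by linarith
    calc C * A ^ (2 - q) = S ^ (q - 1) * A ^ (2 - q) := by rw [← eS]
      _ ≤ (1 / 2 * A) ^ (q - 1) * A ^ (2 - q) := by gcongr <;> linarith
      _ = ρ * A := by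
        rw [Real.mul_rpow (by norm_num) A0.le, mul_assoc, ← Real.rpow_add A0]
        rw [show q - 1 + (2 - q) = 1 by ring, Real.rpow_one]
  have it : ∀ n : ℕ, Mx d K (max (2 * S) (ρ ^ n * K)) q := by
    intro n
    induction n with
    | zero => exact Mx_mono (by simp) (Mx_trivial hq.le d K)
    | succ n ih =>
      refine Mx_mono ?_ (step _ (le_max_left _ _) ih)
      rw [mul_max_of_nonneg _ _ ρ0.le, pow_succ' ρ n, mul_assoc]
      refine max_le_max (by nlinarith) le_rfl
  obtain ⟨n, hn⟩ := exists_pow_lt_of_lt_one (show 0 < 2 * S / (K + 1) by positivity) ρ1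
  have := it n
  rw [max_eq_left] at this
  · exact this
  · rw [lt_div_iff₀ (by positivity)] at hn
    nlinarith [pow_pos ρ0 n]

end boot
end DF

open MeasureTheory ENNReal
namespace DF
open Finset

section comb
variable {X : Type} [Fintype X]

lemma sq_prod_sq (K n : ℕ) (F : ℕ × ℕ → X → ℝ) (x : X) :
    sq (range K ×ˢ range n) F x ^ 2 = ∑ m ∈ range n, sq (range K) (fun k => F (k, m)) x ^ 2 := by
  rw [sq_sq, sum_product_right]
  apply sum_congr rfl; intro m _; rw [sq_sq]

lemma comb1 {p0 : ℝ} (h0 : 0 < p0) (h2 : p0 ≤ 2) (K n : ℕ) (F : ℕ × ℕ → X → ℝ) {W : ℝ} (hW : 0 ≤ W)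
    (H : ∀ m ∈ range n, nP p0 (sq (range K) (fun k => F (k, m))) ≤ W) :
    nP p0 (sq (range K ×ˢ range n) F) ≤ (n:ℝ) ^ (1 / p0) * W := by
  apply nP_le_of h0 (by positivity)
  have pt : ∀ x, |sq (range K ×ˢ range n) F x| ^ p0 ≤ ∑ m ∈ range n, |sq (range K) (fun k => F (k, m)) x| ^ p0 := by
    intro x
    have e : ∀ y : ℝ, |y| ^ p0 = (y ^ 2) ^ (p0 / 2) := by
      intro y
      rw [← sq_abs, ← Real.rpow_natCast, ← Real.rpow_mul (abs_nonneg _)]; congr 1; push_cast; ring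
    simp_rw [e, sq_prod_sq]
    exact rpow_sum_le_sum _ _ (fun _ _ => sq_nonneg _) (by linarith) (by linarith)
  calc _ ≤ _ := sum_le_sum fun x _ => pt x
    _ = ∑ m ∈ range n, nP p0 (sq (range K) (fun k => F (k, m))) ^ p0 := by
      rw [sum_comm]; apply sum_congr rfl; intro m _; rw [nP_rpow h0]
    _ ≤ ∑ m ∈ range n, W ^ p0 := sum_le_sum fun m hm => Real.rpow_le_rpow (nP_nonneg _ _) (H m hm) h0.le
    _ = _ := by
      rw [sum_const, card_range, nsmul_eq_mul, Real.mul_rpow (by positivity) hW, ← Real.rpow_mul (by positivity),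
        one_div_mul_cancel h0.ne', Real.rpow_one]

lemma comb2 {p0 : ℝ} (h2 : 2 ≤ p0) (K n : ℕ) (F : ℕ × ℕ → X → ℝ) {W : ℝ} (hW : 0 ≤ W)
    (H : ∀ m ∈ range n, nP p0 (sq (range K) (fun k => F (k, m))) ≤ W) :
    nP p0 (sq (range K ×ˢ range n) F) ≤ (n:ℝ) ^ (1 / 2 : ℝ) * W := by
  have e : ∀ S : X → ℝ, nP p0 S ^ 2 = nP (p0 / 2) (fun x => S x ^ 2) := by
    intro S
    rw [nP_sqfun (by linarith)]; congr 2; ring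
  refine (abs_le_of_sq_le_sq' ?_ (by positivity)).2
  rw [e]
  simp_rw [sq_prod_sq]
  refine (nP_sum_le (by linarith) _ _).trans ?_
  calc _ ≤ ∑ m ∈ range n, W ^ 2 := by
        apply sum_le_sum; intro m hm
        rw [← e]; exact pow_le_pow_left₀ (nP_nonneg _ _) (H m hm) 2
    _ = _ := by
      rw [sum_const, card_range, nsmul_eq_mul, mul_pow, ← Real.rpow_mul_natCast (by positivity)]
      norm_num

end comb

/-- parameters for interpolation -/
lemma params {p : ℝ} (hp1 : 3 / 2 < p) (hp2 : p < 4) : ∃ p0 θ a ε A : ℝ, 1 < p0 ∧ 0 < θ ∧ θ ≤ 1 ∧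
    1 / p = (1 - θ) / p0 + θ / 2 ∧ 0 < ε ∧ ε ≤ 1 / 2 ∧ a * (1 - θ) - (1 / 2 - ε) * θ < 0 ∧ 1 ≤ A ∧
    (∀ d K ν, Ad K ν → ∀ g : ℕ → GG d K → ℝ,
      nP p0 (sq (range K) (fun k => MN d K (ν k) (g k))) ≤ √A * nP p0 (sq (range K) g)) ∧
    (∀ (d K n : ℕ) (F : ℕ × ℕ → GG d K → ℝ) (W : ℝ), 0 ≤ W →
      (∀ m ∈ range n, nP p0 (sq (range K) (fun k => F (k, m))) ≤ W) →
      nP p0 (sq (range K ×ˢ range n) F) ≤ (n:ℝ) ^ a * W) := by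
  have p0 : 0 < p := by linarith
  have eps : ∀ a θ : ℝ, 0 < θ → θ ≤ 1 → 0 ≤ a → a * (1 - θ) < θ / 2 → ∃ ε : ℝ, 0 < ε ∧ ε ≤ 1 / 2 ∧
      a * (1 - θ) - (1 / 2 - ε) * θ < 0 := by
    intro a θ h1 h2 h3 h4
    have := mul_nonneg h3 (sub_nonneg.2 h2)
    refine ⟨(θ / 2 - a * (1 - θ)) / 2, by linarith, by linarith, ?_⟩
    nlinarith
  rcases le_or_gt p 2 with h | h
  · have ip : 1 / 2 ≤ 1 / p := one_div_le_one_div_of_le p0 h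
    have ip1 : 1 / p < 1 := by rw [div_lt_one p0]; linarith
    obtain ⟨c, hc1, hc2⟩ : ∃ c, max (1 / (2 * (p - 1))) (max (1 / p) (3 / 4)) < c ∧ c < 1 := by
      apply _root_.exists_between
      refine max_lt ?_ (max_lt ip1 (by norm_num))
      rw [div_lt_one (by linarith)]; linarith
    rw [max_lt_iff, max_lt_iff] at hc1
    obtain ⟨ha, hb, hc⟩ := hc1
    have c0 : 0 < c := by linarith
    have D0 : 0 < c - 1 / 2 := by linarith
    set θ := (c - 1 / p) / (c - 1 / 2) with hθ
    have t0 : 0 < θ := div_pos (by linarith) D0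
    have t1 : θ ≤ 1 := by rw [hθ, div_le_one D0]; linarith
    have et : θ * (c - 1 / 2) = c - 1 / p := div_mul_cancel₀ _ D0.ne'
    have key : c * (1 - θ) < θ / 2 := by
      rw [← mul_lt_mul_iff_left₀ D0]
      rw [div_lt_iff₀ (by linarith)] at ha
      have : 1 / p < c * (2 * (1 - 1 / p)) := by
        rw [div_lt_iff₀ p0]
        have : c * (2 * (1 - 1 / p)) * p = c * (2 * (p - 1)) := by field_simp
        rw [this]; exact ha
      nlinarith
    obtain ⟨ε, e1, e2, e3⟩ := eps c θ t0 t1 c0.le key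
    have u1 : 1 < 1 / c := by rw [lt_div_iff₀ c0]; linarith
    have u2 : 1 / c < 2 := by rw [div_lt_iff₀ c0]; linarith
    have eq : 1 / c / (2 - 1 / c) = 1 / (2 * c - 1) := by
      have : 2 * c - 1 ≠ 0 := by linarith
      have : 2 - 1 / c ≠ 0 := by linarith
      field_simp
    obtain ⟨A, hA, hM⟩ := Mx_all (q := 1 / c / (2 - 1 / c))
      (by rw [eq, lt_div_iff₀ (by linarith)]; linarith) (by rw [eq, div_lt_iff₀ (by linarith)]; linarith)
    refine ⟨1 / c, θ, c, ε, A, u1, t0, t1, ?_, e1, e2, e3, hA, ?_, ?_⟩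
    · rw [div_div_eq_mul_div, div_one]; linarith
    · intro d K ν hν g
      exact V1 u1 u2 (by linarith) (hM d K) hν g
    · intro d K n F W hW hF
      have := comb1 (by linarith) u2.le K n F hW hF
      rwa [one_div_one_div] at this
  · have ip : 1 / p < 1 / 2 := one_div_lt_one_div_of_lt (by norm_num) h
    have ip1 : 1 / 4 < 1 / p := one_div_lt_one_div_of_lt p0 hp2
    obtain ⟨c, c0, hc1⟩ : ∃ c, 0 < c ∧ c < min (1 / 4) (2 * (1 / p - 1 / 4)) := by
      apply _root_.exists_between
      exact lt_min (by norm_num) (by linarith)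
    rw [lt_min_iff] at hc1
    obtain ⟨ha, hb⟩ := hc1
    have D0 : 0 < 1 / 2 - c := by linarith
    set θ := (1 / p - c) / (1 / 2 - c) with hθ
    have t0 : 0 < θ := div_pos (by linarith) D0
    have t1 : θ ≤ 1 := by rw [hθ, div_le_one D0]; linarith
    have et : θ * (1 / 2 - c) = 1 / p - c := div_mul_cancel₀ _ D0.ne'
    have key : 1 / 2 * (1 - θ) < θ / 2 := by
      rw [← mul_lt_mul_iff_left₀ D0]
      nlinarith
    obtain ⟨ε, e1, e2, e3⟩ := eps (1 / 2) θ t0 t1 (by norm_num) key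
    have u2 : 2 < 1 / c := by rw [lt_div_iff₀ c0]; linarith
    have eq : 1 / c / (1 / c - 2) = 1 / (1 - 2 * c) := by
      have : 1 - 2 * c ≠ 0 := by linarith
      have : 1 / c - 2 ≠ 0 := by linarith
      field_simp
    obtain ⟨A, hA, hM⟩ := Mx_all (q := 1 / c / (1 / c - 2))
      (by rw [eq, lt_div_iff₀ (by linarith)]; linarith) (by rw [eq, div_lt_iff₀ (by linarith)]; linarith)
    refine ⟨1 / c, θ, 1 / 2, ε, A, by linarith, t0, t1, ?_, e1, e2, e3, hA, ?_, ?_⟩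
    · rw [div_div_eq_mul_div, div_one]; linarith
    · intro d K ν hν g
      exact V2 u2 (by linarith) (hM d K) hν g
    · intro d K n F W hW hF
      exact comb2 u2.le K n F hW hF

end DF

open MeasureTheory ENNReal
namespace DF
open Finset

section lev
variable {d K : ℕ}

def bt (l k m : ℕ) : ℕ := if l ≤ k then NN k + 3 ^ (k - l) * m else NN k

lemma bt_Ad {l m : ℕ} (hm : m < 3 ^ l) : Ad K (fun k => bt l k m) := by
  intro k _
  simp only [bt]
  split_ifs with h
  · refine ⟨Nat.le_add_right _ _, ?_⟩
    rw [NN_succ]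
    have : 3 ^ k = 3 ^ (k - l) * 3 ^ l := by rw [← pow_add]; congr 1; omega
    rw [this]
    exact Nat.add_le_add_left (Nat.mul_le_mul_left _ hm.le) _
  · exact ⟨le_rfl, NN_le_succ k⟩

lemma par_lt {l m : ℕ} (hm : m < 3 ^ l) : 3 * (m / 3) < 3 ^ l := lt_of_le_of_lt (Nat.mul_div_le m 3) hm

noncomputable def Db (d K l k m : ℕ) : (GG d K → ℝ) →ₗ[ℝ] (GG d K → ℝ) :=
  MN d K (bt l k m) - MN d K (bt l k (3 * (m / 3)))

lemma Gd_mono {k : ℕ} {θ : Fin d → ℝ} {C C' m : ℝ} (h : C ≤ C') (H : Gd C k θ m) : Gd C' k θ m := by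
  have y0 := yy_nonneg k θ
  exact ⟨H.1.trans (by gcongr), fun hk => (H.2 hk).trans h⟩

lemma OpF_Db {l : ℕ} (hl : 1 ≤ l) : OpF d K (3 ^ l) 1728 ((1 / 3) ^ l) (Db d K l) where
  kill k m c := by rw [Db, LinearMap.sub_apply, MN_const, MN_const, sub_self]
  mult k hk m hm := by
    rw [mem_range] at hk hm
    refine ⟨_, HM_sub (HM_MN _) (HM_MN _), fun θ hθ => ⟨?_, ?_⟩⟩
    · have h1 := bt_Ad (K := K) hm k hk
      have h2 := bt_Ad (K := K) (par_lt hm) k hk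
      have := Gd_sub (Gd_base h1.1 h1.2 hθ) (Gd_base h2.1 h2.2 hθ)
      rw [sub_sub_sub_cancel_right] at this
      exact Gd_mono (by norm_num) this
    · rcases le_or_gt l k with h | h
      · have h2 := bt_Ad (K := K) (par_lt hm) k hk
        have h1 := bt_Ad (K := K) hm k hk
        set N := bt l k (3 * (m / 3)) with hN
        have e : bt l k m = N + 3 ^ (k - l) * (m % 3) := by
          rw [hN, bt, bt, if_pos h, if_pos h, add_assoc, ← mul_add, Nat.div_add_mod]
        have hk1 : 1 ≤ k := hl.trans h
        have n1 : 1 ≤ NN k := by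
          have := NN_spec k
          have h3 : 3 ^ 1 ≤ 3 ^ k := Nat.pow_le_pow_right (by norm_num) hk1
          omega
        have n4 : NN (k + 1) ≤ 4 * NN k := by
          have := NN_spec k
          have := NN_succ k
          omega
        dsimp only at h1 h2
        have hd := mN_diff (N := N) (h := 3 ^ (k - l) * (m % 3)) (d := d) (by omega) (by rw [← e]; omega) hθ
        rw [← e] at hd
        refine hd.trans ?_
        have hN2 : (3:ℝ) ^ k / 3 ≤ N := (NN_ge hk1).trans (by exact_mod_cast h2.1)
        have hm3 : ((m % 3 : ℕ) : ℝ) ≤ 2 := by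
          have := Nat.mod_lt m (show 3 > 0 by norm_num)
          exact_mod_cast (by omega : m % 3 ≤ 2)
        have e3 : (3:ℝ) ^ (k - l) = 3 ^ k * (1 / 3) ^ l := by
          rw [one_div, inv_pow, ← div_eq_mul_inv, _root_.eq_div_iff (by positivity), ← pow_add]; congr 1; omega
        have P : (0:ℝ) < 3 ^ k / 3 := by positivity
        push_cast
        rw [e3, show (1728:ℝ) * (1 / 3) ^ l = 288 * (6 * (1 / 3) ^ l) by ring]
        refine mul_le_mul_of_nonneg_left ?_ (by norm_num)
        rw [div_le_iff₀ (P.trans_le hN2)]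
        calc (3:ℝ) ^ k * (1 / 3) ^ l * ((m % 3 : ℕ) : ℝ) ≤ 3 ^ k * (1 / 3) ^ l * 2 := by gcongr
          _ = 6 * (1 / 3) ^ l * (3 ^ k / 3) := by ring
          _ ≤ _ := by gcongr
      · have : ∀ m, bt l k m = NN k := fun m => by rw [bt, if_neg (by omega)]
        rw [this, this]; simp

lemma W_Db {q A : ℝ} (hq : 1 ≤ q)
    (H : ∀ ν, Ad K ν → ∀ g : ℕ → GG d K → ℝ, nP q (sq (range K) (fun k => MN d K (ν k) (g k))) ≤ √A * nP q (sq (range K) g))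
    {l m : ℕ} (hm : m < 3 ^ l) (g : ℕ → GG d K → ℝ) :
    nP q (sq (range K) (fun k => Db d K l k m (g k))) ≤ 2 * √A * nP q (sq (range K) g) := by
  have h1 := H _ (bt_Ad hm) g
  have h2 := H _ (bt_Ad (par_lt hm)) g
  calc _ ≤ nP q (fun x => sq (range K) (fun k => MN d K (bt l k m) (g k)) x +
        sq (range K) (fun k => MN d K (bt l k (3 * (m / 3))) (g k)) x) := by
        apply nP_mono (by linarith); intro x
        rw [abs_of_nonneg (sq_nonneg' _ _ _)]
        have := sq_add_le (range K) (fun k => MN d K (bt l k m) (g k)) (fun k x => (-1) * MN d K (bt l k (3 * (m / 3))) (g k) x) x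
        rw [sq_smul] at this
        simp only [abs_neg, abs_one, one_mul, neg_mul, ← sub_eq_add_neg] at this
        exact this
    _ ≤ _ := nP_add_le hq _ _
    _ ≤ _ := by linarith

end lev

/-- all square function estimates -/
lemma squares {p : ℝ} (hp1 : 3 / 2 < p) (hp2 : p < 4) : ∃ C ρ : ℝ, 0 ≤ C ∧ 0 < ρ ∧ ρ < 1 ∧ ∀ (d K : ℕ) (f : GG d K → ℝ),
    nP p (sq (range K) (fun k => (MN d K (NN k) - T2 d K k) f)) ≤ C * nP p f ∧
    ∀ l, 1 ≤ l → nP p (sq (range K ×ˢ range (3 ^ l)) (fun i => Db d K l i.1 i.2 f)) ≤ C * ρ ^ l * nP p f := by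
  obtain ⟨p0, θ, a, ε, A, h0, t0, t1, hpe, e0, e1, hex, hA, HV, HC⟩ := params hp1 hp2
  obtain ⟨C1, hC1, H1⟩ := SQ (p := p) (C0 := 24) h0 (by linarith) t0 t1 hpe e0 e1 (by norm_num)
  obtain ⟨C2, hC2, H2⟩ := SQ (p := p) (C0 := 1728) h0 (by linarith) t0 t1 hpe e0 e1 (by norm_num)
  set Ca := C1 * (2 * A) ^ (1 - θ) with hCa
  set Cb := C2 * (2 * √A) ^ (1 - θ) with hCb
  have Ca0 : 0 ≤ Ca := by positivity
  have Cb0 : 0 ≤ Cb := by positivity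
  set ρ : ℝ := 3 ^ (a * (1 - θ) - (1 / 2 - ε) * θ) with hρ
  refine ⟨Ca + Cb, ρ, by positivity, by positivity, Real.rpow_lt_one_of_one_lt_of_neg (by norm_num) hex, fun d K f => ⟨?_, ?_⟩⟩
  · have h := H1 d K 1 1 (2 * A) _ zero_le_one le_rfl (by linarith) (OpF_base (Ad_NN K))
      (fun g => W_base h0.le hA (HV d K) (Ad_NN K) g) f
    rw [sq_prod_one] at h
    simp only [Nat.cast_one, Real.sqrt_one, Real.one_rpow, mul_one] at h
    refine h.trans ?_
    refine mul_le_mul_of_nonneg_right (by linarith) (nP_nonneg _ _)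
  · intro l hl
    have h := H2 d K (3 ^ l) ((1 / 3) ^ l) (((3 ^ l : ℕ) : ℝ) ^ a * (2 * √A)) _ (by positivity)
      (pow_le_one₀ (by norm_num) (by norm_num)) (by positivity) (OpF_Db hl)
      (fun g => by
        rw [mul_assoc]
        refine HC d K _ _ _ (by have := nP_nonneg p0 (sq (range K) g); positivity) fun m hm => ?_
        exact W_Db h0.le (HV d K) (mem_range.1 hm) g) f
    refine h.trans ?_
    refine mul_le_mul_of_nonneg_right ?_ (nP_nonneg _ _)
    have T : (0:ℝ) < 3 := by norm_num
    have e1 : (((3 ^ l : ℕ) : ℝ) ^ a) ^ (1 - θ) = (3:ℝ) ^ (l * (a * (1 - θ))) := by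
      push_cast
      rw [← Real.rpow_natCast, ← Real.rpow_mul T.le, ← Real.rpow_mul T.le]; congr 1; ring
    have e2 : (√((3 ^ l : ℕ) : ℝ) * (((1:ℝ) / 3) ^ l) ^ (1 - ε)) ^ θ = (3:ℝ) ^ (l * (- (1 / 2 - ε) * θ)) := by
      push_cast
      rw [one_div, Real.sqrt_eq_rpow, ← Real.rpow_natCast, inv_pow, ← Real.rpow_natCast 3 l, ← Real.rpow_neg T.le, ← Real.rpow_mul T.le,
        ← Real.rpow_mul T.le, ← Real.rpow_add T, ← Real.rpow_mul T.le]; congr 1; ring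
    rw [Real.mul_rpow (by positivity) (by positivity), e1, e2]
    have e3 : ρ ^ l = (3:ℝ) ^ (l * (a * (1 - θ))) * (3:ℝ) ^ (l * (- (1 / 2 - ε) * θ)) := by
      rw [hρ, ← Real.rpow_add T, ← Real.rpow_mul_natCast T.le]; congr 1; ring
    rw [e3, show C2 * (3 ^ (l * (a * (1 - θ))) * (2 * √A) ^ (1 - θ)) * (3:ℝ) ^ (l * (-(1 / 2 - ε) * θ)) =
      Cb * ((3:ℝ) ^ (l * (a * (1 - θ))) * (3:ℝ) ^ (l * (- (1 / 2 - ε) * θ))) by rw [hCb]; ring]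
    gcongr
    linarith

end DF

open MeasureTheory ENNReal
namespace DF
open Finset

/-- sequences that never return to an abandoned value -/
def NR {ι : Type*} (c : ℕ → ι) : Prop := ∀ i j k, i ≤ j → j ≤ k → c i = c k → c j = c i

lemma nr_var {ι : Type*} {c : ℕ → ι} (hc : NR c) (s : Finset ι) (hs : ∀ j, c j ∈ s) (φ : ι → ℝ) {r : ℝ} (hr : 2 < r) (J : ℕ) :
    (∑ j ∈ range J, |φ (c (j + 1)) - φ (c j)| ^ r) ^ (1 / r) ≤ 2 * √(∑ i ∈ s, φ i ^ 2) := by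
  classical
  have hr0 : 0 < r := by linarith
  set P := (range J).filter (fun j => c (j + 1) ≠ c j) with hP
  have i1 : Set.InjOn (fun j => c (j + 1)) P := by
    intro a ha b hb h
    rw [hP, mem_coe, mem_filter] at ha hb
    dsimp only at h
    rcases lt_trichotomy a b with hl | hl | hl
    · exact absurd ((hc (a + 1) b (b + 1) hl (Nat.le_succ _) h).trans h).symm hb.2
    · exact hl
    · exact absurd ((hc (b + 1) a (a + 1) hl (Nat.le_succ _) h.symm).trans h.symm).symm ha.2
  have i2 : Set.InjOn c P := by
    intro a ha b hb h
    rw [hP, mem_coe, mem_filter] at ha hb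
    rcases lt_trichotomy a b with hl | hl | hl
    · exact absurd (hc a (a + 1) b (Nat.le_succ _) hl h) ha.2
    · exact hl
    · exact absurd (hc b (b + 1) a (Nat.le_succ _) hl h.symm) hb.2
  have s1 : ∀ e : ℕ → ι, (∀ j, e j ∈ s) → Set.InjOn e P → ∑ j ∈ P, φ (e j) ^ 2 ≤ ∑ i ∈ s, φ i ^ 2 := by
    intro e he hi
    rw [← sum_image (f := fun i => φ i ^ 2) hi]
    apply sum_le_sum_of_subset_of_nonneg
    · intro i hi
      obtain ⟨k, hk, rfl⟩ := mem_image.1 hi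
      exact he k
    · intro i _ _; positivity
  have a1 := s1 _ (fun j => hs (j + 1)) i1
  have a2 := s1 _ hs i2
  have a3 : ∑ j ∈ range J, |φ (c (j + 1)) - φ (c j)| ^ 2 ≤ 4 * ∑ i ∈ s, φ i ^ 2 := by
    calc _ = ∑ j ∈ P, |φ (c (j + 1)) - φ (c j)| ^ 2 := by
          rw [hP, sum_filter]
          apply sum_congr rfl; intro j _
          split_ifs with h
          · rfl
          · rw [ne_eq, not_not] at h; rw [h]; simp
      _ ≤ ∑ j ∈ P, (2 * φ (c (j + 1)) ^ 2 + 2 * φ (c j) ^ 2) := by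
          apply sum_le_sum; intro j _
          rw [sq_abs]; nlinarith [sq_nonneg (φ (c (j + 1)) + φ (c j))]
      _ ≤ _ := by rw [sum_add_distrib, ← mul_sum, ← mul_sum]; linarith
  have a4 := rpow_sum_le_sum (range J) (fun j => |φ (c (j + 1)) - φ (c j)| ^ r) (fun _ _ => by positivity)
    (t := 2 / r) (by positivity) (by rw [div_le_one hr0]; exact hr.le)
  have e : ∀ y : ℝ, (|y| ^ r) ^ (2 / r) = |y| ^ 2 := by
    intro y
    rw [← Real.rpow_mul (abs_nonneg _), mul_div_cancel₀ _ hr0.ne', ← Real.rpow_natCast]; norm_num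
  simp_rw [e] at a4
  have S0 : 0 ≤ ∑ i ∈ s, φ i ^ 2 := sum_nonneg fun _ _ => sq_nonneg _
  refine (abs_le_of_sq_le_sq' ?_ (by positivity)).2
  rw [mul_pow, Real.sq_sqrt S0, ← Real.rpow_mul_natCast (sum_nonneg fun _ _ => by positivity)]
  have : 1 / r * ((2:ℕ):ℝ) = 2 / r := by push_cast; ring
  rw [this]
  linarith

/-- triadic scale of `N` -/
def ka (N : ℕ) : ℕ := Nat.log 3 (2 * N + 1)

lemma ka_mono : Monotone ka := fun a b h => Nat.log_mono_right (by omega)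

lemma NN_ka (N : ℕ) : NN (ka N) ≤ N := by
  have h1 := Nat.pow_log_le_self 3 (show 2 * N + 1 ≠ 0 by omega)
  have h2 := NN_spec (ka N)
  unfold ka at *; omega

lemma lt_ka (N : ℕ) : N - NN (ka N) < 3 ^ ka N := by
  have h1 := Nat.lt_pow_succ_log_self (b := 3) (by norm_num) (2 * N + 1)
  have h2 := NN_spec (ka N)
  rw [Nat.succ_eq_add_one, pow_succ] at h1
  unfold ka at *; omega

lemma ka_lt {N K : ℕ} (h : N < NN K) : ka N < K := by
  have h2 := NN_spec K
  apply Nat.log_lt_of_lt_pow (by omega); omega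

/-- cell of `N` at level `l` -/
def ce (l N : ℕ) : ℕ := (N - NN (ka N)) / 3 ^ (ka N - l)

lemma ce_lt (l N : ℕ) : ce l N < 3 ^ l := by
  rw [ce, Nat.div_lt_iff_lt_mul (by positivity), ← pow_add]
  exact (lt_ka N).trans_le (Nat.pow_le_pow_right (by norm_num) (by omega))

lemma ce_NR {u : ℕ → ℕ} (hu : Monotone u) (l : ℕ) : NR (fun j => (ka (u j), ce l (u j))) := by
  intro i j k hij hjk h
  simp only [Prod.mk.injEq] at h ⊢
  have h1 := hu hij
  have h2 := hu hjk
  have k1 := ka_mono h1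
  have k2 := ka_mono h2
  have e1 : ka (u j) = ka (u i) := by omega
  have e2 : ka (u k) = ka (u i) := by omega
  refine ⟨e1, ?_⟩
  obtain ⟨-, h⟩ := h
  unfold ce at *
  rw [e2] at h
  rw [e1]
  apply le_antisymm
  · rw [h]; apply Nat.div_le_div_right; omega
  · apply Nat.div_le_div_right; omega

lemma ka_NR {u : ℕ → ℕ} (hu : Monotone u) : NR (fun j => ka (u j)) := by
  intro i j k hij hjk h
  have k1 := ka_mono (hu hij)
  have k2 := ka_mono (hu hjk)
  dsimp only at *; omega

lemma chain (d K N L : ℕ) (hL : ka N ≤ L) (f : GG d K → ℝ) (x : GG d K) :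
    MN d K N f x = MN d K (NN (ka N)) f x + ∑ l ∈ range L, Db d K (l + 1) (ka N) (ce (l + 1) N) f x := by
  set k := ka N with hk
  set i := N - NN k with hi
  have hz : ∑ l ∈ range L, Db d K (l + 1) k (ce (l + 1) N) f x = ∑ l ∈ range k, Db d K (l + 1) k (ce (l + 1) N) f x := by
    symm
    apply sum_subset (range_subset_range.2 hL)
    intro l _ hl
    rw [mem_range, not_lt] at hl
    rw [Db, bt, bt, if_neg (by omega), if_neg (by omega), sub_self]; rfl
  let a : ℕ → ℝ := fun l => MN d K (NN k + 3 ^ (k - l) * (i / 3 ^ (k - l))) f x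
  have ht : ∀ l ∈ range k, Db d K (l + 1) k (ce (l + 1) N) f x = a (l + 1) - a l := by
    intro l hl
    rw [mem_range] at hl
    have e : 3 ^ (k - (l + 1)) * (3 * (i / 3 ^ (k - (l + 1)) / 3)) = 3 ^ (k - l) * (i / 3 ^ (k - l)) := by
      have : 3 ^ (k - l) = 3 ^ (k - (l + 1)) * 3 := by rw [← pow_succ]; congr 1; omega
      rw [this, Nat.div_div_eq_div_mul, mul_assoc]
    rw [Db, bt, bt, if_pos (by omega), if_pos (by omega), ce, ← hk, ← hi, e]; rfl
  rw [hz, sum_congr rfl ht, sum_range_sub]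
  have a0 : a 0 = MN d K (NN k) f x := by
    simp only [a, Nat.sub_zero]
    rw [Nat.div_eq_of_lt (lt_ka N)]; simp
  have ak : a k = MN d K N f x := by
    simp only [a, Nat.sub_self, pow_zero, Nat.div_one, one_mul]
    have := NN_ka N
    rw [hi, Nat.add_sub_cancel' this]
  rw [a0, ak]; ring

theorem finite_var {p r : ℝ} (hp1 : 3 / 2 < p) (hp2 : p < 4) (hr : 2 < r) : ∃ C : ℝ, 0 ≤ C ∧ ∀ (d K : ℕ) (f : GG d K → ℝ),
    ∃ B : GG d K → ℝ, nP p B ≤ C * nP p f ∧ ∀ x (u : ℕ → ℕ), Monotone u → (∀ j, u j < NN K) → ∀ J,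
      (∑ j ∈ range J, |MN d K (u (j + 1)) f x - MN d K (u j) f x| ^ r) ^ (1 / r) ≤ B x := by
  have hp : 1 < p := by linarith
  obtain ⟨C1, hC1, H1⟩ := T2_var hp hr
  obtain ⟨C2, ρ, hC2, r0, r1, H2⟩ := squares hp1 hp2
  have r2 : 0 < 1 - ρ := by linarith
  refine ⟨C1 + 2 * C2 + 2 * C2 * (1 / (1 - ρ)), by positivity, fun d K f => ?_⟩
  obtain ⟨B, hB1, hB2⟩ := H1 d K f
  obtain ⟨h2, h3⟩ := H2 d K f
  have N0 := nP_nonneg p f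
  let S0 : GG d K → ℝ := sq (range K) (fun k => (MN d K (NN k) - T2 d K k) f)
  let S : ℕ → GG d K → ℝ := fun l => sq (range K ×ˢ range (3 ^ (l + 1))) (fun i => Db d K (l + 1) i.1 i.2 f)
  have sm : ∀ g : GG d K → ℝ, nP p (fun x => 2 * g x) = 2 * nP p g := by
    intro g
    have := nP_smul (show 0 < p by linarith) 2 g
    simpa using this
  refine ⟨fun x => B x + 2 * S0 x + ∑ l ∈ range K, 2 * S l x, ?_, fun x u hu huK J => ?_⟩
  · refine (nP_add_le hp.le _ _).trans ?_
    refine (add_le_add ((nP_add_le hp.le _ _)) (nP_sum_le hp.le _ _)).trans ?_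
    simp_rw [sm]
    have g1 : ∑ l ∈ range K, 2 * nP p (S l) ≤ 2 * C2 * (1 / (1 - ρ)) * nP p f := by
      calc _ ≤ ∑ l ∈ range K, 2 * C2 * nP p f * ρ ^ l := by
            apply sum_le_sum; intro l _
            have := h3 (l + 1) (by omega)
            have q : C2 * ρ ^ (l + 1) * nP p f ≤ C2 * ρ ^ l * nP p f := by
              have : ρ ^ (l + 1) ≤ ρ ^ l := pow_le_pow_of_le_one r0.le r1.le (Nat.le_succ l)
              gcongr
            have e : nP p (S l) ≤ C2 * ρ ^ l * nP p f := this.trans q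
            linarith
        _ = 2 * C2 * nP p f * ∑ l ∈ range K, ρ ^ l := by rw [mul_sum]
        _ ≤ 2 * C2 * nP p f * (1 / (1 - ρ)) := by
            gcongr
            have := geom_sum_mul_neg ρ K
            rw [le_div_iff₀ r2, this]
            have : 0 ≤ ρ ^ K := by positivity
            linarith
        _ = _ := by ring
    have g2 : nP p S0 ≤ C2 * nP p f := h2
    nlinarith
  · let D : ℕ → ℕ → ℝ := fun l j => match l with
      | 0 => T2 d K (ka (u (j + 1))) f x - T2 d K (ka (u j)) f x
      | 1 => (MN d K (NN (ka (u (j + 1)))) - T2 d K (ka (u (j + 1)))) f x - (MN d K (NN (ka (u j))) - T2 d K (ka (u j))) f x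
      | (l + 2) => Db d K (l + 1) (ka (u (j + 1))) (ce (l + 1) (u (j + 1))) f x - Db d K (l + 1) (ka (u j)) (ce (l + 1) (u j)) f x
    have hK : ∀ j, ka (u j) < K := fun j => ka_lt (huK j)
    have e : ∀ j, MN d K (u (j + 1)) f x - MN d K (u j) f x = ∑ l ∈ range (K + 2), D l j := by
      intro j
      rw [sum_range_succ', sum_range_succ']
      simp only [D, zero_add, sum_sub_distrib]
      rw [chain d K (u (j + 1)) K (hK _).le, chain d K (u j) K (hK _).le]
      simp only [LinearMap.sub_apply, Pi.sub_apply]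
      ring
    simp_rw [e]
    refine (lr_sum_le (by linarith) _ J _).trans ?_
    rw [sum_range_succ', sum_range_succ']
    have t1 : (∑ j ∈ range J, |D 0 j| ^ r) ^ (1 / r) ≤ B x :=
      hB2 x (fun j => ka (u j)) (fun a b h => ka_mono (hu h)) (fun j => (hK j).le) J
    have t2 : (∑ j ∈ range J, |D (0 + 1) j| ^ r) ^ (1 / r) ≤ 2 * S0 x :=
      nr_var (ka_NR hu) (range K) (fun j => mem_range.2 (hK j)) (fun k => (MN d K (NN k) - T2 d K k) f x) hr J
    have t3 : ∀ l, (∑ j ∈ range J, |D (l + 1 + 1) j| ^ r) ^ (1 / r) ≤ 2 * S l x := fun l =>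
      nr_var (ce_NR hu (l + 1)) (range K ×ˢ range (3 ^ (l + 1)))
        (fun j => mem_product.2 ⟨mem_range.2 (hK j), mem_range.2 (ce_lt _ _)⟩) (fun i => Db d K (l + 1) i.1 i.2 f x) hr J
    have t4 := sum_le_sum (s := range K) fun l _ => t3 l
    linarith

end DF

open MeasureTheory ENNReal
namespace DF
open Finset

section tr
variable {d K : ℕ}

/-- lift to the lattice -/
def li (d K : ℕ) (y : GG d K) : Fin d → ℤ := fun j => (y j).valMinAbs

/-- projection from the lattice -/
def pj (d K : ℕ) (x : Fin d → ℤ) : GG d K := fun j => (x j : ZMod (3 ^ K))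

lemma li_inj : Function.Injective (li d K) := by
  intro y y' h
  ext1 j
  exact ZMod.injective_valMinAbs (congrFun h j)

lemma li_pj {x : Fin d → ℤ} (h : ∀ j, 2 * |x j| < 3 ^ K) : li d K (pj d K x) = x := by
  ext j
  rw [li, ZMod.valMinAbs_spec]
  refine ⟨rfl, ?_⟩
  have := abs_lt.1 (show |2 * x j| < 3 ^ K by rw [abs_mul]; simpa using h j)
  rw [Set.mem_Ioc]; push_cast
  constructor <;> linarith

/-- real lattice average -/
noncomputable def rA (N : ℕ) (h : (Fin d → ℤ) → ℝ) (x : Fin d → ℤ) : ℝ :=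
  (∑ a : Fin d → Fin (2 * N + 1), h (fun j => x j - ((a j : ℕ) - N))) / Fintype.card (Fin d → Fin (2 * N + 1))

lemma MN_li {N R n : ℕ} (hN : N ≤ n) {x : Fin d → ℤ} (hx : ∀ j, |x j| ≤ R) (hK : 2 * (R + n) < 3 ^ K)
    (h : (Fin d → ℤ) → ℝ) : MN d K N (fun y => h (li d K y)) (pj d K x) = rA N h x := by
  rw [MN, av_apply, rA]
  congr 1
  apply sum_congr rfl; intro a _
  have e : pj d K x - bx d K N a = pj d K (fun j => x j - ((a j : ℕ) - N)) := by
    ext1 j; simp [pj, bx]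
  rw [e, li_pj]
  intro j
  have h1 := abs_le.1 (hx j)
  have h2 := (a j).isLt
  have h3 : |x j - (((a j : ℕ) : ℤ) - N)| ≤ R + n := by rw [abs_le]; constructor <;> omega
  have h4 : (2 * ((R:ℤ) + n)) < 3 ^ K := by exact_mod_cast hK
  linarith

lemma cube_sum {α : Type*} [AddCommMonoid α] (N : ℕ) (f : (Fin d → ℤ) → α) (x : Fin d → ℤ) :
    ∑ y ∈ Finset.Icc (fun _ => -(N:ℤ) : Fin d → ℤ) (fun _ => (N:ℤ)), f (x - y) =
    ∑ a : Fin d → Fin (2 * N + 1), f (fun j => x j - ((a j : ℕ) - N)) := by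
  symm
  refine sum_nbij' (fun a j => ((a j : ℕ) : ℤ) - N) (fun y j => Fin.ofNat (2 * N + 1) (y j + N).toNat) ?_ ?_ ?_ ?_ ?_
  · intro a _
    rw [Finset.mem_Icc, Pi.le_def, Pi.le_def]
    constructor <;> intro j <;> have := (a j).isLt <;> omega
  · intro y _; exact mem_univ _
  · intro a _
    ext j
    have := (a j).isLt
    simp [Nat.mod_eq_of_lt this]
  · intro y hy
    rw [Finset.mem_Icc, Pi.le_def, Pi.le_def] at hy
    ext j
    have h1 := hy.1 j
    have h2 := hy.2 j
    simp only [Fin.val_ofNat]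
    rw [Nat.mod_eq_of_lt (by omega)]; omega
  · intro a _; rfl

lemma cA_eq (N : ℕ) (f : (Fin d → ℤ) → ℂ) (x : Fin d → ℤ) :
    cubeAvg d N f x = (rA N (fun y => (f y).re) x : ℂ) + (rA N (fun y => (f y).im) x : ℂ) * Complex.I := by
  have fl : ⌊(N:ℝ)⌋ = (N:ℤ) := Int.floor_natCast N
  rw [cubeAvg, fl, cube_sum, rA, rA]
  have hc : (Fintype.card (Fin d → Fin (2 * N + 1)) : ℂ) = (((2 * (N:ℤ) + 1) ^ d : ℤ) : ℂ) := by
    simp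
  push_cast at hc ⊢
  rw [hc, div_eq_mul_inv, div_eq_mul_inv, mul_comm]
  rw [mul_right_comm, ← add_mul]
  congr 1
  rw [sum_mul, ← sum_add_distrib]
  apply sum_congr rfl; intro a _
  exact (Complex.re_add_im _).symm

lemma cA_floor {t : ℝ} (ht : 0 < t) (f : (Fin d → ℤ) → ℂ) (x : Fin d → ℤ) :
    cubeAvg d t f x = cubeAvg d ((⌊t⌋₊ : ℕ) : ℝ) f x := by
  have : ⌊t⌋ = ⌊((⌊t⌋₊ : ℕ) : ℝ)⌋ := by
    rw [Int.floor_natCast, Int.natCast_floor_eq_floor ht.le]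
  rw [cubeAvg, cubeAvg, ← this]

end tr

theorem real_var {p r : ℝ} (hp1 : 3 / 2 < p) (hp2 : p < 4) (hr : 2 < r) : ∃ C : ℝ, 0 < C ∧
    ∀ (d : ℕ) (f : (Fin d → ℤ) → ℂ) (s : Finset (Fin d → ℤ)) (R n : ℕ), (∀ x ∈ s, ∀ j, |x j| ≤ R) →
    ∀ (u : (Fin d → ℤ) → ℕ → ℕ) (J : (Fin d → ℤ) → ℕ), (∀ x ∈ s, Monotone (u x) ∧ ∀ j, u x j ≤ n) →
    ∃ t : Finset (Fin d → ℤ), ∑ x ∈ s, ((∑ j ∈ range (J x),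
      ‖cubeAvg d (u x (j + 1)) f x - cubeAvg d (u x j) f x‖ ^ r) ^ (1 / r)) ^ p ≤ C ^ p * ∑ y ∈ t, ‖f y‖ ^ p := by
  obtain ⟨C, hC, H⟩ := finite_var hp1 hp2 hr
  have hp0 : 0 < p := by linarith
  refine ⟨2 * C + 1, by positivity, fun d f s R n hs u J hu => ?_⟩
  classical
  set K := R + n + 1 with hK
  have hNK : K ≤ NN K := by
    have h1 := NN_spec K
    have h2 : 2 * K + 1 ≤ 3 ^ K := by
      clear_value K
      clear h1 hK
      induction K with
      | zero => simp
      | succ k ih => rw [pow_succ]; omega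
    omega
  have hK3 : 2 * (R + n) < 3 ^ K := by have := NN_spec K; omega
  have hli : ∀ x ∈ s, li d K (pj d K x) = x := by
    intro x hx
    apply li_pj; intro j
    have h1 := hs x hx j
    have h4 : (2 * ((R:ℤ) + n)) < 3 ^ K := by exact_mod_cast hK3
    have : (0:ℤ) ≤ n := by positivity
    linarith
  let F : GG d K → ℝ := fun y => ‖f (li d K y)‖
  let g1 : GG d K → ℝ := fun y => (f (li d K y)).re
  let g2 : GG d K → ℝ := fun y => (f (li d K y)).im
  obtain ⟨B1, b1, c1⟩ := H d K g1
  obtain ⟨B2, b2, c2⟩ := H d K g2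
  have m1 : nP p g1 ≤ nP p F := nP_mono hp0 fun x => Complex.abs_re_le_norm _
  have m2 : nP p g2 ≤ nP p F := nP_mono hp0 fun x => Complex.abs_im_le_norm _
  have F0 : 0 ≤ nP p F := nP_nonneg _ _
  have tot : nP p (fun y => B1 y + B2 y) ≤ (2 * C + 1) * nP p F := by
    refine (nP_add_le (by linarith) B1 B2).trans ?_
    nlinarith [mul_le_mul_of_nonneg_left m1 hC, mul_le_mul_of_nonneg_left m2 hC]
  have pt : ∀ x ∈ s, (∑ j ∈ range (J x), ‖cubeAvg d (u x (j + 1)) f x - cubeAvg d (u x j) f x‖ ^ r) ^ (1 / r) ≤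
      B1 (pj d K x) + B2 (pj d K x) := by
    intro x hx
    obtain ⟨um, un⟩ := hu x hx
    have uK : ∀ j, u x j < NN K := fun j => lt_of_le_of_lt (un j) (by omega)
    have d1 := c1 (pj d K x) (u x) um uK (J x)
    have d2 := c2 (pj d K x) (u x) um uK (J x)
    refine le_trans ?_ (add_le_add d1 d2)
    refine le_trans ?_ (Real.Lp_add_le_of_nonneg _ (by linarith) (fun _ _ => abs_nonneg _) (fun _ _ => abs_nonneg _))
    have r0 : 0 < r := by linarith
    refine Real.rpow_le_rpow (sum_nonneg fun _ _ => by positivity) ?_ (by positivity)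
    apply sum_le_sum; intro j _
    refine Real.rpow_le_rpow (norm_nonneg _) ?_ r0.le
    have q1 : ∀ j, MN d K (u x j) g1 (pj d K x) = _ := fun j => MN_li (un j) (hs x hx) hK3 (fun y => (f y).re)
    have q2 : ∀ j, MN d K (u x j) g2 (pj d K x) = _ := fun j => MN_li (un j) (hs x hx) hK3 (fun y => (f y).im)
    rw [q1, q1, q2, q2, cA_eq, cA_eq]
    refine (Complex.norm_le_abs_re_add_abs_im _).trans (le_of_eq ?_)
    simp
  refine ⟨univ.image (li d K), ?_⟩
  rw [sum_image (fun a _ b _ h => li_inj h)]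
  have eF : ∑ y, ‖f (li d K y)‖ ^ p = nP p F ^ p := by
    rw [nP_rpow hp0]; apply sum_congr rfl; intro y _; simp only [F, abs_norm]
  rw [eF, ← Real.mul_rpow (by positivity) F0]
  calc _ ≤ ∑ x ∈ s, |B1 (pj d K x) + B2 (pj d K x)| ^ p := by
        apply sum_le_sum; intro x hx
        exact Real.rpow_le_rpow (Real.rpow_nonneg (sum_nonneg fun _ _ => by positivity) _) ((pt x hx).trans (le_abs_self _)) hp0.le
    _ = ∑ y ∈ s.image (pj d K), |B1 y + B2 y| ^ p := by
        rw [sum_image]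
        intro a ha b hb h
        rw [← hli a ha, ← hli b hb, h]
    _ ≤ ∑ y, |B1 y + B2 y| ^ p := sum_le_sum_of_subset_of_nonneg (subset_univ _) fun _ _ _ => by positivity
    _ = nP p (fun y => B1 y + B2 y) ^ p := (nP_rpow hp0 _).symm
    _ ≤ _ := Real.rpow_le_rpow (nP_nonneg _ _) tot hp0.le

end DF

open MeasureTheory ENNReal

namespace DF
open Finset

/-- bounded monotone sequences with a length -/
def BS : Type := {w : (ℕ → ℕ) × ℕ // Monotone w.1 ∧ ∃ n, ∀ j, w.1 j ≤ n}

instance : Nonempty BS := ⟨⟨(fun _ => 0, 0), fun _ _ _ => le_rfl, 0, fun _ => le_rfl⟩⟩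

lemma sum_iSup_choice {X ι : Type*} [Nonempty ι] (s : Finset X) (F : X → ι → ℝ≥0∞) {R : ℝ≥0∞}
    (H : ∀ c : X → ι, ∑ x ∈ s, F x (c x) ≤ R) : ∑ x ∈ s, ⨆ i, F x i ≤ R := by
  have e : ∀ x, ⨆ i, F x i = ⨆ c : X → ι, F x (c x) := by
    intro x
    apply le_antisymm
    · exact iSup_le fun i => le_iSup (fun c : X → ι => F x (c x)) (fun _ => i)
    · exact iSup_le fun c => le_iSup (F x) (c x)
  simp_rw [e]
  rw [ENNReal.finsetSum_iSup]
  · exact iSup_le H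
  · classical
    intro c c'
    refine ⟨fun x => if F x (c x) ≤ F x (c' x) then c' x else c x, fun x => ?_⟩
    dsimp only
    split_ifs with h
    · exact ⟨h, le_rfl⟩
    · exact ⟨le_rfl, (not_le.1 h).le⟩

/-- variation along one sequence -/
noncomputable def vv (d : ℕ) (r : ℝ) (f : (Fin d → ℤ) → ℂ) (x : Fin d → ℤ) (w : BS) : ℝ :=
  (∑ j ∈ range w.1.2, ‖cubeAvg d (w.1.1 (j + 1)) f x - cubeAvg d (w.1.1 j) f x‖ ^ r) ^ (1 / r)

lemma vv_nonneg (d : ℕ) (r : ℝ) (f : (Fin d → ℤ) → ℂ) (x : Fin d → ℤ) (w : BS) : 0 ≤ vv d r f x w :=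
  Real.rpow_nonneg (sum_nonneg fun _ _ => by positivity) _

lemma varSem_le {d : ℕ} {r : ℝ} (hr : 0 < r) (f : (Fin d → ℤ) → ℂ) (x : Fin d → ℤ) :
    varSem r (Set.Ioi 0) (fun t => cubeAvg d t f x) ≤ ⨆ w, ENNReal.ofReal (vv d r f x w) := by
  unfold varSem
  refine iSup_le fun J => iSup_le fun u => iSup_le fun hu => iSup_le fun hZ => ?_
  have hlt : ∀ j, min j J < J + 1 := fun j => by omega
  let v : ℕ → ℕ := fun j => ⌊u ⟨min j J, hlt j⟩⌋₊
  have hv : Monotone v := by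
    intro a b h
    apply Nat.floor_mono
    apply hu.monotone
    rw [Fin.mk_le_mk]; omega
  have hvb : ∀ j, v j ≤ v J := by
    intro j
    apply Nat.floor_mono
    apply hu.monotone
    rw [Fin.mk_le_mk]; omega
  refine le_trans (le_of_eq ?_) (le_iSup (fun w : BS => ENNReal.ofReal (vv d r f x w)) ⟨(v, J), hv, v J, hvb⟩)
  have S0 : 0 ≤ ∑ j ∈ range J, ‖cubeAvg d (v (j + 1)) f x - cubeAvg d (v j) f x‖ ^ r :=
    sum_nonneg fun _ _ => by positivity
  simp only [vv]
  rw [← ENNReal.ofReal_rpow_of_nonneg S0 (by positivity), Finset.sum_range,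
    ENNReal.ofReal_sum_of_nonneg (fun _ _ => by positivity)]
  congr 1
  apply sum_congr rfl; intro j _
  rw [← ENNReal.ofReal_rpow_of_nonneg (norm_nonneg _) hr.le]
  have e1 : u j.succ = u ⟨min (j + 1) J, hlt _⟩ := by
    congr 1; ext; simp
  have e2 : u j.castSucc = u ⟨min j J, hlt _⟩ := by
    congr 1; ext; simp
  rw [cA_floor (hZ j.succ), cA_floor (hZ j.castSucc), e1, e2, ofReal_norm]
  rfl

end DF

/-- dimension-free `r`-variational estimate over cubes, full range of scales,
for `p ∈ (3/2,4)`, `r ∈ (2,∞)` (Theorem 1.5). -/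
theorem statement5 (p r : ℝ) (hp1 : 3 / 2 < p) (hp2 : p < 4) (hr : 2 < r) :
    ∃ C : ℝ, 0 < C ∧ ∀ (d : ℕ) (f : (Fin d → ℤ) → ℂ),
      lpZ d (ENNReal.ofReal p) (nnC f) ≠ ∞ →
      lpZ d (ENNReal.ofReal p)
          (fun x => varSem r (Set.Ioi 0) (fun t => cubeAvg d t f x))
        ≤ ENNReal.ofReal C * lpZ d (ENNReal.ofReal p) (nnC f) := by
  obtain ⟨C, hC, H⟩ := DF.real_var hp1 hp2 hr
  refine ⟨C, hC, fun d f _ => ?_⟩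
  have hp0 : 0 < p := by linarith
  have ip : 0 ≤ 1 / p := by positivity
  unfold lpZ
  rw [if_neg ENNReal.ofReal_ne_top, if_neg ENNReal.ofReal_ne_top, ENNReal.toReal_ofReal hp0.le]
  set S := ∑' x, nnC f x ^ p with hS
  have main : ∑' x, varSem r (Set.Ioi 0) (fun t => cubeAvg d t f x) ^ p ≤ ENNReal.ofReal C ^ p * S := by
    rw [ENNReal.tsum_eq_iSup_sum]
    refine iSup_le fun s => ?_
    have h1 : ∀ x, varSem r (Set.Ioi 0) (fun t => cubeAvg d t f x) ^ p ≤
        ⨆ w, ENNReal.ofReal (DF.vv d r f x w) ^ p := by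
      intro x
      rw [← ENNReal.le_rpow_inv_iff hp0]
      refine (DF.varSem_le (by linarith) f x).trans (iSup_le fun w => ?_)
      rw [ENNReal.le_rpow_inv_iff hp0]
      exact le_iSup (fun w => ENNReal.ofReal (DF.vv d r f x w) ^ p) w
    refine (Finset.sum_le_sum fun x _ => h1 x).trans (DF.sum_iSup_choice s _ fun c => ?_)
    choose n hn using fun x => (c x).2.2
    obtain ⟨t, ht⟩ := H d f s (∑ x ∈ s, ∑ j, (x j).natAbs) (∑ x ∈ s, n x)
      (by
        intro x hx j
        have a1 : (x j).natAbs ≤ ∑ j, (x j).natAbs :=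
          Finset.single_le_sum (f := fun j => (x j).natAbs) (fun _ _ => Nat.zero_le _) (Finset.mem_univ j)
        have a2 := Finset.single_le_sum (f := fun x : Fin d → ℤ => ∑ j, (x j).natAbs) (fun _ _ => Nat.zero_le _) hx
        rw [Int.abs_eq_natAbs]
        exact_mod_cast a1.trans a2)
      (fun x => (c x).1.1) (fun x => (c x).1.2)
      (fun x hx => ⟨(c x).2.1, fun j => (hn x j).trans (Finset.single_le_sum (f := n) (fun _ _ => Nat.zero_le _) hx)⟩)
    calc ∑ x ∈ s, ENNReal.ofReal (DF.vv d r f x (c x)) ^ p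
        = ENNReal.ofReal (∑ x ∈ s, DF.vv d r f x (c x) ^ p) := by
          rw [ENNReal.ofReal_sum_of_nonneg (fun x _ => Real.rpow_nonneg (DF.vv_nonneg _ _ _ _ _) _)]
          apply Finset.sum_congr rfl; intro x _
          rw [ENNReal.ofReal_rpow_of_nonneg (DF.vv_nonneg _ _ _ _ _) hp0.le]
      _ ≤ ENNReal.ofReal (C ^ p * ∑ y ∈ t, ‖f y‖ ^ p) := ENNReal.ofReal_le_ofReal ht
      _ = ENNReal.ofReal C ^ p * ∑ y ∈ t, nnC f y ^ p := by
          rw [ENNReal.ofReal_mul (by positivity), ENNReal.ofReal_rpow_of_nonneg hC.le hp0.le,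
            ENNReal.ofReal_sum_of_nonneg (fun _ _ => by positivity)]
          congr 1
          apply Finset.sum_congr rfl; intro y _
          rw [← ENNReal.ofReal_rpow_of_nonneg (norm_nonneg _) hp0.le, ofReal_norm]
          rfl
      _ ≤ _ := by
          gcongr
          exact ENNReal.sum_le_tsum t
  refine (ENNReal.rpow_le_rpow main ip).trans (le_of_eq ?_)
  rw [ENNReal.mul_rpow_of_nonneg _ _ ip, ← ENNReal.rpow_mul, mul_one_div_cancel hp0.ne', ENNReal.rpow_one]
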